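/- arXiv:math/9909110 — 4 statements merged into one kernel-verified Lean document; each statement's English description precedes it below -/
import Mathlib

section
/- There is an absolute constant c > 0 and a function C : (0,1) → (0,∞) with the following property. Let X = (ℝⁿ, ‖·‖_X) satisfy ‖x‖_X ≤ ‖x‖₂ for all x, and suppose X admits a John decomposition id = Σ_{j=1}^m c_j u_j ⊗ u_j. Let P be an orthogonal projection on ℝⁿ with rank P = k, and let κ < k be a positive integer. Then there exist contact points x_1, …, x_κ of X with P x_j ≠ 0 such that, setting z_j = P x_j / ‖P x_j‖₂: (i) the system (z_j)_{j≤κ} is C(κ/k)-equivalent in the euclidean norm to the canonical basis of l₂^κ; and (ii) ‖z_j‖_X ≥ c √((k−κ)/n) for all j ≤ κ. -/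
open scoped RealInnerProductSpace

/-- `u` is a contact point of the Banach space `X = (ℝⁿ, N)` (whose unit ball contains
the euclidean unit ball): `‖u‖₂ = N u = 1` and `⟪u, y⟫ ≤ N y` for all `y`. -/
def IsContactPoint {n : ℕ} (N : EuclideanSpace ℝ (Fin n) → ℝ)
    (u : EuclideanSpace ℝ (Fin n)) : Prop :=
  ‖u‖ = 1 ∧ N u = 1 ∧ ∀ y, ⟪u, y⟫ ≤ N y

/-- `N` is a norm on `ℝⁿ` dominated by the euclidean norm which admits a John
decomposition `id = Σⱼ cⱼ uⱼ ⊗ uⱼ` with `cⱼ > 0` and each `uⱼ` a contact point. -/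
def IsJohnNorm {n : ℕ} (N : EuclideanSpace ℝ (Fin n) → ℝ) : Prop :=
  (∀ x, N x ≤ ‖x‖) ∧ (∀ x y, N (x + y) ≤ N x + N y) ∧
  (∀ (a : ℝ) (x), N (a • x) = |a| * N x) ∧ (∀ x, N x = 0 → x = 0) ∧
  ∃ (m : ℕ) (c : Fin m → ℝ) (u : Fin m → EuclideanSpace ℝ (Fin n)),
    (∀ j, 0 < c j) ∧ (∀ j, IsContactPoint N (u j)) ∧
    ∀ v : EuclideanSpace ℝ (Fin n), ∑ j, c j • ⟪u j, v⟫ • u j = v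

section Barrier

variable {E : Type*} [NormedAddCommGroup E] [InnerProductSpace ℝ E]
  {ι : Type*} [Fintype ι]

/-- The rank one operator `x ↦ ⟪v, x⟫ v`. -/
noncomputable def selfRankOne (v : E) : E →ₗ[ℝ] E := (innerₗ E v).smulRight v

@[simp] lemma selfRankOne_apply (v x : E) : selfRankOne v x = ⟪v, x⟫ • v := rfl

lemma selfRankOne_isSymmetric (v : E) : (selfRankOne v).IsSymmetric := by
  intro x y
  simp only [selfRankOne_apply, real_inner_smul_left, real_inner_smul_right]
  rw [real_inner_comm v x]
  ring

/-- `R` is the (symmetric) resolvent `(S - μ)⁻¹`. -/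
structure IsResolvent (S : E →ₗ[ℝ] E) (μ : ℝ) (R : E →ₗ[ℝ] E) : Prop where
  isSymmetric : R.IsSymmetric
  left_inv : ∀ x, R (S x - μ • x) = x

/-- The barrier potential `tr (A R)` for `A = ∑ⱼ dⱼ wⱼ ⊗ wⱼ`. -/
noncomputable def potential (d : ι → ℝ) (w : ι → E) (R : E →ₗ[ℝ] E) : ℝ :=
  ∑ j, d j * ⟪w j, R (w j)⟫

lemma exists_isResolvent [FiniteDimensional ℝ E] {S : E →ₗ[ℝ] E} (hS : S.IsSymmetric) {μ : ℝ}
    (h : ∀ x, S x = μ • x → x = 0) : ∃ R, IsResolvent S μ R := by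
  have hinj : Function.Injective (S - μ • LinearMap.id : E →ₗ[ℝ] E) := by
    rw [injective_iff_map_eq_zero]
    intro x hx
    exact h x (by simpa [sub_eq_zero] using hx)
  let T := LinearEquiv.ofInjectiveEndo _ hinj
  have hT : ∀ x, T x = S x - μ • x := fun x => rfl
  refine ⟨T.symm, ?_, ?_⟩
  · intro x y
    obtain ⟨x, rfl⟩ := T.surjective x
    obtain ⟨y, rfl⟩ := T.surjective y
    rw [LinearEquiv.coe_coe, LinearEquiv.symm_apply_apply, LinearEquiv.symm_apply_apply, hT, hT,
      inner_sub_left, inner_sub_right, real_inner_smul_left, real_inner_smul_right, hS x y]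
  · intro x
    rw [← hT]
    exact T.symm_apply_apply x

lemma IsResolvent.right_inv {S R : E →ₗ[ℝ] E} {μ : ℝ} (hR : IsResolvent S μ R)
    (hS : S.IsSymmetric) (y : E) : S (R y) - μ • R y = y := by
  refine ext_inner_right ℝ fun z => ?_
  rw [inner_sub_left, hS, real_inner_smul_left, ← real_inner_smul_right, ← inner_sub_right,
    hR.isSymmetric, hR.left_inv]

/-- Sherman–Morrison formula. -/
lemma IsResolvent.add_selfRankOne {S R : E →ₗ[ℝ] E} {μ : ℝ} (hR : IsResolvent S μ R) {v : E}
    (hv : 1 + ⟪v, R v⟫ ≠ 0) :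
    IsResolvent (S + selfRankOne v) μ (R - (1 + ⟪v, R v⟫)⁻¹ • selfRankOne (R v)) := by
  refine ⟨?_, fun x => ?_⟩
  · exact hR.isSymmetric.sub ((selfRankOne_isSymmetric (R v)).smul (by simp))
  · have h1 : (S + selfRankOne v) x - μ • x = (S x - μ • x) + ⟪v, x⟫ • v := by
      simp only [LinearMap.add_apply, selfRankOne_apply]; abel
    have h2 : ⟪R v, S x - μ • x⟫ = ⟪v, x⟫ := by rw [hR.isSymmetric, hR.left_inv]
    rw [h1, LinearMap.sub_apply, map_add, hR.left_inv, LinearMap.smul_apply, selfRankOne_apply,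
      inner_add_right, h2, map_smul, real_inner_smul_right, real_inner_comm v (R v), add_sub_assoc,
      smul_smul, ← sub_smul]
    have h3 : ⟪v, x⟫ - (1 + ⟪v, R v⟫)⁻¹ * (⟪v, x⟫ + ⟪v, x⟫ * ⟪v, R v⟫) = 0 := by
      field_simp; ring
    rw [h3, zero_smul, add_zero]

lemma potential_sub_selfRankOne (d : ι → ℝ) (w : ι → E) (R : E →ₗ[ℝ] E)
    (s : ℝ) (v : E) :
    potential d w (R - s • selfRankOne (R v)) =
      potential d w R - s * ∑ l, d l * ⟪w l, R v⟫ ^ 2 := by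
  simp only [potential, LinearMap.sub_apply, LinearMap.smul_apply, selfRankOne_apply,
    inner_sub_right, real_inner_smul_right, Finset.mul_sum, ← Finset.sum_sub_distrib]
  refine Finset.sum_congr rfl fun l _ => ?_
  rw [real_inner_comm (w l) (R v)]
  ring

/-- Averaging: some vector of the family can be added without spoiling the potential. -/
lemma exists_add_vector [Nonempty ι] {d : ι → ℝ} (hd : ∀ j, 0 < d j) {w : ι → E}
    (hA : ∀ v, ∑ j, d j * ⟪w j, v⟫ ^ 2 ≤ ‖v‖ ^ 2) {R : E →ₗ[ℝ] E} {Δ : ℝ} (hΔ : Δ ≠ 0)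
    (h : ∑ j, d j * ‖R (w j)‖ ^ 2 ≤ Δ * (-(∑ j, d j) - potential d w R)) :
    ∃ j, ∑ l, d l * ⟪w l, R (w j)⟫ ^ 2 ≤ Δ * (-1 - ⟪w j, R (w j)⟫) ∧
      0 < Δ * (-1 - ⟪w j, R (w j)⟫) := by
  have hsum : ∑ j, d j * ∑ l, d l * ⟪w l, R (w j)⟫ ^ 2 ≤
      ∑ j, d j * (Δ * (-1 - ⟪w j, R (w j)⟫)) := by
    calc _ ≤ ∑ j, d j * ‖R (w j)‖ ^ 2 :=
          Finset.sum_le_sum fun j _ => mul_le_mul_of_nonneg_left (hA _) (hd j).le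
      _ ≤ _ := h
      _ = _ := by
          rw [potential, ← Finset.sum_neg_distrib, ← Finset.sum_sub_distrib, Finset.mul_sum]
          exact Finset.sum_congr rfl fun j _ => by ring
  obtain ⟨j, -, hj⟩ := Finset.exists_le_of_sum_le Finset.univ_nonempty hsum
  have hj := le_of_mul_le_mul_left hj (hd j)
  refine ⟨j, hj, ?_⟩
  have h1 : d j * ⟪w j, R (w j)⟫ ^ 2 ≤ ∑ l, d l * ⟪w l, R (w j)⟫ ^ 2 :=
    Finset.single_le_sum (f := fun l => d l * ⟪w l, R (w j)⟫ ^ 2)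
      (fun l _ => mul_nonneg (hd l).le (sq_nonneg _)) (Finset.mem_univ j)
  by_contra hneg
  push Not at hneg
  have h2 : d j * ⟪w j, R (w j)⟫ ^ 2 ≤ 0 := h1.trans (hj.trans hneg)
  have h3 : ⟪w j, R (w j)⟫ = 0 := by
    have := nonpos_of_mul_nonpos_right h2 (hd j)
    exact pow_eq_zero_iff two_ne_zero |>.1 (le_antisymm this (sq_nonneg _))
  have h4 : Δ * (-1 - ⟪w j, R (w j)⟫) = 0 :=
    le_antisymm hneg (le_trans (mul_nonneg (hd j).le (sq_nonneg _)) (h1.trans hj))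
  rw [h3] at h4
  simp at h4
  exact hΔ h4

section Spectral

variable {κ : Type*} [Fintype κ] (e : OrthonormalBasis κ ℝ E) (d : ι → ℝ) (w : ι → E)

/-- The diagonal entries of `A = ∑ⱼ dⱼ wⱼ ⊗ wⱼ` in the basis `e`. -/
noncomputable def diagWeight (i : κ) : ℝ := ∑ j, d j * ⟪w j, e i⟫ ^ 2

variable {e d w}

lemma diagWeight_nonneg (hd : ∀ j, 0 < d j) (i : κ) : 0 ≤ diagWeight e d w i :=
  Finset.sum_nonneg fun j _ => mul_nonneg (hd j).le (sq_nonneg _)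

lemma diagWeight_le_one (hA : ∀ v, ∑ j, d j * ⟪w j, v⟫ ^ 2 ≤ ‖v‖ ^ 2) (i : κ) :
    diagWeight e d w i ≤ 1 := by
  simpa [e.norm_eq_one, diagWeight] using hA (e i)

lemma sum_diagWeight (hw : ∀ j, ‖w j‖ = 1) : ∑ i, diagWeight e d w i = ∑ j, d j := by
  simp only [diagWeight]
  rw [Finset.sum_comm]
  refine Finset.sum_congr rfl fun j _ => ?_
  rw [← Finset.mul_sum, e.sum_sq_inner_left, hw]
  simp

variable {S R : E →ₗ[ℝ] E} {μ : ℝ} {lam : κ → ℝ}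

lemma IsResolvent.sub_ne_zero (hR : IsResolvent S μ R) (he : ∀ i, S (e i) = lam i • e i) (i : κ) :
    lam i - μ ≠ 0 := by
  intro h
  have h1 := hR.left_inv (e i)
  rw [he, ← sub_smul, h, zero_smul, map_zero] at h1
  have := e.norm_eq_one i
  rw [← h1] at this
  simp at this

lemma IsResolvent.apply_basis (hR : IsResolvent S μ R) (he : ∀ i, S (e i) = lam i • e i) (i : κ) :
    R (e i) = (lam i - μ)⁻¹ • e i := by
  have h1 := hR.left_inv (e i)
  rw [he, ← sub_smul, map_smul] at h1
  rw [eq_inv_smul_iff₀ (hR.sub_ne_zero he i), h1]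

lemma IsResolvent.inner_apply (hR : IsResolvent S μ R) (he : ∀ i, S (e i) = lam i • e i) (x : E)
    (i : κ) : ⟪R x, e i⟫ = (lam i - μ)⁻¹ * ⟪x, e i⟫ := by
  rw [hR.isSymmetric, hR.apply_basis he, real_inner_smul_right]

lemma IsResolvent.potential_eq (hR : IsResolvent S μ R) (he : ∀ i, S (e i) = lam i • e i) :
    potential d w R = ∑ i, diagWeight e d w i * (lam i - μ)⁻¹ := by
  simp only [potential, diagWeight, Finset.sum_mul]
  rw [Finset.sum_comm]
  refine Finset.sum_congr rfl fun j _ => ?_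
  rw [← e.sum_inner_mul_inner (w j) (R (w j)), Finset.mul_sum]
  refine Finset.sum_congr rfl fun i _ => ?_
  rw [real_inner_comm (R (w j)) (e i), hR.inner_apply he]
  ring

lemma IsResolvent.sum_norm_sq_eq (hR : IsResolvent S μ R) (he : ∀ i, S (e i) = lam i • e i) :
    ∑ j, d j * ‖R (w j)‖ ^ 2 = ∑ i, diagWeight e d w i * ((lam i - μ)⁻¹) ^ 2 := by
  simp only [diagWeight, Finset.sum_mul]
  rw [Finset.sum_comm]
  refine Finset.sum_congr rfl fun j _ => ?_
  rw [← e.sum_sq_inner_left (R (w j)), Finset.mul_sum]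
  refine Finset.sum_congr rfl fun i _ => ?_
  rw [hR.inner_apply he]
  ring

end Spectral

lemma upper_barrier_ineq {κ : Type*} [Fintype κ] {a lam : κ → ℝ} {u t p δ : ℝ}
    (ha : ∀ i, 0 ≤ a i) (hat : ∑ i, a i = t) (ht : 0 < t) (hlam : ∀ i, lam i < u) (hδ : 0 < δ)
    (hp : δ * (t - p) = 1) (hφ : -p ≤ ∑ i, a i * (lam i - u)⁻¹) :
    (∑ i, a i * (lam i - u)⁻¹) - (∑ i, a i * (lam i - (u + δ))⁻¹) < 0 ∧
    ∑ i, a i * ((lam i - (u + δ))⁻¹) ^ 2 ≤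
      ((∑ i, a i * (lam i - u)⁻¹) - (∑ i, a i * (lam i - (u + δ))⁻¹)) *
        (-t - ∑ i, a i * (lam i - (u + δ))⁻¹) := by
  set φ := ∑ i, a i * (lam i - u)⁻¹
  set φ' := ∑ i, a i * (lam i - (u + δ))⁻¹
  set Q := ∑ i, a i * ((lam i - (u + δ))⁻¹) ^ 2 with hQ
  have hdiff : δ * Q ≤ φ' - φ := by
    rw [hQ, Finset.mul_sum, ← Finset.sum_sub_distrib]
    refine Finset.sum_le_sum fun i _ => ?_
    have hx : 0 < u - lam i := sub_pos.2 (hlam i)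
    have key : δ * ((lam i - (u + δ))⁻¹) ^ 2 ≤ (lam i - (u + δ))⁻¹ - (lam i - u)⁻¹ := by
      have e1 : lam i - (u + δ) = -((u - lam i) + δ) := by ring
      have e2 : lam i - u = -(u - lam i) := by ring
      rw [e1, e2]
      generalize u - lam i = x at hx
      rw [inv_neg, inv_neg, neg_sq]
      have : -(x + δ)⁻¹ - -x⁻¹ - δ * ((x + δ)⁻¹) ^ 2 = δ ^ 2 / (x * (x + δ) ^ 2) := by
        field_simp; ring
      have h2 : 0 ≤ δ ^ 2 / (x * (x + δ) ^ 2) := by positivity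
      linarith
    nlinarith [mul_le_mul_of_nonneg_left key (ha i)]
  have hQpos : 0 < Q := by
    obtain ⟨i, -, hi⟩ : ∃ i ∈ Finset.univ, 0 < a i :=
      Finset.exists_lt_of_sum_lt (by simpa [hat] using ht)
    refine Finset.sum_pos' (fun i _ => mul_nonneg (ha i) (sq_nonneg _)) ⟨i, Finset.mem_univ i, ?_⟩
    have : lam i - (u + δ) ≠ 0 := by linarith [hlam i]
    positivity
  have h1 : 0 < δ * Q := by positivity
  refine ⟨by linarith, ?_⟩
  nlinarith [mul_le_mul_of_nonneg_right hdiff (show 0 ≤ t + φ' by nlinarith),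
    mul_le_mul_of_nonneg_left (show t - p ≤ t + φ' by linarith) h1.le]

lemma lower_barrier_ineq {κ : Type*} [Fintype κ] {a lam : κ → ℝ} {b t δ : ℝ} {m : ℕ}
    (ha : ∀ i, 0 ≤ a i) (ha1 : ∀ i, a i ≤ 1) (hat : ∑ i, a i = t)
    (hlam : ∀ i, lam i ≠ 0 → b < lam i) (hδ : 0 < δ) (hδb : δ < b)
    (hcard : Fintype.card {i // lam i ≠ 0} ≤ m) (hm : b ≤ δ * (t - m))
    (hφ : ∑ i, a i * (lam i - b)⁻¹ ≤ -t - δ⁻¹) :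
    0 < (∑ i, a i * (lam i - b)⁻¹) - (∑ i, a i * (lam i - (b - δ))⁻¹) ∧
    ∑ i, a i * ((lam i - (b - δ))⁻¹) ^ 2 ≤
      ((∑ i, a i * (lam i - b)⁻¹) - (∑ i, a i * (lam i - (b - δ))⁻¹)) *
        (-t - ∑ i, a i * (lam i - (b - δ))⁻¹) := by
  classical
  set φ := ∑ i, a i * (lam i - b)⁻¹
  set φ' := ∑ i, a i * (lam i - (b - δ))⁻¹
  set Q := ∑ i, a i * ((lam i - (b - δ))⁻¹) ^ 2 with hQ
  set q := ∑ i, if lam i = 0 then a i else 0 with hq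
  have hqt : t - m ≤ q := by
    have h1 : t = q + ∑ i, if lam i ≠ 0 then a i else 0 := by
      rw [← hat, hq, ← Finset.sum_add_distrib]
      refine Finset.sum_congr rfl fun i _ => ?_
      by_cases h : lam i = 0 <;> simp [h]
    have h2 : (∑ i, if lam i ≠ 0 then a i else 0) ≤ m := by
      rw [← Finset.sum_filter]
      calc _ ≤ ∑ i ∈ Finset.univ.filter (fun i => lam i ≠ 0), (1 : ℝ) :=
            Finset.sum_le_sum fun i _ => ha1 i
        _ = (Fintype.card {i // lam i ≠ 0} : ℝ) := by
            rw [Fintype.card_subtype]; simp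
        _ ≤ m := by exact_mod_cast hcard
    linarith
  have hb : 0 < b := hδ.trans hδb
  have hb' : 0 < b - δ := sub_pos.2 hδb
  have hqδ : b ≤ δ * q := hm.trans (mul_le_mul_of_nonneg_left hqt hδ.le)
  have hqpos : 0 < q := by
    by_contra h
    nlinarith
  have hdiff : q * (δ / (b * (b - δ))) ≤ φ - φ' := by
    rw [hq, Finset.sum_mul, ← Finset.sum_sub_distrib]
    refine Finset.sum_le_sum fun i _ => ?_
    rw [← mul_sub]
    by_cases h : lam i = 0
    · rw [if_pos h, h]
      refine le_of_eq ?_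
      congr 1
      rw [zero_sub, zero_sub, inv_neg, inv_neg]
      field_simp
      ring
    · rw [if_neg h, zero_mul]
      refine mul_nonneg (ha i) (sub_nonneg.2 ?_)
      have := hlam i h
      exact inv_anti₀ (by linarith) (by linarith)
  have hQle : Q ≤ (φ - φ') * δ⁻¹ + q * (δ / (b * (b - δ) ^ 2)) := by
    rw [hQ, hq, Finset.sum_mul, ← Finset.sum_sub_distrib, Finset.sum_mul,
      ← Finset.sum_add_distrib]
    refine Finset.sum_le_sum fun i _ => ?_
    rw [← mul_sub, mul_assoc]
    by_cases h : lam i = 0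
    · rw [if_pos h, h, ← mul_add]
      refine le_of_eq ?_
      congr 1
      rw [zero_sub, zero_sub, inv_neg, inv_neg]
      field_simp
      ring
    · rw [if_neg h, zero_mul, add_zero]
      refine mul_le_mul_of_nonneg_left ?_ (ha i)
      have hx : 0 < lam i - b := sub_pos.2 (hlam i h)
      have e1 : lam i - (b - δ) = (lam i - b) + δ := by ring
      rw [e1]
      generalize lam i - b = x at hx
      have : (x⁻¹ - (x + δ)⁻¹) * δ⁻¹ - ((x + δ)⁻¹) ^ 2 = δ / (x * (x + δ) ^ 2) := by
        field_simp; ring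
      have h2 : 0 ≤ δ / (x * (x + δ) ^ 2) := by positivity
      linarith
  have hpos : 0 < q * (δ / (b * (b - δ))) := by positivity
  have hsq : q * (δ / (b * (b - δ) ^ 2)) ≤ (φ - φ') ^ 2 := by
    calc q * (δ / (b * (b - δ) ^ 2)) = (q * δ * b) / (b * (b - δ)) ^ 2 := by
          field_simp
      _ ≤ (q * δ * (δ * q)) / (b * (b - δ)) ^ 2 := by gcongr
      _ = (q * (δ / (b * (b - δ)))) ^ 2 := by field_simp
      _ ≤ _ := by gcongr
  refine ⟨hpos.trans_le hdiff, ?_⟩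
  have h3 : (φ - φ') * (δ⁻¹ + (φ - φ')) ≤ (φ - φ') * (-t - φ') :=
    mul_le_mul_of_nonneg_left (by linarith) (hpos.trans_le hdiff).le
  nlinarith

lemma upper_barrier_step [FiniteDimensional ℝ E] [Nonempty ι] {d : ι → ℝ} (hd : ∀ j, 0 < d j)
    {w : ι → E} (hw : ∀ j, ‖w j‖ = 1) (hA : ∀ v, ∑ j, d j * ⟪w j, v⟫ ^ 2 ≤ ‖v‖ ^ 2)
    {S R : E →ₗ[ℝ] E} (hS : S.IsSymmetric) {u p δ : ℝ} (hu : ∀ x, ⟪S x, x⟫ ≤ u * ‖x‖ ^ 2)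
    (hR : IsResolvent S u R) (hδ : 0 < δ) (hp : δ * (∑ j, d j - p) = 1)
    (hφ : -p ≤ potential d w R) :
    ∃ j R', IsResolvent (S + selfRankOne (w j)) (u + δ) R' ∧ -p ≤ potential d w R' ∧
      ∀ x, ⟪(S + selfRankOne (w j)) x, x⟫ ≤ (u + δ) * ‖x‖ ^ 2 := by
  have ht : 0 < ∑ j, d j := Finset.sum_pos (fun j _ => hd j) Finset.univ_nonempty
  obtain ⟨Q, hQ⟩ : ∃ Q, IsResolvent S (u + δ) Q := by
    refine exists_isResolvent hS fun x hx => ?_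
    have := hu x
    rw [hx, real_inner_smul_left, real_inner_self_eq_norm_sq] at this
    have h2 : ‖x‖ ^ 2 = 0 := le_antisymm (by nlinarith) (sq_nonneg _)
    simpa using h2
  let e := hS.eigenvectorBasis rfl
  have he : ∀ i, S (e i) = hS.eigenvalues rfl i • e i := fun i => hS.apply_eigenvectorBasis rfl i
  have hlam : ∀ i, hS.eigenvalues rfl i < u := fun i => by
    have := hu (e i)
    rw [he, real_inner_smul_left, real_inner_self_eq_norm_sq, e.norm_eq_one] at this
    exact lt_of_le_of_ne (by linarith) (sub_ne_zero.1 (hR.sub_ne_zero he i))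
  obtain ⟨hneg, hmain⟩ := upper_barrier_ineq (fun i => diagWeight_nonneg (e := e) hd i)
    (sum_diagWeight hw) ht hlam hδ hp (by rwa [hR.potential_eq he] at hφ)
  rw [← hR.potential_eq he, ← hQ.potential_eq he] at hneg hmain
  rw [← hQ.sum_norm_sq_eq he] at hmain
  obtain ⟨j, hj, hjpos⟩ := exists_add_vector hd hA hneg.ne hmain
  have hc : 0 < 1 + ⟪w j, Q (w j)⟫ := by
    by_contra h
    nlinarith
  refine ⟨j, _, hQ.add_selfRankOne hc.ne', ?_, ?_⟩
  · rw [potential_sub_selfRankOne]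
    have h1 : (1 + ⟪w j, Q (w j)⟫)⁻¹ * ∑ l, d l * ⟪w l, Q (w j)⟫ ^ 2 ≤
        potential d w Q - potential d w R := by
      rw [inv_mul_le_iff₀ hc]
      linarith
    linarith
  · intro x
    have hF : ∀ z, ⟪S z, z⟫ ≤ (u + δ) * ‖z‖ ^ 2 := fun z =>
      (hu z).trans (by nlinarith [sq_nonneg ‖z‖])
    have h1 := hF (x + ⟪w j, x⟫ • Q (w j))
    have hSQ : S (Q (w j)) = w j + (u + δ) • Q (w j) := by
      rw [← sub_eq_iff_eq_add, hQ.right_inv hS]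
    have hxQ : ⟪S x, Q (w j)⟫ = ⟪w j, x⟫ + (u + δ) * ⟪x, Q (w j)⟫ := by
      rw [hS, hSQ, inner_add_right, real_inner_smul_right, real_inner_comm]
    rw [norm_add_sq_real, map_add, map_smul, inner_add_left, inner_add_right, inner_add_right,
      hSQ, norm_smul, mul_pow, Real.norm_eq_abs, sq_abs] at h1
    simp only [real_inner_smul_left, real_inner_smul_right, inner_add_left, hxQ,
      real_inner_self_eq_norm_sq] at h1
    rw [real_inner_comm x (Q (w j))] at h1
    rw [LinearMap.add_apply, selfRankOne_apply, inner_add_left, real_inner_smul_left]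
    nlinarith [mul_nonneg (sq_nonneg ⟪w j, x⟫) hc.le]

/-- If the Gram matrix of `v` is at least `b`, so are the nonzero eigenvalues of its frame
operator. -/
lemma le_eigenvalue_of_gram {m : ℕ} {v : Fin m → E} {b : ℝ}
    (hb : ∀ a : Fin m → ℝ, b * ∑ i, a i ^ 2 ≤ ‖∑ i, a i • v i‖ ^ 2) {e : E} (he1 : ‖e‖ = 1)
    {l : ℝ} (he : (∑ i, selfRankOne (v i)) e = l • e) (hl : l ≠ 0) : b ≤ l := by
  have h1 := hb (fun i => ⟪v i, e⟫)
  rw [LinearMap.sum_apply] at he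
  simp only [selfRankOne_apply] at he
  have h2 : ∑ i, ⟪v i, e⟫ ^ 2 = l := by
    have := congrArg (fun z => ⟪z, e⟫) he
    simp only [sum_inner, real_inner_smul_left, real_inner_self_eq_norm_sq, he1] at this
    rw [one_pow, mul_one] at this
    rw [← this]
    exact Finset.sum_congr rfl fun i _ => sq _
  rw [he, h2, norm_smul, he1, mul_one, Real.norm_eq_abs, sq_abs] at h1
  have h3 : 0 ≤ l := h2 ▸ Finset.sum_nonneg fun i _ => sq_nonneg _
  have h4 : 0 < l := lt_of_le_of_ne h3 hl.symm
  nlinarith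

lemma card_nonzero_eigenvalues_le {κ : Type*} [Fintype κ] {m : ℕ} {v : Fin m → E}
    (e : OrthonormalBasis κ ℝ E) {lam : κ → ℝ} [Fintype {i // lam i ≠ 0}]
    (he : ∀ i, (∑ i, selfRankOne (v i)) (e i) = lam i • e i) :
    Fintype.card {i // lam i ≠ 0} ≤ m := by
  have hmem : ∀ i : {i // lam i ≠ 0}, e i ∈ Submodule.span ℝ (Set.range v) := by
    rintro ⟨i, hi⟩
    have h1 := he i
    have h2 : e i = (lam i)⁻¹ • ∑ l, ⟪v l, e i⟫ • v l := by
      rw [LinearMap.sum_apply] at h1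
      simp only [selfRankOne_apply] at h1
      rw [h1, smul_smul, inv_mul_cancel₀ hi, one_smul]
    change e i ∈ _
    rw [h2]
    exact Submodule.smul_mem _ _ (Submodule.sum_mem _ fun l _ =>
      Submodule.smul_mem _ _ (Submodule.subset_span ⟨l, rfl⟩))
  have hli : LinearIndependent ℝ (fun i : {i // lam i ≠ 0} => e i) :=
    e.orthonormal.linearIndependent.comp _ Subtype.val_injective
  have : Module.Finite ℝ (Submodule.span ℝ (Set.range v)) :=
    FiniteDimensional.span_of_finite ℝ (Set.finite_range v)
  have hli2 : LinearIndependent ℝ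
      (fun i : {i // lam i ≠ 0} => (⟨e i, hmem i⟩ : Submodule.span ℝ (Set.range v))) :=
    LinearIndependent.of_comp (Submodule.span ℝ (Set.range v)).subtype hli
  calc _ ≤ Module.finrank ℝ (Submodule.span ℝ (Set.range v)) := hli2.fintype_card_le_finrank
    _ ≤ Fintype.card (Fin m) := finrank_range_le_card v
    _ = m := Fintype.card_fin m

lemma gram_snoc {m : ℕ} {v : Fin m → E} {b : ℝ} {R : E →ₗ[ℝ] E}
    (hb : ∀ a : Fin m → ℝ, b * ∑ i, a i ^ 2 ≤ ‖∑ i, a i • v i‖ ^ 2) (hb0 : 0 ≤ b)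
    (hR : ∀ y, (∑ i, selfRankOne (v i)) (R y) - b • R y = y) {x : E} (hx : ⟪x, R x⟫ ≤ -1)
    (a : Fin (m + 1) → ℝ) :
    b * ∑ i, a i ^ 2 ≤ ‖∑ i, a i • (Fin.snoc v x : Fin (m + 1) → E) i‖ ^ 2 := by
  rw [Fin.sum_univ_castSucc, Fin.sum_univ_castSucc]
  simp only [Fin.snoc_castSucc, Fin.snoc_last]
  set s := a (Fin.last m)
  set y := R x
  have hSy : ∑ i, ⟪v i, y⟫ • v i = x + b • y := by
    have := hR x
    rw [sub_eq_iff_eq_add, LinearMap.sum_apply] at this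
    simpa using this
  have hyy : ∑ i, ⟪v i, y⟫ ^ 2 = ⟪x, y⟫ + b * ‖y‖ ^ 2 := by
    have := congrArg (fun z => ⟪z, y⟫) hSy
    simp only [sum_inner, real_inner_smul_left, inner_add_left, real_inner_self_eq_norm_sq] at this
    rw [← this]
    exact Finset.sum_congr rfl fun i _ => sq _
  let h : Fin m → ℝ := fun i => a i.castSucc + s * ⟪v i, y⟫
  have h1 := hb h
  have e1 : ∑ i : Fin m, a i.castSucc • v i + s • x = ∑ i, h i • v i - (s * b) • y := by
    simp only [h, add_smul, Finset.sum_add_distrib, mul_smul, ← Finset.smul_sum, hSy]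
    rw [smul_add]
    abel
  have e2 : ∑ i : Fin m, a i.castSucc ^ 2 = ∑ i, h i ^ 2 - 2 * s * ∑ i, h i * ⟪v i, y⟫
      + s ^ 2 * ∑ i, ⟪v i, y⟫ ^ 2 := by
    simp only [Finset.mul_sum, ← Finset.sum_sub_distrib, ← Finset.sum_add_distrib, h]
    exact Finset.sum_congr rfl fun i _ => by ring
  have e3 : ⟪∑ i, h i • v i, (s * b) • y⟫ = s * b * ∑ i, h i * ⟪v i, y⟫ := by
    rw [real_inner_smul_right, sum_inner]
    simp only [real_inner_smul_left]
  rw [e1, e2, norm_sub_sq_real, e3, hyy, norm_smul, mul_pow, Real.norm_eq_abs, sq_abs]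
  nlinarith [mul_nonneg (mul_nonneg (sq_nonneg s) hb0) (show 0 ≤ -1 - ⟪x, y⟫ by linarith)]

lemma sum_selfRankOne_isSymmetric {m : ℕ} (v : Fin m → E) :
    (∑ i, selfRankOne (v i)).IsSymmetric := by
  intro x y
  simp only [LinearMap.sum_apply, sum_inner, inner_sum]
  exact Finset.sum_congr rfl fun i _ => selfRankOne_isSymmetric (v i) x y

lemma lower_barrier_step [FiniteDimensional ℝ E] [Nonempty ι] {d : ι → ℝ} (hd : ∀ j, 0 < d j)
    {w : ι → E} (hw : ∀ j, ‖w j‖ = 1) (hA : ∀ v, ∑ j, d j * ⟪w j, v⟫ ^ 2 ≤ ‖v‖ ^ 2)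
    {m : ℕ} {v : Fin m → E} {b δ : ℝ} {R : E →ₗ[ℝ] E}
    (hb : ∀ a : Fin m → ℝ, b * ∑ i, a i ^ 2 ≤ ‖∑ i, a i • v i‖ ^ 2)
    (hR : IsResolvent (∑ i, selfRankOne (v i)) b R) (hδ : 0 < δ) (hδb : δ < b)
    (hm : b ≤ δ * (∑ j, d j - m)) (hφ : potential d w R ≤ -(∑ j, d j) - δ⁻¹) :
    ∃ j R', IsResolvent (∑ i, selfRankOne (v i) + selfRankOne (w j)) (b - δ) R' ∧
      potential d w R' ≤ -(∑ j, d j) - δ⁻¹ ∧ ∀ a : Fin (m + 1) → ℝ,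
        (b - δ) * ∑ i, a i ^ 2 ≤ ‖∑ i, a i • (Fin.snoc v (w j) : Fin (m + 1) → E) i‖ ^ 2 := by
  have hS := sum_selfRankOne_isSymmetric v
  let e := hS.eigenvectorBasis rfl
  have he : ∀ i, (∑ i, selfRankOne (v i)) (e i) = hS.eigenvalues rfl i • e i :=
    fun i => hS.apply_eigenvectorBasis rfl i
  have hlam : ∀ i, hS.eigenvalues rfl i ≠ 0 → b < hS.eigenvalues rfl i := fun i hi =>
    lt_of_le_of_ne (le_eigenvalue_of_gram hb (e.norm_eq_one i) (he i) hi)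
      (sub_ne_zero.1 (hR.sub_ne_zero he i)).symm
  obtain ⟨Q, hQ⟩ : ∃ Q, IsResolvent (∑ i, selfRankOne (v i)) (b - δ) Q := by
    refine exists_isResolvent hS fun x hx => ?_
    by_contra hx0
    have h1 := le_eigenvalue_of_gram hb (e := ‖x‖⁻¹ • x) (l := b - δ)
      (norm_smul_inv_norm hx0) (by rw [map_smul, hx, smul_comm]) (by linarith)
    linarith
  obtain ⟨hpos, hmain⟩ := lower_barrier_ineq (fun i => diagWeight_nonneg (e := e) hd i)
    (diagWeight_le_one hA) (sum_diagWeight hw) hlam hδ hδb (card_nonzero_eigenvalues_le e he) hm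
    (by rwa [hR.potential_eq he] at hφ)
  rw [← hR.potential_eq he, ← hQ.potential_eq he] at hpos hmain
  rw [← hQ.sum_norm_sq_eq he] at hmain
  obtain ⟨j, hj, hjpos⟩ := exists_add_vector hd hA hpos.ne' hmain
  have hc : 0 < -1 - ⟪w j, Q (w j)⟫ := pos_of_mul_pos_right hjpos hpos.le
  have hc' : 1 + ⟪w j, Q (w j)⟫ = -(-1 - ⟪w j, Q (w j)⟫) := by ring
  refine ⟨j, _, hQ.add_selfRankOne (by linarith), ?_, ?_⟩
  · rw [potential_sub_selfRankOne, hc', inv_neg]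
    have h1 : (-1 - ⟪w j, Q (w j)⟫)⁻¹ * ∑ l, d l * ⟪w l, Q (w j)⟫ ^ 2 ≤
        potential d w R - potential d w Q := by
      rw [inv_mul_le_iff₀ hc]
      linarith
    linarith
  · refine gram_snoc (fun a => le_trans ?_ (hb a)) (by linarith) (hQ.right_inv hS) (by linarith)
    exact mul_le_mul_of_nonneg_right (by linarith) (Finset.sum_nonneg fun i _ => sq_nonneg _)

lemma isResolvent_zero {μ : ℝ} (hμ : μ ≠ 0) :
    IsResolvent (0 : E →ₗ[ℝ] E) μ ((-μ⁻¹) • LinearMap.id) := by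
  refine ⟨fun x y => ?_, fun x => ?_⟩
  · simp [real_inner_smul_left, real_inner_smul_right]
  · simp [smul_smul, hμ]

lemma potential_smul_id {d : ι → ℝ} {w : ι → E} (hw : ∀ j, ‖w j‖ = 1) (c : ℝ) :
    potential d w (c • LinearMap.id) = c * ∑ j, d j := by
  simp [potential, real_inner_smul_right, hw, Finset.mul_sum, mul_comm]

/-- Sparsification: `M` vectors of the family whose frame operator is at most
`u + M / (t (1 - 1 / u))`. -/
lemma exists_bounded_frame [FiniteDimensional ℝ E] [Nonempty ι] {d : ι → ℝ} (hd : ∀ j, 0 < d j)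
    {w : ι → E} (hw : ∀ j, ‖w j‖ = 1) (hA : ∀ v, ∑ j, d j * ⟪w j, v⟫ ^ 2 ≤ ‖v‖ ^ 2)
    {u δ : ℝ} (hu : 0 < u) (hδ : 0 < δ) (hp : δ * (∑ j, d j - u⁻¹ * ∑ j, d j) = 1) (M : ℕ) :
    ∃ f : Fin M → ι, ∀ x, ∑ i, ⟪w (f i), x⟫ ^ 2 ≤ (u + M * δ) * ‖x‖ ^ 2 := by
  suffices h : ∃ (f : Fin M → ι) (R : E →ₗ[ℝ] E),
      IsResolvent (∑ i, selfRankOne (w (f i))) (u + M * δ) R ∧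
      -(u⁻¹ * ∑ j, d j) ≤ potential d w R ∧
      ∀ x, ⟪(∑ i, selfRankOne (w (f i))) x, x⟫ ≤ (u + M * δ) * ‖x‖ ^ 2 by
    obtain ⟨f, R, -, -, h⟩ := h
    refine ⟨f, fun x => le_of_eq_of_le ?_ (h x)⟩
    simp [LinearMap.sum_apply, sum_inner, real_inner_smul_left, sq]
  induction M with
  | zero =>
    refine ⟨Fin.elim0, (-u⁻¹) • LinearMap.id, ?_, ?_, fun x => ?_⟩
    · simpa using isResolvent_zero (E := E) hu.ne'
    · rw [potential_smul_id hw]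
      linarith
    · simp
      positivity
  | succ M ih =>
    obtain ⟨f, R, hR, hφ, hS⟩ := ih
    obtain ⟨j, R', hR', hφ', hS'⟩ := upper_barrier_step hd hw hA
      (sum_selfRankOne_isSymmetric fun i => w (f i)) hS hR hδ hp hφ
    have e : u + (M + 1 : ℕ) * δ = u + M * δ + δ := by push_cast; ring
    refine ⟨Fin.snoc f j, R', ?_, hφ', ?_⟩ <;>
      simpa only [Fin.sum_univ_castSucc, Fin.snoc_castSucc, Fin.snoc_last, e]

/-- Restricted invertibility with the full proportion of vectors. -/
lemma exists_gram_lower_bound [FiniteDimensional ℝ E] [Nonempty ι] {d : ι → ℝ}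
    (hd : ∀ j, 0 < d j)
    {w : ι → E} (hw : ∀ j, ‖w j‖ = 1) (hA : ∀ v, ∑ j, d j * ⟪w j, v⟫ ^ 2 ≤ ‖v‖ ^ 2)
    {b δ : ℝ} (hb0 : 0 < b) (hb1 : b < 1) (hδ : δ * ((1 - b) * ∑ j, d j) = b) (κ : ℕ)
    (hκ : κ * δ < b) :
    ∃ f : Fin κ → ι, ∀ a : Fin κ → ℝ,
      (b - κ * δ) * ∑ i, a i ^ 2 ≤ ‖∑ i, a i • w (f i)‖ ^ 2 := by
  have ht : 0 < ∑ j, d j := Finset.sum_pos (fun j _ => hd j) Finset.univ_nonempty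
  have hδ0 : 0 < δ := by
    have : 0 < (1 - b) * ∑ j, d j := mul_pos (by linarith) ht
    exact pos_of_mul_pos_left (hb0.trans_eq hδ.symm) this.le
  suffices h : ∃ (f : Fin κ → ι) (R : E →ₗ[ℝ] E),
      IsResolvent (∑ i, selfRankOne (w (f i))) (b - κ * δ) R ∧
      potential d w R ≤ -(∑ j, d j) - δ⁻¹ ∧
      ∀ a : Fin κ → ℝ, (b - κ * δ) * ∑ i, a i ^ 2 ≤ ‖∑ i, a i • w (f i)‖ ^ 2 by
    obtain ⟨f, R, -, -, h⟩ := h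
    exact ⟨f, h⟩
  induction κ with
  | zero =>
    refine ⟨Fin.elim0, (-b⁻¹) • LinearMap.id, ?_, ?_, fun x => ?_⟩
    · simpa using isResolvent_zero (E := E) hb0.ne'
    · rw [potential_smul_id hw]
      have : δ⁻¹ = (1 - b) * (∑ j, d j) * b⁻¹ := by
        rw [← div_eq_mul_inv, eq_div_iff hb0.ne', inv_mul_eq_iff_eq_mul₀ hδ0.ne', hδ]
      rw [this]
      refine le_of_eq ?_
      field_simp
      ring
    · simp
  | succ κ ih =>
    push_cast at hκ
    obtain ⟨f, R, hR, hφ, hS⟩ := ih (by linarith)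
    obtain ⟨j, R', hR', hφ', hS'⟩ := lower_barrier_step hd hw hA hS hR hδ0 (by linarith)
      (by nlinarith [mul_pos hδ0 ht]) hφ
    have e : b - (κ + 1 : ℕ) * δ = b - κ * δ - δ := by push_cast; ring
    refine ⟨Fin.snoc f j, R', ?_, hφ', fun a => ?_⟩
    · simpa only [Fin.sum_univ_castSucc, Fin.snoc_castSucc, Fin.snoc_last, e]
    · have := hS' a
      rw [e]
      simpa only [Fin.sum_univ_castSucc, Fin.snoc_castSucc, Fin.snoc_last] using this

/-- A Bessel bound on the vectors bounds their linear combinations. -/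
lemma norm_sq_sum_smul_le {κ : Type*} [Fintype κ] {v : κ → E} {β : ℝ} (hβ : 0 ≤ β)
    (h : ∀ x, ∑ i, ⟪v i, x⟫ ^ 2 ≤ β * ‖x‖ ^ 2) (a : κ → ℝ) :
    ‖∑ i, a i • v i‖ ^ 2 ≤ β * ∑ i, a i ^ 2 := by
  set y := ∑ i, a i • v i with hy
  have h1 : ‖y‖ ^ 2 = ∑ i, a i * ⟪v i, y⟫ := by
    rw [← real_inner_self_eq_norm_sq]
    nth_rewrite 1 [hy]
    simp only [sum_inner, real_inner_smul_left]
  have h2 : (‖y‖ ^ 2) ^ 2 ≤ (∑ i, a i ^ 2) * (β * ‖y‖ ^ 2) := by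
    rw [h1]
    refine (Finset.sum_mul_sq_le_sq_mul_sq _ _ _).trans ?_
    rw [← h1]
    exact mul_le_mul_of_nonneg_left (h y) (Finset.sum_nonneg fun i _ => sq_nonneg _)
  rcases (sq_nonneg ‖y‖).eq_or_lt with h0 | h0
  · rw [← h0]
    exact mul_nonneg hβ (Finset.sum_nonneg fun i _ => sq_nonneg _)
  · nlinarith

/-- Unit vectors in a weighted sub-tight frame of total mass `t`: any proportion less than one of
`t` many of them can be selected so as to be equivalent to an orthonormal system. -/
theorem exists_equivalent_subfamily [FiniteDimensional ℝ E] {d : ι → ℝ} (hd : ∀ j, 0 < d j)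
    {w : ι → E} (hw : ∀ j, ‖w j‖ = 1) (hA : ∀ v, ∑ j, d j * ⟪w j, v⟫ ^ 2 ≤ ‖v‖ ^ 2)
    {ε : ℝ} (hε : 0 < ε) (hε4 : ε ≤ 1 / 4) {κ : ℕ} (hκ0 : 0 < κ)
    (hκ : κ ≤ (1 - 4 * ε) * ∑ j, d j) :
    ∃ f : Fin κ → ι, ∀ a : Fin κ → ℝ,
      ε ^ 2 * ∑ i, a i ^ 2 ≤ ‖∑ i, a i • w (f i)‖ ^ 2 ∧
      ‖∑ i, a i • w (f i)‖ ^ 2 ≤ 4 / ε ^ 2 * ∑ i, a i ^ 2 := by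
  set t := ∑ j, d j with ht
  have hκ1 : (1 : ℝ) ≤ κ := by exact_mod_cast hκ0
  have ht0 : 0 ≤ t := Finset.sum_nonneg fun j _ => (hd j).le
  have ht1 : 1 ≤ t := by nlinarith
  have hne : Nonempty ι := by
    by_contra h
    rw [not_nonempty_iff] at h
    simp at ht
    linarith
  have h1ε : 0 < 1 - ε := by linarith
  have htε : 0 < t * (1 - ε) := by positivity
  set M := ⌈t / ε ^ 2⌉₊
  have hM1 : t / ε ^ 2 ≤ M := Nat.le_ceil _
  have hM2 : (M : ℝ) < t / ε ^ 2 + 1 := Nat.ceil_lt_add_one (by positivity)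
  have hM0 : (0 : ℝ) < M := lt_of_lt_of_le (by positivity) hM1
  have hMne : Nonempty (Fin M) := ⟨⟨0, by exact_mod_cast hM0⟩⟩
  obtain ⟨f, hf⟩ := exists_bounded_frame hd hw hA (u := ε⁻¹) (δ := (t * (1 - ε))⁻¹)
    (by positivity) (by positivity) (by rw [inv_inv, ← ht]; field_simp) M
  set β := ε⁻¹ + M * (t * (1 - ε))⁻¹ with hβ
  have hβ0 : 0 < β := by positivity
  have hβ4 : β ≤ 4 / ε ^ 2 := by
    have h1 : M * (t * (1 - ε))⁻¹ ≤ (ε⁻¹ ^ 2 + 1) * (4 / 3) := by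
      rw [mul_inv_le_iff₀ htε]
      have h2 : t / ε ^ 2 + 1 ≤ (ε⁻¹ ^ 2 + 1) * t := by
        rw [inv_pow, div_eq_mul_inv]; nlinarith
      have h3 : 0 ≤ (ε⁻¹ ^ 2 + 1) * t := by positivity
      nlinarith
    have h2 : 4 ≤ ε⁻¹ := by
      rw [le_inv_comm₀ (by norm_num) hε]; linarith
    have h3 : 4 / ε ^ 2 = 4 * ε⁻¹ ^ 2 := by rw [inv_pow, div_eq_mul_inv]
    rw [h3]
    nlinarith
  have ht' : (1 - ε) ^ 2 * t ≤ M * β⁻¹ := by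
    rw [← div_eq_mul_inv, le_div_iff₀ hβ0, hβ]
    have h1 : t * ε⁻¹ ≤ M * ε := by
      calc t * ε⁻¹ = t / ε ^ 2 * ε := by field_simp
        _ ≤ _ := by gcongr
    have h2 : (1 - ε) ^ 2 * t * (ε⁻¹ + M * (t * (1 - ε))⁻¹) =
        (1 - ε) ^ 2 * (t * ε⁻¹) + (1 - ε) * M := by field_simp
    rw [h2]
    have h3 : (1 - ε) ^ 2 * (t * ε⁻¹) ≤ (1 - ε) ^ 2 * (M * ε) := by gcongr
    have h4 : 0 ≤ M * ε * (1 - (1 - ε) ^ 2) := by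
      have : 0 ≤ 1 - (1 - ε) ^ 2 := by nlinarith
      positivity
    nlinarith
  have hsum : ∑ _i : Fin M, β⁻¹ = M * β⁻¹ := by simp
  have hκt : κ ≤ (1 - ε) ^ 2 * (M * β⁻¹) := by
    have h1 : (1 - 4 * ε) ≤ (1 - ε) ^ 2 * (1 - ε) ^ 2 := by
      nlinarith [sq_nonneg ε, sq_nonneg (ε * (1 - ε))]
    calc (κ : ℝ) ≤ (1 - 4 * ε) * t := hκ
      _ ≤ (1 - ε) ^ 2 * (1 - ε) ^ 2 * t := by gcongr
      _ = (1 - ε) ^ 2 * ((1 - ε) ^ 2 * t) := by ring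
      _ ≤ _ := by gcongr
  have hT : 0 < M * β⁻¹ := by positivity
  have hκδ : κ * (ε / ((1 - ε) * (M * β⁻¹))) ≤ ε - ε ^ 2 := by
    rw [mul_div_assoc', div_le_iff₀ (by positivity)]
    calc κ * ε ≤ (1 - ε) ^ 2 * (M * β⁻¹) * ε := by gcongr
      _ = _ := by ring
  obtain ⟨g, hg⟩ := exists_gram_lower_bound (d := fun _ : Fin M => β⁻¹) (w := fun i => w (f i))
    (fun _ => by positivity) (fun i => hw _) (fun v => by
      rw [← Finset.mul_sum, inv_mul_le_iff₀ hβ0]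
      exact hf v) hε (by linarith) (δ := ε / ((1 - ε) * (M * β⁻¹)))
    (by rw [hsum]; field_simp) κ (by nlinarith)
  have hg' : ∀ a : Fin κ → ℝ, ε ^ 2 * ∑ i, a i ^ 2 ≤ ‖∑ i, a i • w (f (g i))‖ ^ 2 := fun a =>
    le_trans (mul_le_mul_of_nonneg_right (by linarith)
      (Finset.sum_nonneg fun i _ => sq_nonneg _)) (hg a)
  have hinj : Function.Injective g := by
    intro i j hij
    by_contra hne
    have h1 := hg' (Pi.single i 1 - Pi.single j 1)
    have h2 : ∑ l, (Pi.single i 1 - Pi.single j 1 : Fin κ → ℝ) l • w (f (g l)) = 0 := by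
      simp [sub_smul, Finset.sum_sub_distrib, Pi.single_apply, hij]
    have h3 : 1 ≤ ∑ l, (Pi.single i 1 - Pi.single j 1 : Fin κ → ℝ) l ^ 2 := by
      refine le_trans ?_ (Finset.single_le_sum (fun l _ => sq_nonneg _) (Finset.mem_univ i))
      simp [hne]
    rw [h2] at h1
    have h4 : 0 < ε ^ 2 := by positivity
    simp only [norm_zero] at h1
    nlinarith
  refine ⟨fun i => f (g i), fun a => ⟨hg' a, ?_⟩⟩
  refine norm_sq_sum_smul_le (v := fun i => w (f (g i))) (by positivity) (fun x => ?_) a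
  calc ∑ i, ⟪w (f (g i)), x⟫ ^ 2 = ∑ l ∈ Finset.univ.map ⟨g, hinj⟩, ⟪w (f l), x⟫ ^ 2 := by
        rw [Finset.sum_map]; rfl
    _ ≤ ∑ l, ⟪w (f l), x⟫ ^ 2 := Finset.sum_le_sum_of_subset_of_nonneg (Finset.subset_univ _)
        fun _ _ _ => sq_nonneg _
    _ ≤ β * ‖x‖ ^ 2 := hf x
    _ ≤ 4 / ε ^ 2 * ‖x‖ ^ 2 := by gcongr

end Barrier

/-- The trace of an operator, computed along a decomposition of the identity. -/
lemma trace_eq_sum_of_decomposition {E : Type*} [NormedAddCommGroup E] [InnerProductSpace ℝ E]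
    [FiniteDimensional ℝ E] {ι : Type*} [Fintype ι] {c : ι → ℝ} {u : ι → E}
    (h : ∀ v, ∑ j, c j • ⟪u j, v⟫ • u j = v) (T : E →ₗ[ℝ] E) :
    LinearMap.trace ℝ E T = ∑ j, c j * ⟪u j, T (u j)⟫ := by
  let e := stdOrthonormalBasis ℝ E
  have h1 : ∀ i, ⟪e i, T (e i)⟫ = ∑ j, c j * (⟪u j, e i⟫ * ⟪e i, T (u j)⟫) := fun i => by
    conv_lhs => rw [← h (e i)]
    rw [map_sum, inner_sum, h (e i)]
    refine Finset.sum_congr rfl fun j _ => ?_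
    rw [map_smul, map_smul, real_inner_smul_right, real_inner_smul_right]
  rw [T.trace_eq_sum_inner e, Finset.sum_congr rfl fun i _ => h1 i, Finset.sum_comm]
  refine Finset.sum_congr rfl fun j _ => ?_
  rw [← Finset.mul_sum, e.sum_inner_mul_inner]

/-- Dvoretzky–Rogers type lemma for projections. There are `c > 0` and
`C : (0,1) → (0,∞)` such that: whenever `X = (ℝⁿ, N)` admits a John decomposition, `P` is
an orthogonal projection of rank `k`, and `κ < k` is a positive integer, there exist
contact points `x₁, …, x_κ` with `P xⱼ ≠ 0` such that `zⱼ = P xⱼ / ‖P xⱼ‖₂` satisfy: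
(i) `(zⱼ)` is `C(κ/k)`-equivalent in euclidean norm to the canonical basis of `l₂^κ`;
(ii) `N zⱼ ≥ c √((k-κ)/n)` for all `j`. -/
theorem dvoretzky_rogers_contact_points :
    ∃ c : ℝ, 0 < c ∧ ∃ C : ℝ → ℝ, (∀ t, 0 < C t) ∧
      ∀ (n : ℕ), 0 < n → ∀ N : EuclideanSpace ℝ (Fin n) → ℝ, IsJohnNorm N →
      ∀ P : EuclideanSpace ℝ (Fin n) →L[ℝ] EuclideanSpace ℝ (Fin n),
        P.comp P = P → (∀ v w, ⟪P v, w⟫ = ⟪v, P w⟫) →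
      ∀ k κ : ℕ,
        Module.finrank ℝ (LinearMap.range
          (P : EuclideanSpace ℝ (Fin n) →ₗ[ℝ] EuclideanSpace ℝ (Fin n))) = k →
        0 < κ → κ < k →
      ∃ x : Fin κ → EuclideanSpace ℝ (Fin n),
        (∀ j, IsContactPoint N (x j)) ∧ (∀ j, P (x j) ≠ 0) ∧
        (∃ K₁ K₂ : ℝ, 0 < K₁ ∧ 0 < K₂ ∧ K₁ * K₂ ≤ C ((κ : ℝ) / k) ∧
          ∀ a : Fin κ → ℝ,
            K₁⁻¹ * Real.sqrt (∑ j, (a j) ^ 2)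
                ≤ ‖∑ j, a j • (‖P (x j)‖⁻¹ • P (x j))‖ ∧
            ‖∑ j, a j • (‖P (x j)‖⁻¹ • P (x j))‖
                ≤ K₂ * Real.sqrt (∑ j, (a j) ^ 2)) ∧
        ∀ j, c * Real.sqrt (((k : ℝ) - κ) / n) ≤ N (‖P (x j)‖⁻¹ • P (x j)) := by
  refine ⟨1 / 2, by norm_num,
    fun θ => 2 / ((1 - θ) / (4 * (1 + θ))) ^ 2 + 1, fun θ => by positivity, ?_⟩
  intro n hn N hN P hPP hPs k κ hk hκ0 hκk
  obtain ⟨-, -, -, -, m, c, u, hc, hu, hid⟩ := hN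
  have hn0 : (0 : ℝ) < n := by exact_mod_cast hn
  have hκ0' : (0 : ℝ) < κ := by exact_mod_cast hκ0
  have hκk' : (κ : ℝ) < k := by exact_mod_cast hκk
  have hPP' : ∀ v, P (P v) = P v := fun v => congrArg (fun T => T v) hPP
  have hcsum : ∑ j, c j = n := by
    have h := trace_eq_sum_of_decomposition hid LinearMap.id
    rw [LinearMap.trace_id, finrank_euclideanSpace_fin] at h
    rw [h]
    exact Finset.sum_congr rfl fun j _ => by
      rw [LinearMap.id_apply, real_inner_self_eq_norm_sq, (hu j).1]; ring
  have hPu : ∀ v, ⟪v, P v⟫ = ‖P v‖ ^ 2 := fun v => by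
    rw [← real_inner_self_eq_norm_sq, hPs, hPP']
  have htr : ∑ j, c j * ‖P (u j)‖ ^ 2 = k := by
    have h := trace_eq_sum_of_decomposition hid (P : _ →ₗ[ℝ] _)
    have hproj : LinearMap.IsProj (LinearMap.range (P : _ →ₗ[ℝ] EuclideanSpace ℝ (Fin n)))
        (P : _ →ₗ[ℝ] EuclideanSpace ℝ (Fin n)) :=
      ⟨fun v => ⟨v, rfl⟩, by rintro _ ⟨v, rfl⟩; exact hPP' v⟩
    rw [hproj.trace, hk] at h
    rw [h]
    exact Finset.sum_congr rfl fun j _ => by rw [← hPu]; rfl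
  set s : ℝ := (k - κ) / (2 * n) with hs
  have hs0 : 0 < s := div_pos (by linarith) (by linarith)
  let J := {j : Fin m // s ≤ ‖P (u j)‖ ^ 2}
  have hJpos : ∀ j : J, 0 < ‖P (u j)‖ := fun j => by
    have h := hs0.trans_le j.2
    exact lt_of_le_of_ne (norm_nonneg _) fun h0 => by simp [← h0] at h
  have hmass : ((k : ℝ) + κ) / 2 ≤ ∑ j : J, c j * ‖P (u j)‖ ^ 2 := by
    have hsplit := Fintype.sum_subtype_add_sum_subtype (fun j => s ≤ ‖P (u j)‖ ^ 2)
      (fun j => c j * ‖P (u j)‖ ^ 2)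
    have hsmall : ∑ j : {j // ¬ s ≤ ‖P (u j)‖ ^ 2}, c j * ‖P (u j)‖ ^ 2 ≤ n * s := by
      calc _ ≤ ∑ j : {j // ¬ s ≤ ‖P (u j)‖ ^ 2}, c j * s :=
            Finset.sum_le_sum fun j _ =>
              mul_le_mul_of_nonneg_left (not_le.1 j.2).le (hc j).le
        _ ≤ ∑ j, c j * s := by
            have h := Fintype.sum_subtype_add_sum_subtype (fun j => s ≤ ‖P (u j)‖ ^ 2)
              (fun j => c j * s)
            have h2 : 0 ≤ ∑ j : J, c j * s :=
              Finset.sum_nonneg fun j _ => mul_nonneg (hc j).le hs0.le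
            linarith
        _ = n * s := by rw [← Finset.sum_mul, hcsum]
    have hns : n * s = (k - κ) / 2 := by rw [hs]; field_simp
    linarith
  have hA : ∀ v, ∑ j : J, c j * ‖P (u j)‖ ^ 2 * ⟪‖P (u j)‖⁻¹ • P (u j), v⟫ ^ 2 ≤ ‖v‖ ^ 2 := by
    intro v
    have h1 : ∀ j : J, c j * ‖P (u j)‖ ^ 2 * ⟪‖P (u j)‖⁻¹ • P (u j), v⟫ ^ 2 =
        c j * ⟪u j, P v⟫ ^ 2 := fun j => by
      have := (hJpos j).ne'
      rw [real_inner_smul_left, hPs]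
      field_simp
    have h2 : ∑ j, c j * ⟪u j, P v⟫ ^ 2 = ‖P v‖ ^ 2 := by
      have := congrArg (fun z => ⟪z, P v⟫) (hid (P v))
      simp only [sum_inner, real_inner_smul_left, real_inner_self_eq_norm_sq] at this
      rw [← this]
      exact Finset.sum_congr rfl fun j _ => by ring
    have h3 := Fintype.sum_subtype_add_sum_subtype (fun j => s ≤ ‖P (u j)‖ ^ 2)
      (fun j => c j * ⟪u j, P v⟫ ^ 2)
    have h4 : 0 ≤ ∑ j : {j // ¬ s ≤ ‖P (u j)‖ ^ 2}, c j * ⟪u j, P v⟫ ^ 2 :=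
      Finset.sum_nonneg fun j _ => mul_nonneg (hc j).le (sq_nonneg _)
    have h5 : ‖P v‖ ^ 2 ≤ ‖v‖ ^ 2 := by
      have h6 := real_inner_le_norm v (P v)
      rw [hPu] at h6
      nlinarith [norm_nonneg v, norm_nonneg (P v), sq_nonneg (‖v‖ - ‖P v‖)]
    rw [Finset.sum_congr rfl fun j _ => h1 j]
    linarith
  set θ : ℝ := κ / k with hθ
  set ε : ℝ := (1 - θ) / (4 * (1 + θ)) with hε
  have hk0 : (0 : ℝ) < k := hκ0'.trans hκk'
  have hθ0 : 0 < θ := div_pos hκ0' hk0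
  have hθ1 : θ < 1 := (div_lt_one hk0).2 hκk'
  have hε0 : 0 < ε := div_pos (by linarith) (by linarith)
  have hε4 : ε ≤ 1 / 4 := by
    rw [hε, div_le_div_iff₀ (by linarith) (by norm_num)]; linarith
  have hεκ : (1 - 4 * ε) * ((k + κ) / 2) = κ := by
    have hκθ : (κ : ℝ) = θ * k := by rw [hθ]; field_simp
    rw [hε, hκθ]
    field_simp
    ring
  obtain ⟨f, hf⟩ := exists_equivalent_subfamily (d := fun j : J => c j * ‖P (u j)‖ ^ 2)
    (w := fun j : J => ‖P (u j)‖⁻¹ • P (u j))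
    (fun j => mul_pos (hc j) (pow_pos (hJpos j) 2))
    (fun j => norm_smul_inv_norm (norm_pos_iff.1 (hJpos j))) hA hε0 hε4 hκ0
    (hεκ.symm.le.trans (mul_le_mul_of_nonneg_left hmass (by linarith)))
  refine ⟨fun i => u (f i), fun i => hu _, fun i => norm_pos_iff.1 (hJpos _),
    ⟨1 / ε, 2 / ε, by positivity, by positivity, ?_, fun a => ?_⟩, fun i => ?_⟩
  · have : 1 / ε * (2 / ε) = 2 / ε ^ 2 := by field_simp
    linarith
  · obtain ⟨h1, h2⟩ := hf a
    have hsq : 0 ≤ ∑ i, a i ^ 2 := Finset.sum_nonneg fun i _ => sq_nonneg _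
    refine ⟨abs_le_of_sq_le_sq' ?_ (norm_nonneg _) |>.2, abs_le_of_sq_le_sq' ?_ ?_ |>.2⟩
    · rw [mul_pow, Real.sq_sqrt hsq, one_div, inv_inv]
      exact h1
    · rw [mul_pow, Real.sq_sqrt hsq, div_pow]
      norm_num
      exact h2
    · positivity
  · have hpos := hJpos (f i)
    have h1 := (hu (f i)).2.2 (‖P (u (f i))‖⁻¹ • P (u (f i)))
    rw [real_inner_smul_right, hPu, sq, inv_mul_cancel_left₀ hpos.ne'] at h1
    refine le_trans (abs_le_of_sq_le_sq' ?_ hpos.le |>.2) h1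
    have h2 : s ≤ ‖P (u (f i))‖ ^ 2 := (f i).2
    rw [mul_pow, Real.sq_sqrt (div_nonneg (by linarith) hn0.le)]
    have h3 : ((k : ℝ) - κ) / n = 2 * s := by rw [hs]; field_simp
    rw [h3]
    linarith
end

section
/- There is an absolute constant c > 0 and a function C : (0,1) → (0,∞) with the following property. Let X = (ℝⁿ, ‖·‖_X) satisfy ‖x‖_X ≤ ‖x‖₂ for all x and admit a John decomposition. Let T : ℝⁿ → ℝⁿ be a linear operator with ‖T‖_{2→2} ≤ 1, set h = ‖T‖_HS², and let κ < h be a positive integer. Then there exist contact points x_1, …, x_κ of X with T x_j ≠ 0 such that, setting z_j = |T| x_j / ‖T x_j‖₂ where |T| = (T*T)^{1/2}: (i) the system (z_j)_{j≤κ} is C(κ/h)-equivalent in the euclidean norm to the canonical basis of l₂^κ; and (ii) ‖z_j‖_X ≥ c √((h−κ)/n) for all j ≤ κ. -/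
open scoped RealInnerProductSpace

/-- The square of the Hilbert–Schmidt norm of an operator on `ℝⁿ`,
computed on the canonical orthonormal basis. -/
noncomputable def hsNormSq {n : ℕ}
    (T : EuclideanSpace ℝ (Fin n) →L[ℝ] EuclideanSpace ℝ (Fin n)) : ℝ :=
  ∑ i, ‖T (EuclideanSpace.single i 1)‖ ^ 2

section Barriers

variable {E : Type*} [NormedAddCommGroup E] [InnerProductSpace ℝ E]

/-- The symmetric operator `K` controls from below the Gram matrix of `v` at level `b`; the model
case is `K = (b - ∑ᵢ vᵢ ⊗ vᵢ)⁻¹`, where all eigenvalues of the Gram matrix exceed `b`. -/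
structure LowerBarrier {k : ℕ} (v : Fin k → E) (b : ℝ) (K : E →ₗ[ℝ] E) : Prop where
  symm : ∀ x y, ⟪K x, y⟫ = ⟪x, K y⟫
  le : ∀ (x : E) (a : Fin k → ℝ), b * (∑ i, a i ^ 2 + ⟪x, K x⟫) ≤ ‖x - ∑ i, a i • v i‖ ^ 2
  self_le : ∀ x, ⟪x, K x⟫ ≤ b * ‖K x‖ ^ 2

/-- The symmetric operator `Q` controls from above the frame operator of `v` at level `u`; the
model case is `Q = (u - ∑ᵢ vᵢ ⊗ vᵢ)⁻¹`, where all eigenvalues of the sum are below `u`. -/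
structure UpperBarrier {k : ℕ} (v : Fin k → E) (u : ℝ) (Q : E →ₗ[ℝ] E) : Prop where
  symm : ∀ x y, ⟪Q x, y⟫ = ⟪x, Q y⟫
  le : ∀ x y : E, 2 * ⟪x, y⟫ + ∑ i, ⟪v i, y⟫ ^ 2 ≤ u * ‖y‖ ^ 2 + ⟪x, Q x⟫

/-- The Sherman–Morrison update `K + K v ⊗ K v / (1 - ⟪v, K v⟫)`. -/
noncomputable def rankOneUpdate (K : E →ₗ[ℝ] E) (v : E) : E →ₗ[ℝ] E :=
  K - (⟪v, K v⟫ - 1)⁻¹ • (LinearMap.toSpanSingleton ℝ E (K v)).comp (innerₗ E (K v))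

lemma rankOneUpdate_apply (K : E →ₗ[ℝ] E) (v x : E) :
    rankOneUpdate K v x = K x - ((⟪v, K v⟫ - 1)⁻¹ * ⟪K v, x⟫) • K v := by
  simp [rankOneUpdate, smul_smul]

lemma inner_rankOneUpdate (K : E →ₗ[ℝ] E) (v x : E) :
    ⟪x, rankOneUpdate K v x⟫ = ⟪x, K x⟫ - (⟪v, K v⟫ - 1)⁻¹ * ⟪x, K v⟫ ^ 2 := by
  rw [rankOneUpdate_apply, inner_sub_right, inner_smul_right, real_inner_comm x (K v)]
  ring

lemma rankOneUpdate_symm {K : E →ₗ[ℝ] E} (hK : ∀ x y, ⟪K x, y⟫ = ⟪x, K y⟫) (v x y : E) :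
    ⟪rankOneUpdate K v x, y⟫ = ⟪x, rankOneUpdate K v y⟫ := by
  simp only [rankOneUpdate_apply, inner_sub_right, inner_smul_right, inner_sub_left,
    real_inner_smul_left, hK x y, real_inner_comm x (K v)]
  ring

lemma LowerBarrier.of_isEmpty {b : ℝ} (hb : 0 < b) (v : Fin 0 → E) :
    LowerBarrier v b (b⁻¹ • LinearMap.id) where
  symm x y := by simp [real_inner_smul_left, inner_smul_right]
  le x a := by
    simp only [Finset.univ_eq_empty, Finset.sum_empty, LinearMap.smul_apply, LinearMap.id_apply,
      inner_smul_right, real_inner_self_eq_norm_sq, zero_add, sub_zero]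
    rw [mul_inv_cancel_left₀ hb.ne']
  self_le x := by
    simp only [LinearMap.smul_apply, LinearMap.id_apply, inner_smul_right,
      real_inner_self_eq_norm_sq, norm_smul, mul_pow, Real.norm_eq_abs, sq_abs]
    apply le_of_eq
    field_simp

lemma UpperBarrier.of_isEmpty {u : ℝ} (hu : 0 < u) (v : Fin 0 → E) :
    UpperBarrier v u (u⁻¹ • LinearMap.id) where
  symm x y := by simp [real_inner_smul_left, inner_smul_right]
  le x y := by
    have h : 0 ≤ ‖u • y - x‖ ^ 2 := by positivity
    rw [norm_sub_sq_real, norm_smul, mul_pow, Real.norm_eq_abs, sq_abs, real_inner_smul_left,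
      real_inner_comm] at h
    simp only [Finset.univ_eq_empty, Finset.sum_empty, LinearMap.smul_apply, LinearMap.id_apply,
      inner_smul_right, real_inner_self_eq_norm_sq, add_zero]
    have h2 : 0 ≤ u⁻¹ * (u ^ 2 * ‖y‖ ^ 2 - 2 * (u * ⟪x, y⟫) + ‖x‖ ^ 2) := by positivity
    have h3 : u⁻¹ * (u ^ 2 * ‖y‖ ^ 2 - 2 * (u * ⟪x, y⟫) + ‖x‖ ^ 2)
        = u * ‖y‖ ^ 2 - 2 * ⟪x, y⟫ + u⁻¹ * ‖x‖ ^ 2 := by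
      field_simp
    linarith

section

variable {k : ℕ} {v : Fin k → E} {b u : ℝ} {K Q : E →ₗ[ℝ] E}

lemma LowerBarrier.mul_inner_le (h : LowerBarrier v b K) (x : E) : b * ⟪x, K x⟫ ≤ ‖x‖ ^ 2 := by
  simpa using h.le x 0

lemma LowerBarrier.le_norm_sq (h : LowerBarrier v b K) (a : Fin k → ℝ) :
    b * ∑ i, a i ^ 2 ≤ ‖∑ i, a i • v i‖ ^ 2 := by
  simpa using h.le 0 a

lemma UpperBarrier.inner_nonneg (h : UpperBarrier v u Q) (x : E) : 0 ≤ ⟪x, Q x⟫ := by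
  simpa using h.le x 0

lemma UpperBarrier.norm_sq_le (h : UpperBarrier v u Q) (hu : 0 ≤ u) (a : Fin k → ℝ) :
    ‖∑ i, a i • v i‖ ^ 2 ≤ u * ∑ i, a i ^ 2 := by
  set y := ∑ i, a i • v i with hy
  have h1 : ∑ i, ⟪v i, y⟫ ^ 2 ≤ u * ‖y‖ ^ 2 := by simpa using h.le 0 y
  have h2 : ‖y‖ ^ 2 = ∑ i, a i * ⟪v i, y⟫ := by
    rw [← real_inner_self_eq_norm_sq]
    nth_rw 1 [hy]
    simp [sum_inner, real_inner_smul_left]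
  have h3 : (‖y‖ ^ 2) ^ 2 ≤ (∑ i, a i ^ 2) * ∑ i, ⟪v i, y⟫ ^ 2 := by
    nth_rw 1 [h2]
    exact Finset.sum_mul_sq_le_sq_mul_sq _ _ _
  have ha : 0 ≤ ∑ i, a i ^ 2 := Finset.sum_nonneg fun i _ => sq_nonneg _
  rcases eq_or_ne y 0 with h0 | h0
  · simpa [h0] using mul_nonneg hu ha
  · have hp : 0 < ‖y‖ ^ 2 := by positivity
    have : (‖y‖ ^ 2) * ‖y‖ ^ 2 ≤ (u * ∑ i, a i ^ 2) * ‖y‖ ^ 2 := by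
      nlinarith [mul_le_mul_of_nonneg_left h1 ha]
    exact le_of_mul_le_mul_right this hp

lemma LowerBarrier.cons (h : LowerBarrier v b K) (hb : 0 ≤ b) {z : E} (hz : 1 < ⟪z, K z⟫) :
    LowerBarrier (Fin.cons z v : Fin (k + 1) → E) b (rankOneUpdate K z) where
  symm := rankOneUpdate_symm h.symm z
  le x a := by
    have h1 := h.le (x - a 0 • z) (fun i => a i.succ)
    have hs : 0 < ⟪z, K z⟫ - 1 := by linarith
    have h2 : x - ∑ i, a i • (Fin.cons z v : Fin (k + 1) → E) i
        = x - a 0 • z - ∑ i : Fin k, a i.succ • v i := by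
      rw [Fin.sum_univ_succ]
      simp [sub_sub]
    rw [h2, Fin.sum_univ_succ, inner_rankOneUpdate]
    refine le_trans (mul_le_mul_of_nonneg_left ?_ hb) h1
    have h3 : ⟪x - a 0 • z, K (x - a 0 • z)⟫
        = ⟪x, K x⟫ - 2 * a 0 * ⟪x, K z⟫ + a 0 ^ 2 * ⟪z, K z⟫ := by
      simp only [map_sub, map_smul, inner_sub_left, inner_sub_right, inner_smul_right,
        real_inner_smul_left]
      rw [← h.symm z x, real_inner_comm x (K z)]
      ring
    rw [h3]
    generalize ⟪z, K z⟫ = q at *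
    have h4 : 0 ≤ (q - 1)⁻¹ * (a 0 * (q - 1) - ⟪x, K z⟫) ^ 2 := by positivity
    have h5 : (q - 1)⁻¹ * (a 0 * (q - 1) - ⟪x, K z⟫) ^ 2
        = a 0 ^ 2 * (q - 1) - 2 * a 0 * ⟪x, K z⟫ + (q - 1)⁻¹ * ⟪x, K z⟫ ^ 2 := by
      field_simp
      ring
    linarith
  self_le x := by
    have hs : ⟪z, K z⟫ - 1 ≠ 0 := by linarith
    set c := (⟪z, K z⟫ - 1)⁻¹ * ⟪K z, x⟫ with hc
    have h1 : rankOneUpdate K z x = K (x - c • z) := by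
      rw [rankOneUpdate_apply, map_sub, map_smul]
    have h2 := h.self_le (x - c • z)
    have h3 : ⟪z, K (x - c • z)⟫ = -c := by
      rw [map_sub, map_smul, inner_sub_right, inner_smul_right, ← h.symm z x]
      have : ⟪K z, x⟫ = (⟪z, K z⟫ - 1) * c := by rw [hc, mul_inv_cancel_left₀ hs]
      rw [this]
      ring
    have h4 : ⟪x - c • z, K (x - c • z)⟫ = ⟪x, K (x - c • z)⟫ + c ^ 2 := by
      nth_rw 1 [inner_sub_left, real_inner_smul_left]
      rw [h3]
      ring
    rw [h1]
    nlinarith [sq_nonneg c]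

lemma UpperBarrier.cons (h : UpperBarrier v u Q) {z : E} (hz : ⟪z, Q z⟫ < 1) :
    UpperBarrier (Fin.cons z v : Fin (k + 1) → E) u (rankOneUpdate Q z) where
  symm := rankOneUpdate_symm h.symm z
  le x y := by
    set α := ⟪z, y⟫ with hα
    have h1 := h.le (x + α • z) y
    have h3 : ⟪x + α • z, Q (x + α • z)⟫
        = ⟪x, Q x⟫ + 2 * α * ⟪x, Q z⟫ + α ^ 2 * ⟪z, Q z⟫ := by
      simp only [map_add, map_smul, inner_add_left, inner_add_right, inner_smul_right,
        real_inner_smul_left]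
      rw [← h.symm z x, real_inner_comm x (Q z)]
      ring
    rw [h3, inner_add_left, real_inner_smul_left, ← hα] at h1
    rw [Fin.sum_univ_succ, inner_rankOneUpdate]
    simp only [Fin.cons_zero, Fin.cons_succ, ← hα]
    generalize ⟪z, Q z⟫ = q at *
    have hs : 0 < 1 - q := by linarith
    have h4 : 0 ≤ (1 - q)⁻¹ * (α * (1 - q) - ⟪x, Q z⟫) ^ 2 := by positivity
    have h5 : (1 - q)⁻¹ * (α * (1 - q) - ⟪x, Q z⟫) ^ 2
        = α ^ 2 * (1 - q) - 2 * α * ⟪x, Q z⟫ + (1 - q)⁻¹ * ⟪x, Q z⟫ ^ 2 := by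
      field_simp
      ring
    have h6 : (q - 1)⁻¹ = -(1 - q)⁻¹ := by rw [← inv_neg, neg_sub]
    rw [h6]
    linarith

end

/-- The operator `K (1 - δ K)⁻¹`, the resolvent identity, and its symmetry. -/
lemma exists_resolvent_shift [FiniteDimensional ℝ E] {K : E →ₗ[ℝ] E}
    (hK : ∀ x y, ⟪K x, y⟫ = ⟪x, K y⟫) {δ : ℝ} (hδ : ∀ x, δ * ⟪x, K x⟫ = ‖x‖ ^ 2 → x = 0) :
    ∃ K' : E →ₗ[ℝ] E, (∀ x y, ⟪K' x, y⟫ = ⟪x, K' y⟫) ∧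
      ∀ x, ∃ y, x = y - δ • K y ∧ K' x = K y := by
  set D : E →ₗ[ℝ] E := LinearMap.id - δ • K with hD
  have hDapp : ∀ x, D x = x - δ • K x := fun x => by simp [hD]
  have hinj : Function.Injective D := by
    rw [← LinearMap.ker_eq_bot, LinearMap.ker_eq_bot']
    intro x hx
    apply hδ
    have h1 : ⟪x, D x⟫ = 0 := by rw [hx, inner_zero_right]
    rw [hDapp, inner_sub_right, inner_smul_right, real_inner_self_eq_norm_sq] at h1
    linarith
  let e := LinearEquiv.ofInjectiveEndo D hinj
  have he : ∀ x, e.symm x - δ • K (e.symm x) = x := fun x => by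
    rw [← hDapp]
    exact e.apply_symm_apply x
  refine ⟨K.comp e.symm.toLinearMap, fun x y => ?_, fun x => ⟨e.symm x, (he x).symm, rfl⟩⟩
  have hx := he x
  have hy := he y
  simp only [LinearMap.comp_apply, LinearEquiv.coe_coe]
  generalize e.symm x = p at *
  generalize e.symm y = q at *
  rw [← hx, ← hy, inner_sub_left, inner_sub_right, hK p q, inner_smul_right,
    real_inner_smul_left, hK p (K q)]

lemma LowerBarrier.exists_shift [FiniteDimensional ℝ E] {k : ℕ} {v : Fin k → E} {b b' : ℝ}
    {K : E →ₗ[ℝ] E} (h : LowerBarrier v b K) (hb' : 0 < b') (hb : b' < b) :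
    ∃ K' : E →ₗ[ℝ] E, LowerBarrier v b' K' ∧
      ∀ x, (b - b') * b' * ‖K' x‖ ^ 2 ≤ b * (⟪x, K' x⟫ - ⟪x, K x⟫) := by
  have hbp : 0 < b := hb'.trans hb
  obtain ⟨δ, rfl⟩ : ∃ δ, b' = b - δ := ⟨b - b', by ring⟩
  have hδ : 0 < δ := by linarith
  obtain ⟨K', hs, hK'⟩ := exists_resolvent_shift h.symm (δ := δ) fun x hx => by
    have h1 := h.mul_inner_le x
    by_contra h0
    have h2 : 0 < ‖x‖ ^ 2 := by positivity
    have h3 : b * ‖x‖ ^ 2 ≤ δ * ‖x‖ ^ 2 := by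
      rw [← hx]
      nlinarith
    nlinarith
  refine ⟨K', ⟨hs, fun x a => ?_, fun x => ?_⟩, fun x => ?_⟩
  · obtain ⟨y, rfl, hy⟩ := hK' x
    rw [hy]
    have h1 := h.le y a
    have h2 : y - δ • K y - ∑ i, a i • v i = (y - ∑ i, a i • v i) - δ • K y := by abel
    rw [h2]
    generalize y - ∑ i, a i • v i = p at *
    rw [norm_sub_sq_real, inner_sub_left, inner_smul_right, real_inner_smul_left, norm_smul,
      mul_pow, Real.norm_eq_abs, sq_abs, real_inner_self_eq_norm_sq]
    have h3 : 0 ≤ ‖p - b • K y‖ ^ 2 := by positivity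
    rw [norm_sub_sq_real, inner_smul_right, norm_smul, mul_pow, Real.norm_eq_abs, sq_abs] at h3
    generalize ∑ i, a i ^ 2 = r at *
    have h4 := mul_le_mul_of_nonneg_left h1 (sub_nonneg.2 hb.le)
    have h5 := mul_nonneg hδ.le h3
    refine le_of_mul_le_mul_left ?_ hbp
    nlinarith
  · obtain ⟨y, rfl, hy⟩ := hK' x
    rw [hy, inner_sub_left, real_inner_smul_left, real_inner_self_eq_norm_sq]
    linarith [h.self_le y]
  · obtain ⟨y, rfl, hy⟩ := hK' x
    have h1 := h.mul_inner_le (K y)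
    rw [hy, map_sub, map_smul]
    simp only [inner_sub_left, inner_sub_right, real_inner_smul_left, inner_smul_right,
      real_inner_self_eq_norm_sq]
    rw [← h.symm y (K y), real_inner_self_eq_norm_sq]
    nlinarith [mul_le_mul_of_nonneg_left h1 (sq_nonneg δ)]

lemma UpperBarrier.exists_shift [FiniteDimensional ℝ E] {k : ℕ} {v : Fin k → E} {u δ : ℝ}
    {Q : E →ₗ[ℝ] E} (h : UpperBarrier v u Q) (hδ : 0 < δ) :
    ∃ Q' : E →ₗ[ℝ] E, UpperBarrier v (u + δ) Q' ∧
      ∀ x, δ * ‖Q' x‖ ^ 2 ≤ ⟪x, Q x⟫ - ⟪x, Q' x⟫ := by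
  obtain ⟨Q', hs, hQ'⟩ := exists_resolvent_shift h.symm (δ := -δ) fun x hx => by
    have h1 := h.inner_nonneg x
    have h2 : ‖x‖ ^ 2 ≤ 0 := by nlinarith
    simpa using le_antisymm h2 (by positivity)
  refine ⟨Q', ⟨hs, fun x y => ?_⟩, fun x => ?_⟩
  · obtain ⟨p, rfl, hp⟩ := hQ' x
    have h1 := h.le p y
    have h3 : 0 ≤ ‖Q p - y‖ ^ 2 := by positivity
    rw [norm_sub_sq_real] at h3
    rw [hp, inner_sub_left, real_inner_smul_left, inner_sub_left, real_inner_smul_left,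
      real_inner_self_eq_norm_sq]
    nlinarith
  · obtain ⟨p, rfl, hp⟩ := hQ' x
    have h1 := h.inner_nonneg (Q p)
    rw [hp, map_sub, map_smul]
    simp only [inner_sub_left, inner_sub_right, real_inner_smul_left, inner_smul_right,
      real_inner_self_eq_norm_sq]
    rw [← h.symm p (Q p), real_inner_self_eq_norm_sq]
    nlinarith [mul_nonneg (sq_nonneg δ) h1]

end Barriers

section Selection

/-- Markov's inequality for a finite weighted sum. -/
lemma sum_ite_lt_le {ι : Type*} [Fintype ι] {w a : ι → ℝ} (hw : ∀ j, 0 ≤ w j)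
    (ha : ∀ j, 0 ≤ a j) {t M : ℝ} (ht : 0 ≤ t) (hM : 0 ≤ M) (h : ∑ j, w j * a j ≤ t * M) :
    ∑ j, (if t < a j then w j else 0) ≤ M := by
  rcases ht.eq_or_lt with rfl | ht
  · have h0 : ∑ j, w j * a j = 0 := le_antisymm (by simpa using h)
      (Finset.sum_nonneg fun j _ => mul_nonneg (hw j) (ha j))
    rw [Finset.sum_eq_zero_iff_of_nonneg fun j _ => mul_nonneg (hw j) (ha j)] at h0
    refine le_trans (Finset.sum_nonpos fun j _ => ?_) hM
    split_ifs with hj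
    · exact ((mul_eq_zero.1 (h0 j (Finset.mem_univ j))).resolve_right hj.ne').le
    · exact le_rfl
  · refine le_of_mul_le_mul_left (le_trans ?_ h) ht
    rw [Finset.mul_sum]
    refine Finset.sum_le_sum fun j _ => ?_
    split_ifs with hj
    · rw [mul_comm]
      exact mul_le_mul_of_nonneg_left hj.le (hw j)
    · simpa using mul_nonneg (hw j) (ha j)

/-- An index satisfying two Markov-type bounds and beating an average. -/
lemma exists_index {ι : Type*} [Fintype ι] {w q s a a' : ι → ℝ} {g L t t' M : ℝ}
    (hw : ∀ j, 0 ≤ w j) (hq : ∀ j, 0 ≤ q j) (ha : ∀ j, 0 ≤ a j) (ha' : ∀ j, 0 ≤ a' j)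
    (hs : ∀ j, s j ≤ L) (hL : 0 ≤ L) (hg : 0 ≤ g) (ht : 0 ≤ t) (ht' : 0 ≤ t') (hM : 0 ≤ M)
    (hat : ∑ j, w j * a j ≤ t * M) (hat' : ∑ j, w j * a' j ≤ t' * M)
    (h : ∑ j, w j * q j < g * (∑ j, w j * s j - 2 * M * L)) :
    ∃ j, a j ≤ t ∧ a' j ≤ t' ∧ q j < g * s j := by
  by_contra! hc
  have h1 := mul_le_mul_of_nonneg_left (sum_ite_lt_le hw ha ht hM hat) (mul_nonneg hg hL)
  have h2 := mul_le_mul_of_nonneg_left (sum_ite_lt_le hw ha' ht' hM hat') (mul_nonneg hg hL)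
  have h3 : g * ∑ j, w j * s j ≤ ∑ j, w j * q j
      + g * L * ∑ j, (if t < a j then w j else 0)
      + g * L * ∑ j, (if t' < a' j then w j else 0) := by
    simp only [Finset.mul_sum, ← Finset.sum_add_distrib]
    refine Finset.sum_le_sum fun j _ => ?_
    have e1 : 0 ≤ w j * q j := mul_nonneg (hw j) (hq j)
    have e2 : g * (w j * s j) ≤ g * L * w j := by
      nlinarith [mul_le_mul_of_nonneg_left (hs j) (mul_nonneg hg (hw j))]
    have e3 : 0 ≤ g * L * w j := mul_nonneg (mul_nonneg hg hL) (hw j)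
    by_cases c1 : t < a j
    · by_cases c2 : t' < a' j <;> simp only [c1, c2, if_true, if_false] <;> linarith
    · by_cases c2 : t' < a' j
      · simp only [c1, c2, if_true, if_false]
        linarith
      · simp only [c1, c2, if_false]
        nlinarith [mul_le_mul_of_nonneg_left (hc j (not_lt.1 c1) (not_lt.1 c2)) (hw j)]
  linarith

variable {E : Type*} [NormedAddCommGroup E] [InnerProductSpace ℝ E]

lemma sum_inner_rankOneUpdate {ι : Type*} [Fintype ι] (w : ι → ℝ) (z : ι → E) (K : E →ₗ[ℝ] E)
    (v : E) : ∑ j, w j * ⟪z j, rankOneUpdate K v (z j)⟫ = ∑ j, w j * ⟪z j, K (z j)⟫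
      - (⟪v, K v⟫ - 1)⁻¹ * ∑ j, w j * ⟪z j, K v⟫ ^ 2 := by
  simp only [inner_rankOneUpdate, Finset.mul_sum, ← Finset.sum_sub_distrib]
  exact Finset.sum_congr rfl fun j _ => by ring

lemma potential_estimate {ε h p p₀ β r F : ℝ} (hε : 0 < ε) (hε1 : ε ≤ 1) (hh : 0 < h)
    (hr : r * (ε * h) = 4) (hβ : β ≤ ε ^ 2 / 8) (hp₀ : ε / 2 * h ≤ p₀) (hp : p₀ ≤ p)
    (hF : r * F ≤ (1 + r) * p - p₀) : F < (1 + ε / 2 + (p - p₀)) * (p - β * h) := by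
  have hεh : 0 < ε * h := mul_pos hε hh
  have hr0 : 0 < r := by
    by_contra! hc
    nlinarith
  refine lt_of_mul_lt_mul_left (lt_of_le_of_lt hF ?_) hr0.le
  have h1 : β * h ≤ ε ^ 2 / 8 * h := mul_le_mul_of_nonneg_right hβ hh.le
  have h2 : ε ^ 2 * h ≤ ε * h := by nlinarith
  have h3 : 3 / 8 * (ε * h) ≤ p - β * h := by linarith
  have h4 : 1 ≤ r * (p - β * h) := by
    nlinarith [mul_le_mul_of_nonneg_left h3 hr0.le]
  have h5 : 0 < (1 + ε / 2) * (p - β * h) - p := by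
    have e1 : ε / 2 * (ε / 2 * h) ≤ ε / 2 * p := by
      apply mul_le_mul_of_nonneg_left (hp₀.trans hp)
      positivity
    have e2 : (1 + ε / 2) * (β * h) ≤ (3 / 2) * (ε ^ 2 / 8 * h) := by
      have : (1 + ε / 2) * (β * h) ≤ (1 + ε / 2) * (ε ^ 2 / 8 * h) :=
        mul_le_mul_of_nonneg_left h1 (by positivity)
      have h6 : 0 ≤ ε ^ 2 / 8 * h := by positivity
      nlinarith
    have e3 : 0 < ε ^ 2 * h := by positivity
    nlinarith
  nlinarith [mul_pos hr0 h5, mul_nonneg (sub_nonneg.2 hp) (sub_nonneg.2 h4)]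

variable [FiniteDimensional ℝ E] {ι : Type*} [Fintype ι] {w : ι → ℝ} {z : ι → E}

set_option maxHeartbeats 400000 in
/-- One step of the selection: both barriers are moved and a vector is added. -/
lemma exists_barrier_step (hw : ∀ j, 0 ≤ w j) (hz : ∀ j, ‖z j‖ = 1)
    (hB : ∀ y, ∑ j, w j * ⟪z j, y⟫ ^ 2 ≤ ‖y‖ ^ 2) (hh : 0 < ∑ j, w j)
    {ε r b' u : ℝ} (hε : 0 < ε) (hε1 : ε ≤ 1) (hr : r * (ε * ∑ j, w j) = 4)
    (hb0 : 0 < b') (hb1 : b' ≤ ε ^ 2 / 24)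
    {k : ℕ} {x : Fin k → ι} {K Q : E →ₗ[ℝ] E}
    (hK : LowerBarrier (fun i => z (x i)) (b' * (1 + r)) K)
    (hQ : UpperBarrier (fun i => z (x i)) u Q)
    (hKp : ε / 2 * ∑ j, w j ≤ b' * (1 + r) * ∑ j, w j * ⟪z j, K (z j)⟫)
    (hQp : ∑ j, w j * ⟪z j, Q (z j)⟫ ≤ ε ^ 2 / 48 * ∑ j, w j) :
    ∃ (j : ι) (K' Q' : E →ₗ[ℝ] E),
      LowerBarrier (fun i => z ((Fin.cons j x : Fin (k + 1) → ι) i)) b' K' ∧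
      UpperBarrier (fun i => z ((Fin.cons j x : Fin (k + 1) → ι) i))
        (u + 48 / (ε ^ 2 * ∑ j, w j)) Q' ∧
      b' * (1 + r) * ∑ j, w j * ⟪z j, K (z j)⟫ - (1 + ε / 2)
        ≤ b' * ∑ j, w j * ⟪z j, K' (z j)⟫ ∧
      ∑ j, w j * ⟪z j, Q' (z j)⟫ ≤ ε ^ 2 / 48 * ∑ j, w j := by
  set h := ∑ j, w j with hdef
  have hεh : 0 < ε * h := mul_pos hε hh
  have hr0 : 0 < r := by
    by_contra! hc
    nlinarith
  obtain ⟨K', hK', hKK'⟩ := hK.exists_shift hb0 (by nlinarith)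
  have hδ : 0 < 48 / (ε ^ 2 * h) := by positivity
  obtain ⟨Q', hQ', hQQ'⟩ := hQ.exists_shift hδ
  set δ := 48 / (ε ^ 2 * h) with hδdef
  have hδh : δ * (ε ^ 2 * h) = 48 := by
    rw [hδdef]
    field_simp
  set Ψ := ∑ j, w j * ⟪z j, Q (z j)⟫
  set Ψ' := ∑ j, w j * ⟪z j, Q' (z j)⟫ with hΨ'
  set Φ := ∑ j, w j * ⟪z j, K (z j)⟫
  set Φ' := ∑ j, w j * ⟪z j, K' (z j)⟫ with hΦ'
  set F := ∑ j, w j * ‖K' (z j)‖ ^ 2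
  set G := ∑ j, w j * ‖Q' (z j)‖ ^ 2
  have hGΨ : δ * G ≤ Ψ - Ψ' := by
    simp only [G, Ψ, Ψ', Finset.mul_sum, ← Finset.sum_sub_distrib]
    exact Finset.sum_le_sum fun j _ => by
      nlinarith [mul_le_mul_of_nonneg_left (hQQ' (z j)) (hw j)]
  have hG0 : 0 ≤ G := Finset.sum_nonneg fun j _ => mul_nonneg (hw j) (sq_nonneg _)
  have hFΦ : b' * r * b' * F ≤ b' * (1 + r) * (Φ' - Φ) := by
    simp only [F, Φ, Φ', Finset.mul_sum, ← Finset.sum_sub_distrib]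
    exact Finset.sum_le_sum fun j _ => by
      nlinarith [mul_le_mul_of_nonneg_left (hKK' (z j)) (hw j)]
  have hΦF : Φ' ≤ b' * F := by
    simp only [F, Φ', Finset.mul_sum]
    exact Finset.sum_le_sum fun j _ => by
      nlinarith [mul_le_mul_of_nonneg_left (hK'.self_le (z j)) (hw j)]
  have hpp : b' * (1 + r) * Φ ≤ b' * Φ' := by
    nlinarith [mul_le_mul_of_nonneg_left hΦF (mul_pos hb0 hr0).le]
  have hest : b' ^ 2 * F < (1 + ε / 2 + (b' * Φ' - b' * (1 + r) * Φ))
      * (b' * Φ' - (b' + ε ^ 2 / 12) * h) := by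
    refine potential_estimate hε hε1 hh hr (by linarith) hKp hpp ?_
    nlinarith
  set g := (1 + ε / 2 + (b' * Φ' - b' * (1 + r) * Φ)) / b' with hg
  have hg0 : 0 ≤ g := by
    apply div_nonneg _ hb0.le
    linarith
  have hgb : b' * g = 1 + ε / 2 + (b' * Φ' - b' * (1 + r) * Φ) := by
    rw [hg]
    field_simp
  obtain ⟨j, hj1, hj2, hj3⟩ := exists_index (w := w) (q := fun j => ‖K' (z j)‖ ^ 2)
    (s := fun j => ⟪z j, K' (z j)⟫ - 1) (a := fun j => ⟪z j, Q' (z j)⟫)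
    (a' := fun j => ‖Q' (z j)‖ ^ 2) (g := g) (L := b'⁻¹) (t := 1 / 2) (t' := (Ψ - Ψ') / 2)
    (M := ε ^ 2 / 24 * h) hw (fun j => sq_nonneg _) (fun j => hQ'.inner_nonneg _)
    (fun j => sq_nonneg _)
    (fun j => by
      have h1 := hK'.mul_inner_le (z j)
      rw [hz, one_pow, ← le_div_iff₀' hb0, one_div] at h1
      linarith)
    (by positivity) hg0 (by norm_num) (by nlinarith) (by positivity)
    (by nlinarith)
    (by
      have : G = δ * G * (ε ^ 2 * h) / 48 := by
        rw [mul_right_comm, hδh]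
        ring
      change G ≤ _
      rw [this]
      nlinarith [mul_le_mul_of_nonneg_right hGΨ (show 0 ≤ ε ^ 2 * h by positivity)])
    (by
      change F < g * (_ - _)
      have e1 : ∑ j, w j * (⟪z j, K' (z j)⟫ - 1) = Φ' - h := by
        simp only [mul_sub, mul_one, Finset.sum_sub_distrib, hΦ', hdef]
      rw [e1]
      refine lt_of_mul_lt_mul_left ?_ (sq_nonneg b')
      refine hest.trans_eq ?_
      rw [← hgb]
      field_simp
      ring)
  have hs : 1 < ⟪z j, K' (z j)⟫ := by
    by_contra! hc
    nlinarith [sq_nonneg ‖K' (z j)‖]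
  have hcons : (fun i => z ((Fin.cons j x : Fin (k + 1) → ι) i))
      = (Fin.cons (z j) (fun i => z (x i)) : Fin (k + 1) → E) := by
    funext i
    refine Fin.cases ?_ (fun i => ?_) i <;> simp
  refine ⟨j, rankOneUpdate K' (z j), rankOneUpdate Q' (z j), ?_, ?_, ?_, ?_⟩
  · rw [hcons]
    exact hK'.cons hb0.le hs
  · rw [hcons]
    exact hQ'.cons (by linarith)
  · rw [sum_inner_rankOneUpdate]
    have e1 : (⟪z j, K' (z j)⟫ - 1)⁻¹ * ∑ i, w i * ⟪z i, K' (z j)⟫ ^ 2 ≤ g := by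
      rw [inv_mul_le_iff₀ (by linarith), mul_comm]
      exact (hB _).trans hj3.le
    nlinarith [mul_le_mul_of_nonneg_left e1 hb0.le]
  · rw [sum_inner_rankOneUpdate]
    refine le_trans ?_ hQp
    have e1 : -(⟪z j, Q' (z j)⟫ - 1)⁻¹ * ∑ i, w i * ⟪z i, Q' (z j)⟫ ^ 2 ≤ Ψ - Ψ' := by
      rw [← inv_neg, neg_sub, inv_mul_le_iff₀ (by linarith)]
      nlinarith [hB (Q' (z j)), sq_nonneg ‖Q' (z j)‖]
    linarith

/-- A well-conditioned subsystem of size `κ ≤ (1 - ε) h` of a decomposition of total mass `h`. -/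
theorem exists_wellConditioned (hw : ∀ j, 0 ≤ w j) (hz : ∀ j, ‖z j‖ = 1)
    (hB : ∀ y, ∑ j, w j * ⟪z j, y⟫ ^ 2 ≤ ‖y‖ ^ 2) (hh : 0 < ∑ j, w j)
    {ε : ℝ} (hε : 0 < ε) (hε1 : ε ≤ 1) {κ : ℕ} (hκ : (κ : ℝ) ≤ (1 - ε) * ∑ j, w j) :
    ∃ x : Fin κ → ι, ∀ a : Fin κ → ℝ,
      ε ^ 2 / 24 * Real.exp (-(4 / ε)) * ∑ i, a i ^ 2 ≤ ‖∑ i, a i • z (x i)‖ ^ 2 ∧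
      ‖∑ i, a i • z (x i)‖ ^ 2 ≤ 96 / ε ^ 2 * ∑ i, a i ^ 2 := by
  set h := ∑ j, w j with hdef
  set r := 4 / (ε * h) with hrdef
  have hr : r * (ε * h) = 4 := by
    rw [hrdef]
    field_simp
  have hr0 : 0 < r := by positivity
  have key : ∀ k : ℕ, k ≤ κ → ∃ (x : Fin k → ι) (K Q : E →ₗ[ℝ] E),
      LowerBarrier (fun i => z (x i)) (ε ^ 2 / 24 / (1 + r) ^ k) K ∧
      UpperBarrier (fun i => z (x i)) (48 / ε ^ 2 + k * (48 / (ε ^ 2 * h))) Q ∧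
      h - (1 + ε / 2) * k ≤ ε ^ 2 / 24 / (1 + r) ^ k * ∑ j, w j * ⟪z j, K (z j)⟫ ∧
      ∑ j, w j * ⟪z j, Q (z j)⟫ ≤ ε ^ 2 / 48 * h := by
    intro k
    induction k with
    | zero =>
      intro _
      refine ⟨Fin.elim0, (ε ^ 2 / 24 / (1 + r) ^ 0)⁻¹ • LinearMap.id,
        (48 / ε ^ 2 + (0 : ℕ) * (48 / (ε ^ 2 * h)))⁻¹ • LinearMap.id,
        .of_isEmpty (by positivity) _, .of_isEmpty (by positivity) _, ?_, ?_⟩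
      · simp only [LinearMap.smul_apply, LinearMap.id_apply, inner_smul_right,
          real_inner_self_eq_norm_sq, hz, one_pow, mul_one, ← Finset.sum_mul, ← hdef]
        apply le_of_eq
        field_simp
        simp
      · simp only [LinearMap.smul_apply, LinearMap.id_apply, inner_smul_right,
          real_inner_self_eq_norm_sq, hz, one_pow, mul_one, ← Finset.sum_mul, ← hdef]
        apply le_of_eq
        simp
        ring
    | succ k ih =>
      intro hk
      obtain ⟨x, K, Q, hK, hQ, hKp, hQp⟩ := ih (by omega)
      have hb : ε ^ 2 / 24 / (1 + r) ^ k = ε ^ 2 / 24 / (1 + r) ^ (k + 1) * (1 + r) := by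
        field_simp
        ring
      rw [hb] at hK hKp
      have hb1 : ε ^ 2 / 24 / (1 + r) ^ (k + 1) ≤ ε ^ 2 / 24 :=
        div_le_self (by positivity) (one_le_pow₀ (by linarith))
      have hk1 : (k : ℝ) ≤ (1 - ε) * h := by
        refine le_trans ?_ hκ
        exact_mod_cast (by omega : k ≤ κ)
      have hlow : ε / 2 * h ≤ h - (1 + ε / 2) * k := by
        have e1 : (1 + ε / 2) * k ≤ (1 + ε / 2) * ((1 - ε) * h) :=
          mul_le_mul_of_nonneg_left hk1 (by positivity)
        have e2 : 0 ≤ ε ^ 2 * h := by positivity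
        nlinarith
      obtain ⟨j, K', Q', hK', hQ', hKp', hQp'⟩ := exists_barrier_step hw hz hB hh hε hε1 hr
        (by positivity) hb1 hK hQ (hlow.trans hKp) hQp
      refine ⟨Fin.cons j x, K', Q', hK', ?_, ?_, hQp'⟩
      · convert hQ' using 1
        push_cast
        ring
      · refine le_trans ?_ hKp'
        push_cast
        linarith
  obtain ⟨x, K, Q, hK, hQ, -, -⟩ := key κ le_rfl
  have hκh : (κ : ℝ) ≤ h := by nlinarith
  refine ⟨x, fun a => ?_⟩
  have ha : 0 ≤ ∑ i, a i ^ 2 := Finset.sum_nonneg fun i _ => sq_nonneg _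
  refine ⟨le_trans (mul_le_mul_of_nonneg_right ?_ ha) (hK.le_norm_sq a),
    (hQ.norm_sq_le (by positivity) a).trans (mul_le_mul_of_nonneg_right ?_ ha)⟩
  · rw [div_eq_mul_inv _ ((1 + r) ^ κ), Real.exp_neg]
    refine mul_le_mul_of_nonneg_left ?_ (by positivity)
    apply inv_anti₀ (by positivity)
    calc (1 + r) ^ κ ≤ Real.exp r ^ κ := by
          gcongr
          linarith [Real.add_one_le_exp r]
      _ = Real.exp (κ * r) := (Real.exp_nat_mul r κ).symm
      _ ≤ Real.exp (4 / ε) := by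
          apply Real.exp_le_exp.2
          have : h * r = 4 / ε := by
            rw [hrdef]
            field_simp
          rw [← this]
          exact mul_le_mul_of_nonneg_right hκh hr0.le
  · have e1 : (κ : ℝ) * (48 / (ε ^ 2 * h)) ≤ h * (48 / (ε ^ 2 * h)) :=
      mul_le_mul_of_nonneg_right hκh (by positivity)
    have e2 : h * (48 / (ε ^ 2 * h)) = 48 / ε ^ 2 := by field_simp
    have e3 : 96 / ε ^ 2 = 48 / ε ^ 2 + 48 / ε ^ 2 := by ring
    linarith

end Selection

section JohnDecomposition

variable {n m : ℕ} {c : Fin m → ℝ} {u : Fin m → EuclideanSpace ℝ (Fin n)}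

lemma sum_mul_inner_sq_of_decomposition
    (hu : ∀ v : EuclideanSpace ℝ (Fin n), ∑ j, c j • ⟪u j, v⟫ • u j = v)
    (v : EuclideanSpace ℝ (Fin n)) : ∑ j, c j * ⟪u j, v⟫ ^ 2 = ‖v‖ ^ 2 := by
  rw [← real_inner_self_eq_norm_sq]
  nth_rw 3 [← hu v]
  rw [inner_sum]
  refine Finset.sum_congr rfl fun j _ => ?_
  rw [inner_smul_right, inner_smul_right, real_inner_comm (u j) v]
  ring

lemma norm_sq_eq_sum_inner_single (v : EuclideanSpace ℝ (Fin n)) :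
    ‖v‖ ^ 2 = ∑ i, ⟪v, EuclideanSpace.single i 1⟫ ^ 2 := by
  simp [EuclideanSpace.real_norm_sq_eq, EuclideanSpace.inner_single_right]

lemma sum_mul_norm_sq_of_decomposition
    (hu : ∀ v : EuclideanSpace ℝ (Fin n), ∑ j, c j • ⟪u j, v⟫ • u j = v)
    {S : EuclideanSpace ℝ (Fin n) →L[ℝ] EuclideanSpace ℝ (Fin n)}
    (hS : ∀ v w, ⟪S v, w⟫ = ⟪v, S w⟫) : ∑ j, c j * ‖S (u j)‖ ^ 2 = hsNormSq S := by
  simp only [norm_sq_eq_sum_inner_single (S _), Finset.mul_sum, hS, hsNormSq]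
  rw [Finset.sum_comm]
  refine Finset.sum_congr rfl fun i _ => ?_
  simp only [sum_mul_inner_sq_of_decomposition hu, norm_sq_eq_sum_inner_single, hS]

lemma sum_eq_of_decomposition
    (hu : ∀ v : EuclideanSpace ℝ (Fin n), ∑ j, c j • ⟪u j, v⟫ • u j = v)
    (hu1 : ∀ j, ‖u j‖ = 1) : ∑ j, c j = n := by
  simpa [hu1, hsNormSq] using sum_mul_norm_sq_of_decomposition hu
    (S := ContinuousLinearMap.id ℝ (EuclideanSpace ℝ (Fin n))) fun v w => rfl

end JohnDecomposition

lemma norm_sq_le_inner_of_le_one {E : Type*} [NormedAddCommGroup E] [InnerProductSpace ℝ E]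
    {S : E →L[ℝ] E} (hS : ∀ v w, ⟪S v, w⟫ = ⟪v, S w⟫) (hpos : ∀ v, 0 ≤ ⟪v, S v⟫)
    (hle : ∀ v, ‖S v‖ ≤ ‖v‖) (v : E) : ‖S v‖ ^ 2 ≤ ⟪v, S v⟫ := by
  have h1 := hpos (v - S v)
  have h2 : ⟪S v, S (S v)⟫ ≤ ‖S v‖ ^ 2 := by
    refine (real_inner_le_norm _ _).trans ?_
    rw [sq]
    exact mul_le_mul_of_nonneg_left (hle _) (norm_nonneg _)
  rw [map_sub, inner_sub_left, inner_sub_right, inner_sub_right, ← hS v (S v),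
    real_inner_self_eq_norm_sq] at h1
  linarith

/-- Dvoretzky–Rogers type lemma for arbitrary operators, via the
positive part `|T| = (T*T)^{1/2}`, i.e. the selfadjoint positive operator `S` with
`S² = T*T`. There are `c > 0` and `C : (0,1) → (0,∞)` such that: whenever `X = (ℝⁿ, N)`
admits a John decomposition, `‖T‖₂→₂ ≤ 1`, `h = ‖T‖_HS²` and `κ < h` is a positive
integer, there exist contact points `x₁, …, x_κ` with `T xⱼ ≠ 0` such that
`zⱼ = |T| xⱼ / ‖T xⱼ‖₂` satisfy: (i) `(zⱼ)` is `C(κ/h)`-equivalent in euclidean norm to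
the canonical basis of `l₂^κ`; (ii) `N zⱼ ≥ c √((h-κ)/n)` for all `j`. -/
theorem dvoretzky_rogers_polar :
    ∃ c : ℝ, 0 < c ∧ ∃ C : ℝ → ℝ, (∀ t, 0 < C t) ∧
      ∀ (n : ℕ), 0 < n → ∀ N : EuclideanSpace ℝ (Fin n) → ℝ, IsJohnNorm N →
      ∀ T : EuclideanSpace ℝ (Fin n) →L[ℝ] EuclideanSpace ℝ (Fin n), ‖T‖ ≤ 1 →
      ∀ S : EuclideanSpace ℝ (Fin n) →L[ℝ] EuclideanSpace ℝ (Fin n),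
        (∀ v w, ⟪S v, w⟫ = ⟪v, S w⟫) → (∀ v, 0 ≤ ⟪v, S v⟫) →
        S.comp S = (ContinuousLinearMap.adjoint T).comp T →
      ∀ κ : ℕ, 0 < κ → (κ : ℝ) < hsNormSq T →
      ∃ x : Fin κ → EuclideanSpace ℝ (Fin n),
        (∀ j, IsContactPoint N (x j)) ∧ (∀ j, T (x j) ≠ 0) ∧
        (∃ K₁ K₂ : ℝ, 0 < K₁ ∧ 0 < K₂ ∧ K₁ * K₂ ≤ C ((κ : ℝ) / hsNormSq T) ∧
          ∀ a : Fin κ → ℝ,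
            K₁⁻¹ * Real.sqrt (∑ j, (a j) ^ 2)
                ≤ ‖∑ j, a j • (‖T (x j)‖⁻¹ • S (x j))‖ ∧
            ‖∑ j, a j • (‖T (x j)‖⁻¹ • S (x j))‖
                ≤ K₂ * Real.sqrt (∑ j, (a j) ^ 2)) ∧
        ∀ j, c * Real.sqrt ((hsNormSq T - κ) / n) ≤ N (‖T (x j)‖⁻¹ • S (x j)) := by
  let ε : ℝ → ℝ := fun t => (1 - t) / (1 + t)
  let B : ℝ → ℝ := fun t => ε t ^ 2 / 24 * Real.exp (-(4 / ε t))
  refine ⟨1 / 2, by norm_num, fun t => √(B t)⁻¹ * √(96 / ε t ^ 2) + 1,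
    fun t => by positivity, ?_⟩
  intro n hn N hN T hT S hS hSpos hST κ hκ0 hκ
  obtain ⟨-, -, -, -, m, c, u, hc, hu, hdec⟩ := hN
  have hn' : (0 : ℝ) < n := by exact_mod_cast hn
  have hκ' : (0 : ℝ) < κ := by exact_mod_cast hκ0
  have hST' : ∀ v, ‖S v‖ = ‖T v‖ := fun v => by
    have h1 : S (S v) = ContinuousLinearMap.adjoint T (T v) := DFunLike.congr_fun hST v
    rw [← sq_eq_sq₀ (norm_nonneg _) (norm_nonneg _), ← real_inner_self_eq_norm_sq,
      ← real_inner_self_eq_norm_sq, hS, h1, ContinuousLinearMap.adjoint_inner_right]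
  have hSle : ∀ v, ‖S v‖ ≤ ‖v‖ := fun v => by
    rw [hST']
    exact T.le_of_opNorm_le hT v |>.trans_eq (one_mul _)
  have hhs : hsNormSq S = hsNormSq T := by simp only [hsNormSq, hST']
  set h := hsNormSq T
  have hsum : ∑ j, c j * ‖S (u j)‖ ^ 2 = h :=
    (sum_mul_norm_sq_of_decomposition hdec hS).trans hhs
  have hcn : ∑ j, c j = n := sum_eq_of_decomposition hdec fun j => (hu j).1
  set d := (h - κ) / (4 * n) with hd
  have hd0 : 0 < d := div_pos (by linarith) (by positivity)
  let good : Fin m → Prop := fun j => d ≤ ‖S (u j)‖ ^ 2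
  have hgood : ∀ j : {j // good j}, 0 < ‖S (u j)‖ := fun j =>
    (norm_nonneg _).lt_of_ne' fun h0 => by
      have := j.2
      simp only [good, h0] at this
      linarith
  let w : {j // good j} → ℝ := fun j => c j * ‖S (u j)‖ ^ 2
  let z : {j // good j} → EuclideanSpace ℝ (Fin n) := fun j => ‖S (u j)‖⁻¹ • S (u j)
  have hw : ∀ j, 0 ≤ w j := fun j => mul_nonneg (hc j).le (sq_nonneg _)
  have hz : ∀ j, ‖z j‖ = 1 := fun j => by
    simp only [z, norm_smul, norm_inv, norm_norm]
    exact inv_mul_cancel₀ (hgood j).ne'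
  have hB : ∀ y, ∑ j, w j * ⟪z j, y⟫ ^ 2 ≤ ‖y‖ ^ 2 := fun y => by
    have h1 : ∀ j, w j * ⟪z j, y⟫ ^ 2 = c j * ⟪u j, S y⟫ ^ 2 := fun j => by
      simp only [w, z, real_inner_smul_left, hS]
      have := (hgood j).ne'
      field_simp
    calc ∑ j, w j * ⟪z j, y⟫ ^ 2 = ∑ j : {j // good j}, c j * ⟪u j, S y⟫ ^ 2 :=
          Finset.sum_congr rfl fun j _ => h1 j
      _ = ∑ j with good j, c j * ⟪u j, S y⟫ ^ 2 :=
          (Finset.sum_subtype _ (by simp) fun j => c j * ⟪u j, S y⟫ ^ 2).symm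
      _ ≤ ∑ j, c j * ⟪u j, S y⟫ ^ 2 :=
          Finset.sum_le_sum_of_subset_of_nonneg (Finset.filter_subset _ _)
            fun j _ _ => mul_nonneg (hc j).le (sq_nonneg _)
      _ = ‖S y‖ ^ 2 := sum_mul_inner_sq_of_decomposition hdec _
      _ ≤ ‖y‖ ^ 2 := pow_le_pow_left₀ (norm_nonneg _) (hSle y) 2
  have hmass : (h + κ) / 2 ≤ ∑ j, w j := by
    have h1 : ∑ j, w j = ∑ j with good j, c j * ‖S (u j)‖ ^ 2 :=
      (Finset.sum_subtype _ (by simp) fun j => c j * ‖S (u j)‖ ^ 2).symm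
    have h2 : ∑ j with ¬ good j, c j * ‖S (u j)‖ ^ 2 ≤ n * d := by
      calc ∑ j with ¬ good j, c j * ‖S (u j)‖ ^ 2 ≤ ∑ j with ¬ good j, c j * d :=
            Finset.sum_le_sum fun j hj =>
              mul_le_mul_of_nonneg_left (not_le.1 (Finset.mem_filter.1 hj).2).le (hc j).le
        _ ≤ ∑ j, c j * d := Finset.sum_le_sum_of_subset_of_nonneg (Finset.filter_subset _ _)
            fun j _ _ => mul_nonneg (hc j).le hd0.le
        _ = n * d := by rw [← Finset.sum_mul, hcn]
    have h3 : n * d = (h - κ) / 4 := by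
      rw [hd]
      field_simp
    have h4 := Finset.sum_filter_add_sum_filter_not Finset.univ good
      fun j => c j * ‖S (u j)‖ ^ 2
    linarith
  have hh : 0 < h := hκ'.trans hκ
  have hε : ε (κ / h) = (h - κ) / (h + κ) := by
    simp only [ε]
    field_simp
  have hε0 : 0 < ε (κ / h) := by
    rw [hε]
    exact div_pos (by linarith) (by linarith)
  have hε1 : ε (κ / h) ≤ 1 := by
    rw [hε, div_le_one (by linarith)]
    linarith
  have hκle : (κ : ℝ) ≤ (1 - ε (κ / h)) * ∑ j, w j := by
    refine le_trans (le_of_eq ?_) (mul_le_mul_of_nonneg_left hmass (by linarith))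
    rw [hε]
    have : h + κ ≠ 0 := by positivity
    field_simp
    ring
  obtain ⟨x, hx⟩ := exists_wellConditioned hw hz hB (by linarith) hε0 hε1 hκle
  have hBpos : 0 < B (κ / h) := by positivity
  have hxz : ∀ j, ‖T (u (x j))‖⁻¹ • S (u (x j)) = z (x j) := fun j => by
    simp only [z, hST']
  refine ⟨fun j => u (x j), fun j => hu _, fun j h0 => ?_,
    ⟨√(B (κ / h))⁻¹, √(96 / ε (κ / h) ^ 2), by positivity, by positivity,
      by linarith, fun a => ⟨?_, ?_⟩⟩, fun j => ?_⟩
  · have := hgood (x j)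
    rw [hST', h0, norm_zero] at this
    exact this.false
  · simp only [hxz]
    rw [Real.sqrt_inv, inv_inv, ← Real.sqrt_mul hBpos.le]
    exact Real.sqrt_le_left (norm_nonneg _) |>.2 (hx a).1
  · simp only [hxz]
    rw [← Real.sqrt_mul (by positivity)]
    exact Real.le_sqrt_of_sq_le (hx a).2
  · refine le_trans ?_ ((hu (x j)).2.2 _)
    have h1 := norm_sq_le_inner_of_le_one hS hSpos hSle (u (x j))
    have h2 := hgood (x j)
    rw [inner_smul_right, ← hST', inv_mul_eq_div, le_div_iff₀ h2]
    refine le_trans ?_ h1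
    rw [sq]
    refine mul_le_mul_of_nonneg_right ?_ h2.le
    have h3 : 1 / 2 * √((h - κ) / n) = √d := by
      rw [hd, show (h - κ) / (4 * n) = (1 / 2) ^ 2 * ((h - κ) / n) by ring,
        Real.sqrt_mul (by positivity), Real.sqrt_sq (by norm_num)]
    rw [h3]
    exact Real.sqrt_le_left h2.le |>.2 (x j).2
end

section
/- For every ε ∈ (0,1) there is a constant C(ε) > 0 depending only on ε with the following property. Let X = (ℝⁿ, ‖·‖_X) satisfy ‖x‖_X ≤ ‖x‖₂ for all x and admit a John decomposition. Then there exist an integer k > (1−ε)n and contact points x_1, …, x_k of X such that the system (x_j)_{j≤k} is C(ε)-equivalent (in the euclidean norm) to the canonical basis of l₂^k. -/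
open scoped RealInnerProductSpace

section

open Matrix

/-- The matrix `M` bordered by the vector `w` and the corner entry `d`. -/
def Matrix.bordered {ι : Type*} (M : Matrix ι ι ℝ) (w : ι → ℝ) (d : ℝ) :
    Matrix (ι ⊕ Unit) (ι ⊕ Unit) ℝ :=
  fromBlocks M (replicateCol Unit w) (replicateRow Unit w) (of fun _ _ => d)

/-- A bordered positive definite matrix with positive Schur complement is positive definite,
and the trace of its inverse is given by the Schur complement formula. -/
lemma Matrix.PosDef.bordered {ι : Type*} [Fintype ι] [DecidableEq ι] {M : Matrix ι ι ℝ}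
    (hM : M.PosDef) {w : ι → ℝ} {d : ℝ} (hs : 0 < d - w ⬝ᵥ (M⁻¹ *ᵥ w)) :
    (M.bordered w d).PosDef ∧
      (M.bordered w d)⁻¹.trace =
        M⁻¹.trace + (1 + w ⬝ᵥ ((M⁻¹ * M⁻¹) *ᵥ w)) / (d - w ⬝ᵥ (M⁻¹ *ᵥ w)) := by
  set s := d - w ⬝ᵥ (M⁻¹ *ᵥ w) with hsdef
  have hdet : IsUnit M.det := (Matrix.isUnit_iff_isUnit_det _).1 hM.isUnit
  have hT : M⁻¹ᵀ = M⁻¹ := by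
    simpa using hM.inv.isHermitian.eq
  set z := M⁻¹ *ᵥ w with hz
  have hMz : M *ᵥ z = w := by
    rw [hz, mulVec_mulVec, mul_nonsing_inv _ hdet, one_mulVec]
  have hzv : w ᵥ* M⁻¹ = z := by
    rw [hz, ← vecMul_transpose, hT]
  have hzz : w ⬝ᵥ ((M⁻¹ * M⁻¹) *ᵥ w) = z ⬝ᵥ z := by
    rw [← mulVec_mulVec, dotProduct_mulVec, hzv]
  have hmul : M.bordered w d * fromBlocks (M⁻¹ + s⁻¹ • vecMulVec z z)
      (replicateCol Unit (-s⁻¹ • z)) (replicateRow Unit (-s⁻¹ • z)) (of fun _ _ => s⁻¹) = 1 := by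
    rw [Matrix.bordered, fromBlocks_multiply, ← fromBlocks_one]
    congr 1
    · rw [mul_add, mul_nonsing_inv _ hdet, Matrix.mul_smul, mul_vecMulVec, hMz]
      ext i j
      simp [vecMulVec_apply, mul_apply]
      ring
    · ext i j
      have := congrFun hMz i
      simp only [mulVec, dotProduct] at this
      simp [mul_apply, mul_left_comm _ s⁻¹, ← Finset.mul_sum, this]
      ring
    · ext i j
      have := congrFun hzv j
      simp only [vecMul, dotProduct] at this
      have h2 : ∑ k, w k * (s⁻¹ * (z k * z j)) = s⁻¹ * z j * (w ⬝ᵥ z) := by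
        rw [dotProduct, Finset.mul_sum]; exact Finset.sum_congr rfl fun _ _ => by ring
      simp [mul_apply, mul_add, Finset.sum_add_distrib, this, vecMulVec_apply, h2]
      have h3 : w ⬝ᵥ z = d - s := by rw [hsdef]; ring
      rw [h3]; field_simp; ring
    · ext i j
      have h2 : ∑ k, w k * (s⁻¹ * z k) = s⁻¹ * (w ⬝ᵥ z) := by
        rw [dotProduct, Finset.mul_sum]; exact Finset.sum_congr rfl fun _ _ => by ring
      have h3 : w ⬝ᵥ z = d - s := by rw [hsdef]; ring
      simp [mul_apply, h2, h3]
      field_simp; ring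
  have hinv := inv_eq_right_inv hmul
  have hunit : IsUnit (M.bordered w d) := IsUnit.of_mul_eq_one _ hmul
  refine ⟨?_, ?_⟩
  · have : Invertible M := hM.isUnit.invertible
    have hps : (M.bordered w d).PosSemidef := by
      have := (PosDef.fromBlocks₁₁ (replicateCol Unit w) (of fun _ _ => d) hM).2 (by
        have : ((of fun _ _ => d : Matrix Unit Unit ℝ) -
            (replicateCol Unit w)ᴴ * M⁻¹ * replicateCol Unit w) = s • 1 := by
          ext i j
          have : ∀ x, ∑ k, w k * M⁻¹ k x = z x := fun x => congrFun hzv x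
          simp [mul_apply, this, hsdef, dotProduct, mul_comm]
        rw [this]
        exact PosSemidef.one.smul hs.le)
      simpa [Matrix.bordered] using this
    exact hps.posDef_iff_isUnit.2 hunit
  · rw [hinv, hzz]
    simp [trace, vecMulVec_apply, Finset.sum_add_distrib, dotProduct, ← Finset.mul_sum]
    field_simp
    ring

/-- Shifting a positive definite matrix by `δ` decreases the trace of its inverse by at least
`δ` times the trace of the square of the shifted inverse. -/
lemma Matrix.PosDef.shift {ι : Type*} [Fintype ι] [DecidableEq ι] {M : Matrix ι ι ℝ}
    (hM : M.PosDef) {δ : ℝ} (hδ : 0 ≤ δ) :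
    (M + δ • 1).PosDef ∧
      (M + δ • 1)⁻¹.trace + δ * ((M + δ • 1)⁻¹ * (M + δ • 1)⁻¹).trace ≤ M⁻¹.trace := by
  have hN : (M + δ • 1).PosDef := hM.add_posSemidef (PosSemidef.one.smul hδ)
  refine ⟨hN, ?_⟩
  set R := (M + δ • 1)⁻¹ with hR
  have h1 : M * M⁻¹ = 1 := mul_nonsing_inv _ ((Matrix.isUnit_iff_isUnit_det _).1 hM.isUnit)
  have h2 : R * (M + δ • 1) = 1 :=
    nonsing_inv_mul _ ((Matrix.isUnit_iff_isUnit_det _).1 hN.isUnit)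
  have h3 : M⁻¹ = R + δ • (R * M⁻¹) := by
    calc M⁻¹ = R * (M + δ • 1) * M⁻¹ := by rw [h2, one_mul]
      _ = R * (M * M⁻¹) + δ • (R * M⁻¹) := by simp [mul_add, add_mul, mul_assoc]
      _ = _ := by rw [h1, mul_one]
  have h4 : M⁻¹ = R + δ • (R * R) + (δ * δ) • (R * (R * M⁻¹)) := by
    nth_rw 1 [h3]; nth_rw 1 [h3]
    simp [mul_add, smul_smul, add_assoc]
  have h5 : 0 ≤ (R * (R * M⁻¹)).trace := by
    rw [← mul_assoc, trace_mul_comm, ← mul_assoc, trace_mul_comm, ← mul_assoc]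
    have := (hM.inv.posSemidef.mul_mul_conjTranspose_same R).trace_nonneg
    rwa [hN.inv.isHermitian.eq] at this
  have h6 := congrArg trace h4
  simp only [trace_add, trace_smul, smul_eq_mul] at h6
  nlinarith [mul_nonneg (mul_nonneg hδ hδ) h5]

lemma sum_mul_dotProduct_mulVec {ι κ : Type*} [Fintype ι] [Fintype κ] {G : Matrix ι ι ℝ}
    {c : κ → ℝ} {w : κ → ι → ℝ} (hG : ∀ i j, ∑ l, c l * (w l i * w l j) = G i j)
    (R : Matrix ι ι ℝ) : ∑ l, c l * (w l ⬝ᵥ (R *ᵥ w l)) = (R * G).trace := by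
  have hGs : ∀ i j, G i j = G j i := fun i j => by
    rw [← hG, ← hG]; exact Finset.sum_congr rfl fun _ _ => by ring
  simp only [trace, diag_apply, mul_apply, dotProduct, mulVec, Finset.mul_sum]
  rw [Finset.sum_comm]
  refine Finset.sum_congr rfl fun i _ => ?_
  rw [Finset.sum_comm]
  refine Finset.sum_congr rfl fun j _ => ?_
  rw [hGs j i, ← hG, Finset.mul_sum]
  exact Finset.sum_congr rfl fun _ _ => by ring

lemma trace_inv_mul_of_mul_eq {ι : Type*} [Fintype ι] [DecidableEq ι] {P G : Matrix ι ι ℝ}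
    {σ τ : ℝ} (hP : P.PosDef) (h : G = σ • P + τ • 1) :
    (P⁻¹ * G).trace = σ * Fintype.card ι + τ * P⁻¹.trace ∧
      (P⁻¹ * P⁻¹ * G).trace = σ * P⁻¹.trace + τ * (P⁻¹ * P⁻¹).trace := by
  have h1 : P⁻¹ * P = 1 := nonsing_inv_mul _ ((Matrix.isUnit_iff_isUnit_det _).1 hP.isUnit)
  subst h
  constructor
  · simp [mul_add, h1]
  · simp [mul_add, mul_assoc, h1]

/-- If weighted averages of four nonnegative functions are small, then some index makes all of
them small, the first one with the sharp constant. -/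
lemma exists_forall_le_of_average {κ : Type*} [Fintype κ] {c h₁ g₁ h₂ g₂ : κ → ℝ}
    {n ε r H₁ G₁ H₂ G₂ η : ℝ} (hn : 0 < n) (hε : 0 < ε) (hη : 0 < η) (hr : r ≤ 1)
    (hc : ∀ l, 0 < c l) (hsum : ∑ l, c l = n)
    (p₁ : ∀ l, 0 ≤ h₁ l) (p₂ : ∀ l, 0 ≤ g₁ l) (p₃ : ∀ l, 0 ≤ h₂ l) (p₄ : ∀ l, 0 ≤ g₂ l)
    (e₁ : ∑ l, c l * h₁ l ≤ H₁) (e₂ : ∑ l, c l * g₁ l ≤ n * G₁)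
    (e₃ : ∑ l, c l * h₂ l ≤ H₂) (e₄ : ∑ l, c l * g₂ l ≤ n * G₂)
    (hG₁ : 0 ≤ G₁) (hG₂ : 0 ≤ G₂)
    (hH₁ : H₁ ≤ n * (r - 5 / 8 * ε)) (hH₂ : η * H₂ ≤ n * ε / 8) :
    ∃ l, ε / 4 ≤ r - h₁ l ∧ g₁ l ≤ 8 / ε * (1 + G₁) ∧ η * h₂ l ≤ 1 ∧
      g₂ l ≤ 8 / ε * (1 + G₂) := by
  set β₁ := ε / (8 * (1 + G₁)) with hβ₁
  set β₂ := ε / (8 * (1 + G₂)) with hβ₂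
  have b₁ : 0 < β₁ := by positivity
  have b₂ : 0 < β₂ := by positivity
  have m₁ : β₁ * G₁ ≤ ε / 8 := by
    rw [hβ₁, div_mul_eq_mul_div, div_le_div_iff₀ (by positivity) (by positivity)]
    nlinarith
  have m₂ : β₂ * G₂ ≤ ε / 8 := by
    rw [hβ₂, div_mul_eq_mul_div, div_le_div_iff₀ (by positivity) (by positivity)]
    nlinarith
  have key : ∃ l, 0 ≤ r - ε / 4 - h₁ l - β₁ * g₁ l - η * h₂ l - β₂ * g₂ l := by
    by_contra! hcon
    have hne : (Finset.univ : Finset κ).Nonempty := by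
      by_contra hempty
      rw [Finset.not_nonempty_iff_eq_empty] at hempty
      rw [hempty, Finset.sum_empty] at hsum
      exact hn.ne hsum
    have hneg : ∑ l, c l * (r - ε / 4 - h₁ l - β₁ * g₁ l - η * h₂ l - β₂ * g₂ l) < 0 :=
      Finset.sum_neg (fun l _ => mul_neg_of_pos_of_neg (hc l) (hcon l)) hne
    have heq : ∑ l, c l * (r - ε / 4 - h₁ l - β₁ * g₁ l - η * h₂ l - β₂ * g₂ l) =
        n * (r - ε / 4) - ∑ l, c l * h₁ l - β₁ * ∑ l, c l * g₁ l - η * ∑ l, c l * h₂ l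
          - β₂ * ∑ l, c l * g₂ l := by
      rw [← hsum, Finset.sum_mul, Finset.mul_sum, Finset.mul_sum, Finset.mul_sum,
        ← Finset.sum_sub_distrib, ← Finset.sum_sub_distrib, ← Finset.sum_sub_distrib,
        ← Finset.sum_sub_distrib]
      exact Finset.sum_congr rfl fun _ _ => by ring
    have i₁ := mul_le_mul_of_nonneg_left e₂ b₁.le
    have i₂ := mul_le_mul_of_nonneg_left e₃ hη.le
    have i₃ := mul_le_mul_of_nonneg_left e₄ b₂.le
    have i₄ := mul_le_mul_of_nonneg_left m₁ hn.le
    have i₅ := mul_le_mul_of_nonneg_left m₂ hn.le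
    nlinarith
  obtain ⟨l, hl⟩ := key
  have q₁ := mul_nonneg b₁.le (p₂ l)
  have q₂ := mul_nonneg hη.le (p₃ l)
  have q₃ := mul_nonneg b₂.le (p₄ l)
  have q₄ := p₁ l
  have d₁ : 8 / ε * (1 + G₁) = 1 / β₁ := by rw [hβ₁]; field_simp
  have d₂ : 8 / ε * (1 + G₂) = 1 / β₂ := by rw [hβ₂]; field_simp
  refine ⟨l, by linarith, ?_, by linarith, ?_⟩
  · rw [d₁, le_div_iff₀ b₁]; linarith
  · rw [d₂, le_div_iff₀ b₂]; linarith

lemma Matrix.PosDef.dotProduct_inv_mulVec_nonneg {ι : Type*} [Fintype ι] [DecidableEq ι]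
    {P : Matrix ι ι ℝ} (hP : P.PosDef) (w : ι → ℝ) :
    0 ≤ w ⬝ᵥ (P⁻¹ *ᵥ w) ∧ 0 ≤ w ⬝ᵥ ((P⁻¹ * P⁻¹) *ᵥ w) := by
  have h2 : (P⁻¹ * P⁻¹).PosSemidef := by
    simpa [pow_two] using hP.inv.posSemidef.pow 2
  exact ⟨by simpa using hP.inv.posSemidef.dotProduct_mulVec_nonneg w,
    by simpa using h2.dotProduct_mulVec_nonneg w⟩

lemma Matrix.PosDef.trace_inv_nonneg {ι : Type*} [Fintype ι] [DecidableEq ι]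
    {P : Matrix ι ι ℝ} (hP : P.PosDef) : 0 ≤ P⁻¹.trace ∧ 0 ≤ (P⁻¹ * P⁻¹).trace := by
  have h2 : (P⁻¹ * P⁻¹).PosSemidef := by
    simpa [pow_two] using hP.inv.posSemidef.pow 2
  exact ⟨hP.inv.posSemidef.trace_nonneg, h2.trace_nonneg⟩

/-- One step of the two-sided barrier argument: some `w l` can be appended to the Gram matrix `G`
while the lower barrier shrinks by a factor `1 + O(1 / n)` and the upper one grows by `O(1 / n)`. -/
lemma exists_bordered_barrier {ι κ : Type*} [Fintype ι] [DecidableEq ι] [Fintype κ]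
    {G : Matrix ι ι ℝ} {c : κ → ℝ} {w : κ → ι → ℝ} {n ε b L U V : ℝ}
    (hn : 0 < n) (hε : 0 < ε) (hε1 : ε < 1)
    (hc : ∀ l, 0 < c l) (hsum : ∑ l, c l = n)
    (hG : ∀ i j, ∑ l, c l * (w l i * w l j) = G i j)
    (hcard : (Fintype.card ι : ℝ) ≤ (1 - ε) * n) (hb : 0 < b)
    (hlow : (G - (b * (1 + 36 / ε ^ 2 / n)) • 1).PosDef)
    (hlow_tr : (G - (b * (1 + 36 / ε ^ 2 / n)) • 1)⁻¹.trace ≤ L)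
    (hbL : b * (1 + L / n) ≤ ε / 4)
    (hU : 576 / ε ^ 2 ≤ U) (hup : (U • 1 - G).PosDef) (hup_tr : (U • 1 - G)⁻¹.trace ≤ V)
    (hV : V ≤ n * ε / 32) :
    ∃ l, (G.bordered (w l) 1 - b • 1).PosDef ∧
      (G.bordered (w l) 1 - b • 1)⁻¹.trace ≤ L + 36 / ε ^ 2 * (1 + L / n) ∧
      ((U + 18 / (ε * n)) • 1 - G.bordered (w l) 1).PosDef ∧
      ((U + 18 / (ε * n)) • 1 - G.bordered (w l) 1)⁻¹.trace ≤ V + ε / 32 := by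
  set U' := U + 18 / (ε * n) with hU'
  have hU'0 : 576 / ε ^ 2 ≤ U' := hU.trans (by rw [hU']; have : 0 ≤ 18 / (ε * n) := by positivity
                                               linarith)
  have hU'ε : 576 ≤ U' * ε ^ 2 := by rwa [div_le_iff₀ (by positivity)] at hU'0
  have hU'4 : 4 ≤ U' := by nlinarith [sq_nonneg ε, mul_pos hε hε]
  obtain ⟨hA, hA_tr⟩ := hlow.shift (δ := b * (36 / ε ^ 2 / n)) (by positivity)
  obtain ⟨hB, hB_tr⟩ := hup.shift (δ := 18 / (ε * n)) (by positivity)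
  have eA : G - (b * (1 + 36 / ε ^ 2 / n)) • 1 + (b * (36 / ε ^ 2 / n)) • 1
      = G - b • (1 : Matrix ι ι ℝ) := by rw [mul_add, mul_one, add_smul]; abel
  have eB : U • 1 - G + (18 / (ε * n)) • 1 = U' • (1 : Matrix ι ι ℝ) - G := by
    rw [hU', add_smul]; abel
  rw [eA] at hA hA_tr
  rw [eB] at hB hB_tr
  set A := G - b • (1 : Matrix ι ι ℝ) with hAdef
  set B := U' • (1 : Matrix ι ι ℝ) - G with hBdef
  obtain ⟨tA₁, tA₂⟩ := trace_inv_mul_of_mul_eq hA (σ := 1) (τ := b) (G := G) (by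
    rw [hAdef]; simp)
  obtain ⟨tB₁, tB₂⟩ := trace_inv_mul_of_mul_eq hB (σ := -1) (τ := U') (G := G) (by
    rw [hBdef]; simp)
  obtain ⟨nA₁, nA₂⟩ := hA.trace_inv_nonneg
  obtain ⟨nB₁, nB₂⟩ := hB.trace_inv_nonneg
  rw [← sum_mul_dotProduct_mulVec hG] at tA₁ tA₂ tB₁ tB₂
  set Φ := A⁻¹.trace
  set T := (A⁻¹ * A⁻¹).trace
  set Ψ := B⁻¹.trace
  set W := (B⁻¹ * B⁻¹).trace
  have hcard0 : (0 : ℝ) ≤ Fintype.card ι := Nat.cast_nonneg _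
  have hδT : 0 ≤ b * (36 / ε ^ 2 / n) * T := by positivity
  have hδW : 0 ≤ 18 / (ε * n) * W := by positivity
  have hΦL : Φ ≤ L := by linarith
  have hbΦ : b * (1 + Φ / n) ≤ ε / 4 := le_trans (by gcongr) hbL
  have hbΦ' : b * n + b * Φ ≤ n * ε / 4 := by
    have := mul_le_mul_of_nonneg_right hbΦ hn.le
    have e : b * (1 + Φ / n) * n = b * n + b * Φ := by field_simp
    linarith
  obtain ⟨l, hs, hg, hh', hg'⟩ := exists_forall_le_of_average (c := c)
    (h₁ := fun l => w l ⬝ᵥ (A⁻¹ *ᵥ w l)) (g₁ := fun l => w l ⬝ᵥ ((A⁻¹ * A⁻¹) *ᵥ w l))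
    (h₂ := fun l => w l ⬝ᵥ (B⁻¹ *ᵥ w l)) (g₂ := fun l => w l ⬝ᵥ ((B⁻¹ * B⁻¹) *ᵥ w l))
    (r := 1 - b) (η := 4 / U') (G₁ := (Φ + b * T) / n) (G₂ := U' * W / n) (H₂ := U' * Ψ)
    hn hε (by positivity) (by linarith) hc hsum
    (fun l => (hA.dotProduct_inv_mulVec_nonneg _).1)
    (fun l => (hA.dotProduct_inv_mulVec_nonneg _).2)
    (fun l => (hB.dotProduct_inv_mulVec_nonneg _).1)
    (fun l => (hB.dotProduct_inv_mulVec_nonneg _).2)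
    tA₁.le (by rw [tA₂, mul_div_cancel₀ _ hn.ne', one_mul]) (by rw [tB₁]; linarith)
    (by rw [tB₂, mul_div_cancel₀ _ hn.ne']; linarith)
    (by positivity) (by positivity) (by nlinarith)
    (by rw [← mul_assoc, div_mul_cancel₀ _ (by positivity)]; linarith)
  have hh : w l ⬝ᵥ (B⁻¹ *ᵥ w l) ≤ U' / 4 := by
    rw [div_mul_eq_mul_div, div_le_one (by positivity)] at hh'
    linarith
  have sA : ε / 4 ≤ (1 - b) - w l ⬝ᵥ (A⁻¹ *ᵥ w l) := hs
  have sB : U' / 2 ≤ (U' - 1) - (-w l) ⬝ᵥ (B⁻¹ *ᵥ (-w l)) := by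
    simp only [mulVec_neg, neg_dotProduct_neg]
    linarith
  obtain ⟨pA, qA⟩ := hA.bordered (w := w l) (d := 1 - b) (by linarith)
  obtain ⟨pB, qB⟩ := hB.bordered (w := -w l) (d := U' - 1) (by linarith)
  have eA' : A.bordered (w l) (1 - b) = G.bordered (w l) 1 - b • 1 := by
    ext (i | i) (j | j) <;> simp [Matrix.bordered, hAdef, one_apply]
  have eB' : B.bordered (-w l) (U' - 1) = U' • 1 - G.bordered (w l) 1 := by
    ext (i | i) (j | j) <;> simp [Matrix.bordered, hBdef, one_apply]
  rw [eA'] at pA qA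
  rw [eB'] at pB qB
  refine ⟨l, pA, ?_, pB, ?_⟩
  · rw [qA]
    have h0 : 0 ≤ (Φ + b * T) / n := by positivity
    have h1 : 1 + w l ⬝ᵥ ((A⁻¹ * A⁻¹) *ᵥ w l) ≤ 9 / ε * (1 + (Φ + b * T) / n) := by
      have : 1 * 1 ≤ 1 / ε * (1 + (Φ + b * T) / n) :=
        mul_le_mul (by rw [le_div_iff₀ hε]; linarith) (by linarith) (by norm_num) (by positivity)
      have e : 9 / ε * (1 + (Φ + b * T) / n) =
        8 / ε * (1 + (Φ + b * T) / n) + 1 / ε * (1 + (Φ + b * T) / n) := by ring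
      linarith
    calc _ ≤ Φ + 9 / ε * (1 + (Φ + b * T) / n) / (ε / 4) := by gcongr
      _ = (Φ + b * (36 / ε ^ 2 / n) * T) + 36 / ε ^ 2 * (1 + Φ / n) := by field_simp; ring
      _ ≤ _ := by gcongr; linarith
  · rw [qB]
    simp only [mulVec_neg, neg_dotProduct_neg] at sB ⊢
    have h0 : 0 ≤ U' * W / n := by positivity
    have h1 : 1 + w l ⬝ᵥ ((B⁻¹ * B⁻¹) *ᵥ w l) ≤ 9 / ε * (1 + U' * W / n) := by
      have : 1 * 1 ≤ 1 / ε * (1 + U' * W / n) :=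
        mul_le_mul (by rw [le_div_iff₀ hε]; linarith) (by linarith) (by norm_num) (by positivity)
      have e : 9 / ε * (1 + U' * W / n) =
        8 / ε * (1 + U' * W / n) + 1 / ε * (1 + U' * W / n) := by ring
      linarith
    calc _ ≤ Ψ + 9 / ε * (1 + U' * W / n) / (U' / 2) := by gcongr
      _ = (Ψ + 18 / (ε * n) * W) + 18 / (ε * U') := by field_simp; ring
      _ ≤ _ := by
        have : 18 / (ε * U') ≤ ε / 32 := by
          rw [div_le_div_iff₀ (by positivity) (by norm_num)]
          have e : ε * (ε * U') = U' * ε ^ 2 := by ring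
          linarith
        linarith

/-- From a John decomposition one can select `k` contact points whose Gram matrix lies strictly
between two explicit barriers, as long as `k - 1 ≤ (1 - ε) n`. -/
lemma IsContactPoint.exists_riesz_barrier {n m : ℕ} (hn : 0 < n)
    {N : EuclideanSpace ℝ (Fin n) → ℝ} {c : Fin m → ℝ} {u : Fin m → EuclideanSpace ℝ (Fin n)}
    (hc : ∀ j, 0 < c j) (hu : ∀ j, IsContactPoint N (u j))
    (hid : ∀ v : EuclideanSpace ℝ (Fin n), ∑ j, c j • ⟪u j, v⟫ • u j = v)
    {ε : ℝ} (hε : 0 < ε) (hε1 : ε < 1) (k : ℕ) (hk : ∀ j < k, (j : ℝ) ≤ (1 - ε) * n) :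
    ∃ (ι : Type) (_ : Fintype ι) (_ : DecidableEq ι) (x : ι → EuclideanSpace ℝ (Fin n)),
      Fintype.card ι = k ∧ (∀ i, IsContactPoint N (x i)) ∧
      (gram ℝ x - (ε / 4 / (1 + 36 / ε ^ 2 / n) ^ k) • 1).PosDef ∧
      (gram ℝ x - (ε / 4 / (1 + 36 / ε ^ 2 / n) ^ k) • 1)⁻¹.trace
        ≤ n * ((1 + 36 / ε ^ 2 / n) ^ k - 1) ∧
      ((576 / ε ^ 2 + k * (18 / (ε * n))) • 1 - gram ℝ x).PosDef ∧
      ((576 / ε ^ 2 + k * (18 / (ε * n))) • 1 - gram ℝ x)⁻¹.trace ≤ k * (ε / 32) := by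
  have hn' : (0 : ℝ) < n := Nat.cast_pos.2 hn
  have hinner : ∀ v w : EuclideanSpace ℝ (Fin n), ∑ j, c j * (⟪v, u j⟫ * ⟪w, u j⟫) = ⟪v, w⟫ := by
    intro v w
    conv_rhs => rw [← hid w, inner_sum]
    refine Finset.sum_congr rfl fun j _ => ?_
    rw [inner_smul_right, inner_smul_right, real_inner_comm w]
    ring
  have hsum : ∑ j, c j = n := by
    have h1 : ∀ j, ∑ i, ⟪EuclideanSpace.basisFun (Fin n) ℝ i, u j⟫ *
        ⟪EuclideanSpace.basisFun (Fin n) ℝ i, u j⟫ = 1 := by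
      intro j
      have := (EuclideanSpace.basisFun (Fin n) ℝ).sum_inner_mul_inner (u j) (u j)
      rw [real_inner_self_eq_norm_sq, (hu j).1] at this
      simpa [real_inner_comm] using this
    calc ∑ j, c j = ∑ j, ∑ i, c j * (⟪EuclideanSpace.basisFun (Fin n) ℝ i, u j⟫ *
        ⟪EuclideanSpace.basisFun (Fin n) ℝ i, u j⟫) := by simp_rw [← Finset.mul_sum, h1, mul_one]
      _ = ∑ i : Fin n, ⟪EuclideanSpace.basisFun (Fin n) ℝ i,
          EuclideanSpace.basisFun (Fin n) ℝ i⟫ := by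
        rw [Finset.sum_comm]; exact Finset.sum_congr rfl fun i _ => hinner _ _
      _ = n := by simp
  induction k with
  | zero =>
    refine ⟨Empty, inferInstance, inferInstance, Empty.elim, by simp, fun i => i.elim, ?_, ?_,
      ?_, ?_⟩
    · exact PosDef.of_dotProduct_mulVec_pos (by ext i; exact i.elim)
        fun x hx => (hx (Subsingleton.elim _ _)).elim
    · simp [trace]
    · exact PosDef.of_dotProduct_mulVec_pos (by ext i; exact i.elim)
        fun x hx => (hx (Subsingleton.elim _ _)).elim
    · simp [trace]
  | succ k ih =>
    obtain ⟨ι, _, _, x, hcard, hx, hlow, hlow_tr, hup, hup_tr⟩ :=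
      ih fun j hj => hk j (hj.trans k.lt_succ_self)
    have hkn : (k : ℝ) ≤ (1 - ε) * n := hk k k.lt_succ_self
    set q : ℝ := 1 + 36 / ε ^ 2 / n with hq
    have hq1 : 1 ≤ q := by
      have : 0 ≤ 36 / ε ^ 2 / n := by positivity
      rw [hq]; linarith
    have hq0 : 0 < q := by linarith
    have hb : ε / 4 / q ^ k = ε / 4 / q ^ (k + 1) * q := by rw [pow_succ]; field_simp
    rw [hb] at hlow hlow_tr
    obtain ⟨l, h1, h2, h3, h4⟩ := exists_bordered_barrier (G := gram ℝ x) hn' hε hε1 hc hsum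
      (fun i j => hinner (x i) (x j)) (by rw [hcard]; exact hkn) (by positivity) hlow hlow_tr
      (by
        rw [mul_div_cancel_left₀ _ hn'.ne', add_sub_cancel, pow_succ]
        have : ε / 4 / (q ^ k * q) * q ^ k = ε / 4 / q := by field_simp
        rw [this]
        exact div_le_self (by positivity) hq1)
      (by have : 0 ≤ k * (18 / (ε * n)) := by positivity
          linarith) hup hup_tr (by nlinarith)
    have hgram : (gram ℝ x).bordered (fun i => ⟪x i, u l⟫) 1 =
        gram ℝ (Sum.elim x fun _ : Unit => u l) := by
      ext (i | i) (j | j) <;> simp [Matrix.bordered, gram_apply, real_inner_comm, (hu l).1]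
    rw [hgram] at h1 h2 h3 h4
    have hUk : 576 / ε ^ 2 + k * (18 / (ε * n)) + 18 / (ε * n) =
        576 / ε ^ 2 + ((k + 1 : ℕ) : ℝ) * (18 / (ε * n)) := by push_cast; ring
    rw [hUk] at h3 h4
    refine ⟨ι ⊕ Unit, inferInstance, inferInstance, Sum.elim x fun _ => u l, by simp [hcard], ?_,
      h1, h2.trans_eq ?_, h3, h4.trans_eq (by push_cast; ring)⟩
    · rintro (i | i)
      · exact hx i
      · exact hu l
    · rw [mul_div_cancel_left₀ _ hn'.ne', add_sub_cancel]
      have : 36 / ε ^ 2 = n * (q - 1) := by rw [hq]; field_simp; ring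
      rw [this, pow_succ]; ring

lemma dotProduct_gram_mulVec {ι E : Type*} [Fintype ι] [NormedAddCommGroup E]
    [InnerProductSpace ℝ E] (x : ι → E) (a : ι → ℝ) :
    a ⬝ᵥ (gram ℝ x *ᵥ a) = ‖∑ i, a i • x i‖ ^ 2 := by
  rw [← real_inner_self_eq_norm_sq, sum_inner]
  simp only [dotProduct, mulVec, gram_apply, inner_sum, inner_smul_left, inner_smul_right,
    Finset.mul_sum]
  refine Finset.sum_congr rfl fun i _ => Finset.sum_congr rfl fun j _ => ?_
  simp
  ring

lemma mul_sum_sq_le_norm_sum_smul_sq {ι E : Type*} [Fintype ι] [DecidableEq ι]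
    [NormedAddCommGroup E] [InnerProductSpace ℝ E] {x : ι → E} {b : ℝ}
    (h : (gram ℝ x - b • 1).PosSemidef) (a : ι → ℝ) :
    b * ∑ i, a i ^ 2 ≤ ‖∑ i, a i • x i‖ ^ 2 := by
  have haa : a ⬝ᵥ a = ∑ i, a i ^ 2 := by simp [dotProduct, sq]
  have h := h.dotProduct_mulVec_nonneg a
  rw [star_trivial, sub_mulVec, dotProduct_sub, dotProduct_gram_mulVec, smul_mulVec, one_mulVec,
    dotProduct_smul, haa, smul_eq_mul] at h
  linarith

lemma norm_sum_smul_sq_le_mul_sum_sq {ι E : Type*} [Fintype ι] [DecidableEq ι]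
    [NormedAddCommGroup E] [InnerProductSpace ℝ E] {x : ι → E} {U : ℝ}
    (h : (U • 1 - gram ℝ x).PosSemidef) (a : ι → ℝ) :
    ‖∑ i, a i • x i‖ ^ 2 ≤ U * ∑ i, a i ^ 2 := by
  have haa : a ⬝ᵥ a = ∑ i, a i ^ 2 := by simp [dotProduct, sq]
  have h := h.dotProduct_mulVec_nonneg a
  rw [star_trivial, sub_mulVec, dotProduct_sub, dotProduct_gram_mulVec, smul_mulVec, one_mulVec,
    dotProduct_smul, haa, smul_eq_mul] at h
  linarith

end

/-- For every `ε ∈ (0,1)` there is `C(ε) > 0` such that every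
`X = (ℝⁿ, N)` admitting a John decomposition has `k > (1-ε)n` contact points which are
`C(ε)`-equivalent in euclidean norm to the canonical basis of `l₂^k`. -/
theorem contact_points_almost_orthonormal :
    ∀ ε : ℝ, ε ∈ Set.Ioo (0 : ℝ) 1 → ∃ C : ℝ, 0 < C ∧
      ∀ (n : ℕ), 0 < n → ∀ N : EuclideanSpace ℝ (Fin n) → ℝ, IsJohnNorm N →
      ∃ k : ℕ, (1 - ε) * n < k ∧
      ∃ x : Fin k → EuclideanSpace ℝ (Fin n),
        (∀ j, IsContactPoint N (x j)) ∧
        ∃ K₁ K₂ : ℝ, 0 < K₁ ∧ 0 < K₂ ∧ K₁ * K₂ ≤ C ∧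
          ∀ a : Fin k → ℝ,
            K₁⁻¹ * Real.sqrt (∑ j, (a j) ^ 2) ≤ ‖∑ j, a j • x j‖ ∧
            ‖∑ j, a j • x j‖ ≤ K₂ * Real.sqrt (∑ j, (a j) ^ 2) := by
  rintro ε ⟨hε, hε1⟩
  set β : ℝ := ε / 4 / Real.exp (36 / ε ^ 2) with hβ
  set γ : ℝ := 576 / ε ^ 2 + 18 / ε with hγ
  have hβ0 : 0 < β := by positivity
  have hγ0 : 0 < γ := by positivity
  refine ⟨(√β)⁻¹ * √γ, by positivity, ?_⟩
  rintro n hn N ⟨-, -, -, -, m, c, u, hc, hu, hid⟩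
  have hn' : (0 : ℝ) < n := Nat.cast_pos.2 hn
  have hpos : 0 ≤ (1 - ε) * n := mul_nonneg (by linarith) hn'.le
  set k := ⌊(1 - ε) * n⌋₊ + 1 with hk
  have hkn : (k : ℝ) ≤ n := by
    have : ⌊(1 - ε) * n⌋₊ < n := (Nat.floor_lt hpos).2 (by nlinarith)
    exact_mod_cast this
  obtain ⟨ι, _, _, x, hcard, hx, hlow, -, hup, -⟩ :=
    IsContactPoint.exists_riesz_barrier hn hc hu hid hε hε1 k fun j hj =>
      (Nat.le_floor_iff hpos).1 (Nat.lt_succ_iff.1 hj)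
  have hβk : β ≤ ε / 4 / (1 + 36 / ε ^ 2 / n) ^ k := by
    rw [hβ]
    gcongr
    calc (1 + 36 / ε ^ 2 / n) ^ k ≤ Real.exp (36 / ε ^ 2 / n) ^ k := by
          gcongr
          rw [add_comm]
          exact Real.add_one_le_exp _
      _ = Real.exp (k * (36 / ε ^ 2 / n)) := (Real.exp_nat_mul _ _).symm
      _ ≤ Real.exp (n * (36 / ε ^ 2 / n)) := by gcongr
      _ = Real.exp (36 / ε ^ 2) := by rw [mul_div_cancel₀ _ hn'.ne']
  have hγk : 576 / ε ^ 2 + k * (18 / (ε * n)) ≤ γ := by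
    have h : k * (18 / (ε * n)) ≤ n * (18 / (ε * n)) := by gcongr
    have h' : n * (18 / (ε * n)) = 18 / ε := by field_simp
    rw [hγ]
    linarith
  have hsq : ∀ a : ι → ℝ, 0 ≤ ∑ i, a i ^ 2 := fun a => Finset.sum_nonneg fun i _ => sq_nonneg _
  have hlower : ∀ a : ι → ℝ, β * ∑ i, a i ^ 2 ≤ ‖∑ i, a i • x i‖ ^ 2 := fun a =>
    (mul_le_mul_of_nonneg_right hβk (hsq a)).trans
      (mul_sum_sq_le_norm_sum_smul_sq hlow.posSemidef a)
  have hupper : ∀ a : ι → ℝ, ‖∑ i, a i • x i‖ ^ 2 ≤ γ * ∑ i, a i ^ 2 := fun a =>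
    (norm_sum_smul_sq_le_mul_sum_sq hup.posSemidef a).trans
      (mul_le_mul_of_nonneg_right hγk (hsq a))
  let e : Fin k ≃ ι := (Fintype.equivFinOfCardEq hcard).symm
  refine ⟨k, by rw [hk]; push_cast; exact Nat.lt_floor_add_one _, x ∘ e, fun j => hx _,
    (√β)⁻¹, √γ, by positivity, by positivity, le_rfl, fun a => ?_⟩
  have h₁ : ∑ j, a j ^ 2 = ∑ i, a (e.symm i) ^ 2 :=
    (e.symm.sum_comp fun j => a j ^ 2).symm
  have h₂ : ∑ j, a j • (x ∘ e) j = ∑ i, a (e.symm i) • x i := by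
    rw [← e.symm.sum_comp]
    simp
  rw [h₁, h₂, inv_inv, ← Real.sqrt_mul hβ0.le, ← Real.sqrt_mul hγ0.le]
  exact ⟨Real.sqrt_le_iff.2 ⟨norm_nonneg _, hlower fun i => a (e.symm i)⟩,
    Real.le_sqrt_of_sq_le (hupper fun i => a (e.symm i))⟩
end

section
/- For every ε ∈ (0,1) there is a constant C(ε) > 0 depending only on ε with the following property. For every n-dimensional real Banach space X there exist an integer k > (1−ε)n and linear operators β : l₂^k → X and α : X → l_∞^k such that α ∘ β is the formal identity map from l₂^k to l_∞^k (i.e. α(β(a)) = a for every a ∈ ℝ^k) and ‖α‖ ‖β‖ ≤ C(ε). -/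
open Matrix

/-- The rows of `V` satisfy a strict lower `ℓ₂`-estimate with constant `b`. -/
def RowsBoundedBelow {j n : ℕ} (V : Matrix (Fin j) (Fin n) ℝ) (b : ℝ) : Prop :=
  ∀ a : Fin j → ℝ, a ≠ 0 → b * (a ⬝ᵥ a) < (a ᵥ* V) ⬝ᵥ (a ᵥ* V)

/-- Every linear functional on matrices exceeds its mean value on the rank one matrices `u uᵀ`,
`u ∈ K`. -/
def IsotropicallyRich {n : ℕ} (K : Set (Fin n → ℝ)) : Prop :=
  ∀ (S : Matrix (Fin n) (Fin n) ℝ) (q : ℝ), n * q < S.trace → ∃ u ∈ K, q < u ⬝ᵥ (S *ᵥ u)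

lemma dotProduct_self_pos {m : ℕ} {a : Fin m → ℝ} (ha : a ≠ 0) : 0 < a ⬝ᵥ a :=
  lt_of_le_of_ne (by simpa using dotProduct_star_self_nonneg a)
    (fun h => ha (dotProduct_self_eq_zero.1 h.symm))

namespace RowsBoundedBelow

variable {j n : ℕ} {V : Matrix (Fin j) (Fin n) ℝ} {b b' : ℝ}

lemma le (h : RowsBoundedBelow V b) (a : Fin j → ℝ) :
    b * (a ⬝ᵥ a) ≤ (a ᵥ* V) ⬝ᵥ (a ᵥ* V) := by
  rcases eq_or_ne a 0 with rfl | ha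
  · simp
  · exact (h a ha).le

lemma anti (h : RowsBoundedBelow V b) (hb : b' ≤ b) : RowsBoundedBelow V b' := fun a ha =>
  (mul_le_mul_of_nonneg_right hb (dotProduct_self_pos ha).le).trans_lt (h a ha)

lemma transpose_shift_mulVec (V : Matrix (Fin j) (Fin n) ℝ) (b : ℝ) (y : Fin n → ℝ) :
    ((Vᵀ * V - b • 1) *ᵥ y) = (V *ᵥ y) ᵥ* V - b • y := by
  rw [sub_mulVec, smul_mulVec, one_mulVec, ← mulVec_mulVec, mulVec_transpose]

lemma isUnit_det (h : RowsBoundedBelow V b) (hb : 0 < b) :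
    IsUnit (Vᵀ * V - b • (1 : Matrix (Fin n) (Fin n) ℝ)).det := by
  rw [isUnit_iff_ne_zero]
  intro h0
  obtain ⟨x, hx, hx0⟩ := exists_mulVec_eq_zero_iff.2 h0
  rw [transpose_shift_mulVec, sub_eq_zero] at hx0
  have h1 : (V *ᵥ x) ⬝ᵥ (V *ᵥ x) = b * (x ⬝ᵥ x) := by
    rw [dotProduct_mulVec, hx0, smul_dotProduct, smul_eq_mul]
  have h2 : V *ᵥ x ≠ 0 := by
    intro h3
    rw [h3] at h1
    have := mul_pos hb (dotProduct_self_pos hx)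
    simp at h1
    rcases h1 with h1 | h1
    · exact hb.ne' h1
    · exact hx h1
  have h3 := h _ h2
  rw [hx0, h1] at h3
  simp only [smul_dotProduct, dotProduct_smul, smul_eq_mul] at h3
  exact lt_irrefl _ h3

/-- Adjoining a row `u` with `uᵀ (VᵀV - b)⁻¹ u < -1` preserves the lower estimate. -/
lemma cons (h : RowsBoundedBelow V b) (hb : 0 < b) {u y : Fin n → ℝ}
    (hy : (Vᵀ * V - b • 1) *ᵥ y = u) (huy : u ⬝ᵥ y < -1) :
    RowsBoundedBelow (of (vecCons u V)) b := by
  intro a ha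
  rw [transpose_shift_mulVec] at hy
  obtain ⟨s, a, rfl⟩ : ∃ (s : ℝ) (a' : Fin j → ℝ), a = vecCons s a' :=
    ⟨vecHead a, vecTail a, (cons_head_tail a).symm⟩
  have e : vecCons s a ᵥ* of (vecCons u V) = s • u + a ᵥ* V := by
    rw [cons_vecMul]; rfl
  rw [e, cons_dotProduct_cons]
  set z := V *ᵥ y with hz
  set c := a + s • z with hc
  have ha' : a = c - s • z := by rw [hc]; abel
  have hcy : ∀ d : Fin j → ℝ, (d ᵥ* V) ⬝ᵥ y = d ⬝ᵥ z := fun d => by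
    rw [hz, dotProduct_mulVec]
  have key : (s • u + a ᵥ* V) ⬝ᵥ (s • u + a ᵥ* V) - b * (s * s + a ⬝ᵥ a) =
      ((c ᵥ* V) ⬝ᵥ (c ᵥ* V) - b * (c ⬝ᵥ c)) + s ^ 2 * b * (-(u ⬝ᵥ y) - 1) := by
    have e1 : s • u + a ᵥ* V = c ᵥ* V - (s * b) • y := by
      rw [← hy, hc, add_vecMul, smul_vecMul, smul_sub, smul_smul]; abel
    have e2 : u ⬝ᵥ y = z ⬝ᵥ z - b * (y ⬝ᵥ y) := by
      rw [← hy, sub_dotProduct, hcy, smul_dotProduct, smul_eq_mul]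
    rw [e1, e2, ha']
    simp only [sub_dotProduct, dotProduct_sub, smul_dotProduct, dotProduct_smul, smul_eq_mul,
      dotProduct_comm y (c ᵥ* V), hcy, dotProduct_comm z c]
    ring
  have h1 := h.le c
  rcases eq_or_ne s 0 with hs | hs
  · subst hs
    have : c ≠ 0 := by
      intro h0
      apply ha
      rw [ha', h0]
      ext i
      refine Fin.cases ?_ (fun i => ?_) i <;> simp
    have := h c this
    simp only [ne_eq, OfNat.ofNat_ne_zero, not_false_eq_true, zero_pow, zero_mul, add_zero] at key
    simp only [zero_mul] at *
    linarith
  · have : 0 < s ^ 2 * b * (-(u ⬝ᵥ y) - 1) := by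
      have : 0 < s ^ 2 := by positivity
      exact mul_pos (mul_pos this hb) (by linarith)
    linarith

lemma neg_le_dotProduct_inv_mulVec (h : RowsBoundedBelow V b) (hb : 0 < b) (y : Fin n → ℝ) :
    0 ≤ y ⬝ᵥ ((Vᵀ * V - b • 1)⁻¹ *ᵥ y) + b⁻¹ * (y ⬝ᵥ y) := by
  set x := (Vᵀ * V - b • (1 : Matrix (Fin n) (Fin n) ℝ))⁻¹ *ᵥ y with hx
  have hy : (Vᵀ * V - b • 1) *ᵥ x = y := by
    rw [hx, mulVec_mulVec, mul_nonsing_inv _ (h.isUnit_det hb), one_mulVec]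
  rw [transpose_shift_mulVec] at hy
  set z := V *ᵥ x with hz
  have hcy : ∀ d : Fin j → ℝ, (d ᵥ* V) ⬝ᵥ x = d ⬝ᵥ z := fun d =>
    (dotProduct_mulVec d V x).symm
  have e : y ⬝ᵥ x + b⁻¹ * (y ⬝ᵥ y) = b⁻¹ * ((z ᵥ* V) ⬝ᵥ (z ᵥ* V) - b * (z ⬝ᵥ z)) := by
    rw [← hy]
    simp only [sub_dotProduct, dotProduct_sub, smul_dotProduct, dotProduct_smul, smul_eq_mul,
      dotProduct_comm x (z ᵥ* V), hcy]
    field_simp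
    ring
  rw [e]
  have := h.le z
  exact mul_nonneg (by positivity) (by linarith)

end RowsBoundedBelow

lemma trace_transpose_mul_self_eq {n : ℕ} (N : Matrix (Fin n) (Fin n) ℝ) :
    (Nᵀ * N).trace = ∑ i, (Nᵀ i) ⬝ᵥ (Nᵀ i) := by
  simp [trace, mul_apply, dotProduct]

/-- A conjugate of a matrix with nonnegative quadratic form has nonnegative trace. -/
lemma trace_transpose_mul_mul_nonneg {n : ℕ} (N P : Matrix (Fin n) (Fin n) ℝ)
    (hP : ∀ y : Fin n → ℝ, 0 ≤ y ⬝ᵥ (P *ᵥ y)) : 0 ≤ (Nᵀ * P * N).trace := by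
  have : (Nᵀ * P * N).trace = ∑ i, Nᵀ i ⬝ᵥ (P *ᵥ Nᵀ i) := by
    refine Finset.sum_congr rfl fun i _ => ?_
    rw [diag_apply, Matrix.mul_assoc, mul_apply]
    rfl
  rw [this]
  exact Finset.sum_nonneg fun i _ => hP _

namespace RowsBoundedBelow

variable {j n : ℕ} {V : Matrix (Fin j) (Fin n) ℝ} {b b' : ℝ}

lemma transpose_shift_inv (V : Matrix (Fin j) (Fin n) ℝ) (b : ℝ) :
    ((Vᵀ * V - b • (1 : Matrix (Fin n) (Fin n) ℝ))⁻¹)ᵀ = (Vᵀ * V - b • 1)⁻¹ := by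
  rw [transpose_nonsing_inv]; simp

/-- The barrier step: lowering the barrier from `b` to `b'` makes room for a new row from `K`
without increasing the trace of the resolvent. -/
lemma exists_cons (h : RowsBoundedBelow V b) (hb' : 0 < b') (hbb : b' < b) (hn : 0 < n)
    {K : Set (Fin n → ℝ)} (hK : IsotropicallyRich K) {τ : ℝ}
    (htr : (Vᵀ * V - b • (1 : Matrix (Fin n) (Fin n) ℝ))⁻¹.trace ≤ -(n * τ))
    (hτ : 1 < (b - b') * (b' / b) * (n * (τ - 1))) :
    ∃ u ∈ K, RowsBoundedBelow (of (vecCons u V)) b' ∧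
      ((of (vecCons u V))ᵀ * of (vecCons u V) -
        b' • (1 : Matrix (Fin n) (Fin n) ℝ))⁻¹.trace ≤ -(n * τ) := by
  have hb : 0 < b := hb'.trans hbb
  have h' : RowsBoundedBelow V b' := h.anti hbb.le
  set M := Vᵀ * V - b • (1 : Matrix (Fin n) (Fin n) ℝ) with hM
  set M' := Vᵀ * V - b' • (1 : Matrix (Fin n) (Fin n) ℝ) with hM'
  set N := M⁻¹ with hN
  set N' := M'⁻¹ with hN'
  have hMN : M * N = 1 := mul_nonsing_inv _ (h.isUnit_det hb)
  have hNM : N * M = 1 := nonsing_inv_mul _ (h.isUnit_det hb)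
  have hMN' : M' * N' = 1 := mul_nonsing_inv _ (h'.isUnit_det hb')
  have hNM' : N' * M' = 1 := nonsing_inv_mul _ (h'.isUnit_det hb')
  have hT' : N'ᵀ = N' := transpose_shift_inv V b'
  have hMM : M' = M + (b - b') • 1 := by rw [hM, hM', sub_smul]; abel
  have hres : N - N' = (b - b') • (N' * N) := by
    calc N - N' = N' * M' * N - N' * (M * N) := by rw [hNM', hMN, one_mul, mul_one]
      _ = _ := by rw [hMM]; simp [mul_add, add_mul, Matrix.mul_assoc]
  have hP := trace_transpose_mul_mul_nonneg N' (N + b⁻¹ • 1) (fun y => by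
    have := h.neg_le_dotProduct_inv_mulVec hb y
    rwa [add_mulVec, smul_mulVec, one_mulVec, dotProduct_add, dotProduct_smul, smul_eq_mul])
  set δ := b - b' with hδ
  have hδ0 : 0 < δ := sub_pos.2 hbb
  have hid : δ • (N'ᵀ * (N + b⁻¹ • 1) * N') = N' * N - (b' / b) • (N' * N') := by
    have e : N * N' = N' * N := by
      have e1 : N' * N = N' * (N * M') * N' := by
        rw [Matrix.mul_assoc, Matrix.mul_assoc N, hMN', mul_one]
      have e2 : N * M' = M' * N := by
        rw [hMM]; simp [mul_add, add_mul, hMN, hNM]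
      rw [e1, e2, ← Matrix.mul_assoc, hNM', one_mul]
    have e3 : δ • (N' * N * N') = N' * N - N' * N' := by
      rw [Matrix.mul_assoc, e, ← Matrix.mul_smul, ← hres, mul_sub]
    have e4 : b' / b = 1 - δ * b⁻¹ := by rw [hδ]; field_simp; ring
    rw [hT', mul_add, add_mul, smul_add, e3, e4]
    simp [sub_smul, smul_smul]
    abel
  have hQ0 : 0 < (N' * N').trace := by
    have e : (N' * N').trace = ∑ i, (N'ᵀ i) ⬝ᵥ (N'ᵀ i) := by
      rw [← trace_transpose_mul_self_eq, hT']
    rw [e]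
    refine Finset.sum_pos (fun i _ => dotProduct_self_pos fun h0 => ?_)
      (by have := Fin.pos_iff_nonempty.1 hn; exact Finset.univ_nonempty)
    rw [hT'] at h0
    have := congrFun (congrFun hNM' i) i
    rw [mul_apply] at this
    simp [h0] at this
  have hΔ : N.trace - N'.trace = δ * (N' * N).trace := by
    rw [← trace_sub, hres, trace_smul, smul_eq_mul]
  have hΔ1 : δ * (b' / b) * (N' * N').trace ≤ N.trace - N'.trace := by
    have e := congrArg trace hid
    rw [trace_smul, trace_sub, trace_smul, smul_eq_mul, smul_eq_mul] at e
    have := mul_nonneg hδ0.le hP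
    rw [hΔ, mul_assoc]
    exact mul_le_mul_of_nonneg_left (by linarith) hδ0.le
  set Δ := N.trace - N'.trace with hΔdef
  have hΔ0 : 0 < Δ := lt_of_lt_of_le (by positivity) hΔ1
  have hn' : (0 : ℝ) < n := by exact_mod_cast hn
  have hτ1 : 0 < n * (τ - 1) := by
    by_contra! h0
    have : 0 < δ * (b' / b) := by positivity
    nlinarith
  have hbig : n * Δ < (-(Δ • N') - N' * N').trace := by
    rw [trace_sub, trace_neg, trace_smul, smul_eq_mul]
    have h1 : (N' * N').trace < Δ * (n * (τ - 1)) := by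
      calc (N' * N').trace < (δ * (b' / b) * (n * (τ - 1))) * (N' * N').trace := by
            nlinarith
        _ = δ * (b' / b) * (N' * N').trace * (n * (τ - 1)) := by ring
        _ ≤ _ := mul_le_mul_of_nonneg_right hΔ1 hτ1.le
    have h2 : n * τ ≤ -N'.trace := by linarith
    nlinarith
  obtain ⟨u, huK, hu⟩ := hK _ _ hbig
  set y := N' *ᵥ u with hy
  have hyy : u ⬝ᵥ ((N' * N') *ᵥ u) = y ⬝ᵥ y := by
    rw [← mulVec_mulVec, dotProduct_mulVec, ← mulVec_transpose, hT']
  have hu' : Δ < -(Δ * (u ⬝ᵥ y)) - y ⬝ᵥ y := by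
    rw [sub_mulVec, neg_mulVec, smul_mulVec, dotProduct_sub, dotProduct_neg, dotProduct_smul,
      hyy, smul_eq_mul] at hu
    exact hu
  have hyy0 : 0 ≤ y ⬝ᵥ y := by simpa using dotProduct_star_self_nonneg y
  have huy : u ⬝ᵥ y < -1 := by nlinarith
  have hMy : M' *ᵥ y = u := by rw [hy, mulVec_mulVec, hMN', one_mulVec]
  refine ⟨u, huK, h'.cons hb' hMy huy, ?_⟩
  set r := 1 + u ⬝ᵥ y with hr
  have hr0 : r < 0 := by linarith
  have hV : (of (vecCons u V))ᵀ * of (vecCons u V) - b' • (1 : Matrix (Fin n) (Fin n) ℝ) =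
      M' + vecMulVec u u := by
    rw [hM']
    have hs0 : vecCons u V 0 = u := rfl
    have hs : ∀ x, vecCons u V (Fin.succ x) = V x := fun _ => rfl
    ext i k
    simp only [Matrix.add_apply, Matrix.sub_apply, mul_apply, transpose_apply, of_apply,
      Fin.sum_univ_succ, vecMulVec_apply, hs0, hs]
    ring
  have hinv : (M' + vecMulVec u u) * (N' - r⁻¹ • vecMulVec y y) = 1 := by
    have e1 : M' * vecMulVec y y = vecMulVec u y := by rw [mul_vecMulVec, hMy]
    have e2 : vecMulVec u u * N' = vecMulVec u y := by
      rw [vecMulVec_mul, ← mulVec_transpose, hT']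
    have e3 : vecMulVec u u * vecMulVec y y = (u ⬝ᵥ y) • vecMulVec u y := by
      rw [vecMulVec_mul_vecMulVec]
      ext i k
      simp [vecMulVec_apply]
      ring
    rw [add_mul, mul_sub, mul_sub, hMN', Matrix.mul_smul, Matrix.mul_smul, e1, e2, e3]
    have e4 : u ⬝ᵥ y = r - 1 := by rw [hr]; ring
    rw [e4]
    have e5 : r⁻¹ * (r - 1) = 1 - r⁻¹ := by
      rw [mul_sub, inv_mul_cancel₀ hr0.ne, mul_one]
    rw [smul_smul, e5, sub_smul, one_smul]
    abel
  rw [hV, inv_eq_right_inv hinv, trace_sub, trace_smul, trace_vecMulVec, smul_eq_mul]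
  have : -(r⁻¹ * (y ⬝ᵥ y)) ≤ Δ := by
    have e : -(r⁻¹ * (y ⬝ᵥ y)) = (y ⬝ᵥ y) / (-r) := by field_simp
    rw [e, div_le_iff₀ (by linarith)]
    rw [hr]; nlinarith
  linarith

lemma of_isEmpty (V : Matrix (Fin 0) (Fin n) ℝ) (b : ℝ) : RowsBoundedBelow V b :=
  fun a ha => (ha (Subsingleton.elim a 0)).elim

lemma exists_cons_of_lt (h : RowsBoundedBelow V b) (hb : 0 < b) (hb1 : b ≤ 1) (hjn : j < n)
    {K : Set (Fin n → ℝ)} (hK : IsotropicallyRich K) (hball : ∀ u ∈ K, u ⬝ᵥ u ≤ 1) :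
    ∃ u ∈ K, RowsBoundedBelow (of (vecCons u V)) (b / (16 * n)) := by
  obtain ⟨v, hv, hv0⟩ : ∃ v : Fin n → ℝ, v ≠ 0 ∧ V *ᵥ v = 0 := by
    have hker := LinearMap.ker_ne_bot_of_finrank_lt (f := V.mulVecLin) (by simpa using hjn)
    obtain ⟨v, hv, hv0⟩ := Submodule.exists_mem_ne_zero_of_ne_bot hker
    exact ⟨v, hv0, by simpa using hv⟩
  have hv2 := dotProduct_self_pos hv
  have hn : (1 : ℝ) ≤ n := by exact_mod_cast (Nat.zero_lt_of_lt hjn)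
  obtain ⟨u, huK, hu⟩ := hK (vecMulVec v v) ((v ⬝ᵥ v) / (2 * n)) (by
    rw [trace_vecMulVec]
    have : (n : ℝ) * ((v ⬝ᵥ v) / (2 * n)) = (v ⬝ᵥ v) / 2 := by field_simp
    linarith)
  have hu' : (v ⬝ᵥ v) < 2 * n * (u ⬝ᵥ v) ^ 2 := by
    rw [vecMulVec_mulVec, div_lt_iff₀ (by linarith)] at hu
    simp only [dotProduct_smul, op_smul_eq_mul,
      dotProduct_comm v u] at hu
    linarith
  refine ⟨u, huK, fun a ha => ?_⟩
  have ha0 := dotProduct_self_pos ha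
  obtain ⟨s, a, rfl⟩ : ∃ (s : ℝ) (a' : Fin j → ℝ), a = vecCons s a' :=
    ⟨vecHead a, vecTail a, (cons_head_tail a).symm⟩
  have e : vecCons s a ᵥ* of (vecCons u V) = s • u + a ᵥ* V := by
    rw [cons_vecMul]; rfl
  rw [e]
  rw [cons_dotProduct_cons] at ha0 ⊢
  set w := s • u + a ᵥ* V with hw
  have hwv : w ⬝ᵥ v = s * (u ⬝ᵥ v) := by
    rw [hw, add_dotProduct, smul_dotProduct, ← dotProduct_mulVec, hv0, dotProduct_zero,
      add_zero, smul_eq_mul]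
  have hcs : (w ⬝ᵥ v) ^ 2 ≤ (w ⬝ᵥ w) * (v ⬝ᵥ v) := by
    have := Finset.sum_mul_sq_le_sq_mul_sq Finset.univ w v
    simpa only [dotProduct, sq] using this
  have hs : s ^ 2 ≤ 2 * n * (w ⬝ᵥ w) := by
    have h1 : s ^ 2 * (v ⬝ᵥ v) ≤ (2 * n * (w ⬝ᵥ w)) * (v ⬝ᵥ v) := by
      calc s ^ 2 * (v ⬝ᵥ v) ≤ s ^ 2 * (2 * n * (u ⬝ᵥ v) ^ 2) := by gcongr
        _ = 2 * n * (w ⬝ᵥ v) ^ 2 := by rw [hwv]; ring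
        _ ≤ 2 * n * ((w ⬝ᵥ w) * (v ⬝ᵥ v)) := by gcongr
        _ = _ := by ring
    exact le_of_mul_le_mul_right h1 hv2
  have haV : (a ᵥ* V) ⬝ᵥ (a ᵥ* V) ≤ 2 * (w ⬝ᵥ w) + 2 * s ^ 2 := by
    have e1 : a ᵥ* V = w - s • u := by rw [hw]; abel
    have e2 : 0 ≤ (w + s • u) ⬝ᵥ (w + s • u) := by
      simpa using dotProduct_star_self_nonneg (w + s • u)
    have e3 : s ^ 2 * (u ⬝ᵥ u) ≤ s ^ 2 := mul_le_of_le_one_right (sq_nonneg s) (hball u huK)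
    rw [e1]
    simp only [sub_dotProduct, dotProduct_sub, add_dotProduct, dotProduct_add, smul_dotProduct,
      dotProduct_smul, smul_eq_mul, dotProduct_comm u w] at e2 ⊢
    nlinarith
  have hba := h.le a
  have hW : b * (s * s + a ⬝ᵥ a) ≤ 8 * n * (w ⬝ᵥ w) := by
    have h0 : 0 ≤ w ⬝ᵥ w := by simpa using dotProduct_star_self_nonneg w
    nlinarith [mul_le_of_le_one_left (sq_nonneg s) hb1, mul_nonneg (sub_nonneg.2 hn) h0]
  have hpos := mul_pos hb ha0
  rw [div_mul_eq_mul_div, div_lt_iff₀ (by linarith)]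
  linarith

end RowsBoundedBelow

lemma exists_rowsBoundedBelow_of_le (n j : ℕ) : ∃ b : ℝ, 0 < b ∧ b ≤ 1 ∧
    ∀ K : Set (Fin n → ℝ), IsotropicallyRich K → (∀ u ∈ K, u ⬝ᵥ u ≤ 1) → j ≤ n →
      ∃ V : Matrix (Fin j) (Fin n) ℝ, (∀ i, V i ∈ K) ∧ RowsBoundedBelow V b := by
  induction j with
  | zero => exact ⟨1, one_pos, le_rfl, fun K _ _ _ => ⟨0, fun i => i.elim0, .of_isEmpty _ _⟩⟩
  | succ j ih =>
    obtain ⟨b, hb, hb1, H⟩ := ih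
    rcases Nat.eq_zero_or_pos n with rfl | hn
    · exact ⟨1, one_pos, le_rfl, fun K _ _ h => absurd h (by simp)⟩
    have hn' : (1 : ℝ) ≤ n := by exact_mod_cast hn
    refine ⟨b / (16 * n), by positivity, ?_, fun K hK hball hj => ?_⟩
    · rw [div_le_one (by positivity)]; linarith
    obtain ⟨V, hVK, hV⟩ := H K hK hball (by omega)
    obtain ⟨u, huK, hu⟩ := hV.exists_cons_of_lt hb hb1 (by omega) hK hball
    exact ⟨_, Fin.cases huK hVK, hu⟩

lemma exists_rowsBoundedBelow_of_barrier {n : ℕ} (hn : 0 < n) {K : Set (Fin n → ℝ)}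
    (hK : IsotropicallyRich K) {b₀ δ : ℝ} (hb₀ : 0 < b₀) (hδ : 0 < δ) (k : ℕ)
    (hpos : 0 < b₀ - k * δ)
    (hstep : ∀ j < k, 1 < δ * ((b₀ - (j + 1) * δ) / (b₀ - j * δ)) * (n * (b₀⁻¹ - 1))) :
    ∃ V : Matrix (Fin k) (Fin n) ℝ, (∀ i, V i ∈ K) ∧ RowsBoundedBelow V (b₀ - k * δ) := by
  suffices H : ∀ j ≤ k, ∃ V : Matrix (Fin j) (Fin n) ℝ, (∀ i, V i ∈ K) ∧
      RowsBoundedBelow V (b₀ - j * δ) ∧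
      (Vᵀ * V - (b₀ - j * δ) • (1 : Matrix (Fin n) (Fin n) ℝ))⁻¹.trace ≤ -(n * b₀⁻¹) by
    obtain ⟨V, h1, h2, -⟩ := H k le_rfl
    exact ⟨V, h1, h2⟩
  intro j
  induction j with
  | zero =>
    intro _
    refine ⟨0, fun i => i.elim0, .of_isEmpty _ _, ?_⟩
    have : ((0 : Matrix (Fin 0) (Fin n) ℝ)ᵀ * (0 : Matrix (Fin 0) (Fin n) ℝ) -
        (b₀ - (0 : ℕ) * δ) • (1 : Matrix (Fin n) (Fin n) ℝ))⁻¹ = -(b₀⁻¹ • 1) := by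
      apply inv_eq_right_inv
      simp [smul_smul, hb₀.ne']
    rw [this, trace_neg, trace_smul, trace_one]
    simp [mul_comm]
  | succ j ih =>
    intro hj
    obtain ⟨V, h1, h2, h3⟩ := ih (by omega)
    have hjk : ((j + 1 : ℕ) : ℝ) ≤ k := by exact_mod_cast hj
    have hp : 0 < b₀ - (j + 1 : ℕ) * δ := by nlinarith
    have hs := hstep j (by omega)
    obtain ⟨u, hu, h4, h5⟩ := h2.exists_cons (b' := b₀ - (j + 1 : ℕ) * δ) hp
      (by push_cast; linarith) hn hK h3
      (by
        have e : b₀ - j * δ - (b₀ - (j + 1 : ℕ) * δ) = δ := by push_cast; ring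
        rw [e]; push_cast; exact hs)
    exact ⟨_, Fin.cases hu h1, h4, h5⟩

lemma exists_rowsBoundedBelow_of_large {ε : ℝ} (hε : 0 < ε) (hε1 : ε < 1) {n : ℕ}
    (hn : 64 / ε ^ 3 ≤ n) {K : Set (Fin n → ℝ)} (hK : IsotropicallyRich K) :
    ∃ k : ℕ, (1 - ε) * n < k ∧ ∃ V : Matrix (Fin k) (Fin n) ℝ, (∀ i, V i ∈ K) ∧
      RowsBoundedBelow V (ε ^ 3 / 32) := by
  have hn0 : (0 : ℝ) < n := lt_of_lt_of_le (by positivity) hn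
  have hn3 : 64 ≤ n * ε ^ 3 := by rwa [div_le_iff₀ (by positivity)] at hn
  have hε2 : ε ^ 2 ≤ 1 := by nlinarith
  have hn1 : 64 ≤ n * ε := by
    nlinarith [mul_le_mul_of_nonneg_left hε2 (mul_pos hn0 hε).le]
  set k := ⌊(1 - ε) * n⌋₊ + 1 with hk
  have hk1 : (1 - ε) * n < k := by rw [hk]; push_cast; exact Nat.lt_floor_add_one _
  have hk2 : (k : ℝ) ≤ (1 - ε / 2) * n := by
    have := Nat.floor_le (mul_nonneg (sub_nonneg.2 hε1.le) hn0.le)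
    rw [hk]; push_cast; nlinarith
  set δ := (1 + ε / 2) * (ε / 8) / n with hδ
  have hδ0 : 0 < δ := by positivity
  have hδn : δ * n = (1 + ε / 2) * (ε / 8) := by rw [hδ]; field_simp
  have hbk : ε ^ 3 / 32 ≤ ε / 8 - k * δ := by
    have : k * δ ≤ (1 - ε / 2) * n * δ := by gcongr
    have e : (1 - ε / 2) * n * δ = (1 - ε / 2) * ((1 + ε / 2) * (ε / 8)) := by
      rw [← hδn]; ring
    rw [e] at this
    nlinarith
  have hb0 : 0 < ε ^ 3 / 32 := by positivity
  obtain ⟨V, h1, h2⟩ := exists_rowsBoundedBelow_of_barrier (by exact_mod_cast hn0) hK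
    (b₀ := ε / 8) (by positivity) hδ0 k (by linarith) (fun j hj => by
      have hjk : (j : ℝ) + 1 ≤ k := by exact_mod_cast hj
      have hb : ε ^ 3 / 32 ≤ ε / 8 - j * δ := by nlinarith
      set b := ε / 8 - j * δ with hbdef
      have hbpos : 0 < b := by linarith
      have e1 : (ε / 8 - (j + 1) * δ) / b = 1 - δ / b := by
        rw [show ε / 8 - (j + 1) * δ = b - δ by rw [hbdef]; ring, sub_div, div_self hbpos.ne']
      have e2 : δ / b ≤ ε / 8 := by
        rw [div_le_iff₀ hbpos]
        have h3 : ε / 8 * (ε ^ 3 / 32) ≤ ε / 8 * b := by gcongr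
        have h4 : δ ≤ ε / 8 * (ε ^ 3 / 32) := by
          rw [hδ, div_le_iff₀ hn0]
          have h5 : (1 + ε / 2) ≤ ε ^ 3 / 32 * n := by nlinarith
          nlinarith
        linarith
      have e3 : δ * ((ε / 8 - (j + 1) * δ) / b) * (n * ((ε / 8)⁻¹ - 1)) =
          (1 + ε / 2) * (1 - ε / 8) * (1 - δ / b) := by
        rw [e1]
        have : δ * (1 - δ / b) * (n * ((ε / 8)⁻¹ - 1)) =
          (δ * n) * (1 - δ / b) * ((ε / 8)⁻¹ - 1) := by ring
        rw [this, hδn]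
        field_simp
      rw [e3]
      have e4 : (1 + ε / 2) * (1 - ε / 8) * (1 - ε / 8) ≤
          (1 + ε / 2) * (1 - ε / 8) * (1 - δ / b) := by
        apply mul_le_mul_of_nonneg_left (by linarith)
        exact mul_nonneg (by linarith) (by linarith)
      nlinarith [pow_pos hε 3])
  exact ⟨k, hk1, V, h1, h2.anti hbk⟩

/-- Proportional restricted invertibility, uniformly in the dimension. -/
lemma exists_rowsBoundedBelow {ε : ℝ} (hε : 0 < ε) (hε1 : ε < 1) :
    ∃ b : ℝ, 0 < b ∧ ∀ n : ℕ, 0 < n → ∀ K : Set (Fin n → ℝ), IsotropicallyRich K →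
      (∀ u ∈ K, u ⬝ᵥ u ≤ 1) → ∃ k : ℕ, (1 - ε) * n < k ∧
        ∃ V : Matrix (Fin k) (Fin n) ℝ, (∀ i, V i ∈ K) ∧ RowsBoundedBelow V b := by
  choose b hb _ H using fun n => exists_rowsBoundedBelow_of_le n n
  obtain ⟨N, hN⟩ := exists_nat_ge (64 / ε ^ 3)
  have hne : (Finset.range (N + 1)).Nonempty := ⟨0, by simp⟩
  obtain ⟨m, -, hm⟩ := Finset.exists_min_image (Finset.range (N + 1)) b hne
  refine ⟨min (ε ^ 3 / 32) (b m), lt_min (by positivity) (hb m), fun n hn K hK hball => ?_⟩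
  rcases le_total N n with h | h
  · obtain ⟨k, hk, V, h1, h2⟩ := exists_rowsBoundedBelow_of_large hε hε1
      (hN.trans (by exact_mod_cast h)) hK
    exact ⟨k, hk, V, h1, h2.anti (min_le_left _ _)⟩
  · obtain ⟨V, h1, h2⟩ := H n K hK hball le_rfl
    have hn' : (0 : ℝ) < n := by exact_mod_cast hn
    exact ⟨n, by nlinarith, V, h1,
      h2.anti ((min_le_right _ _).trans (hm n (by simp; omega)))⟩

lemma RowsBoundedBelow.exists_rightInverse {k n : ℕ} {V : Matrix (Fin k) (Fin n) ℝ} {b : ℝ}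
    (h : RowsBoundedBelow V b) (hb : 0 < b) :
    ∃ R : Matrix (Fin n) (Fin k) ℝ, V * R = 1 ∧
      ∀ a, (R *ᵥ a) ⬝ᵥ (R *ᵥ a) ≤ b⁻¹ * (a ⬝ᵥ a) := by
  have hG : ∀ c, (c ᵥ* V) ⬝ᵥ (c ᵥ* V) = c ⬝ᵥ ((V * Vᵀ) *ᵥ c) := fun c => by
    rw [← mulVec_mulVec, mulVec_transpose, dotProduct_mulVec]
  have hU : IsUnit (V * Vᵀ).det := by
    rw [isUnit_iff_ne_zero]
    intro h0
    obtain ⟨x, hx, hx0⟩ := exists_mulVec_eq_zero_iff.2 h0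
    have := h x hx
    rw [hG, hx0, dotProduct_zero] at this
    exact absurd this (not_lt.2 (mul_pos hb (dotProduct_self_pos hx)).le)
  refine ⟨Vᵀ * (V * Vᵀ)⁻¹, by rw [← Matrix.mul_assoc, mul_nonsing_inv _ hU], fun a => ?_⟩
  set c := (V * Vᵀ)⁻¹ *ᵥ a with hc
  have e : (Vᵀ * (V * Vᵀ)⁻¹) *ᵥ a = c ᵥ* V := by
    rw [← mulVec_mulVec, mulVec_transpose]
  have hGc : (V * Vᵀ) *ᵥ c = a := by
    rw [hc, mulVec_mulVec, mul_nonsing_inv _ hU, one_mulVec]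
  have h1 := h.le c
  rw [e]
  rw [hG, hGc] at h1 ⊢
  have h2 : 0 ≤ (a - b • c) ⬝ᵥ (a - b • c) := by
    simpa using dotProduct_star_self_nonneg (a - b • c)
  simp only [sub_dotProduct, dotProduct_sub, smul_dotProduct, dotProduct_smul, smul_eq_mul,
    dotProduct_comm a c] at h2
  rw [inv_mul_eq_div, le_div_iff₀ hb]
  nlinarith

/-- A linear map from Euclidean space of maximal determinant among contractions. -/
lemma exists_contraction_abs_det_le {n : ℕ} (hn : 0 < n) (X : Type*) [NormedAddCommGroup X]
    [NormedSpace ℝ X] [FiniteDimensional ℝ X] (hX : Module.finrank ℝ X = n) :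
    ∃ T : EuclideanSpace ℝ (Fin n) →L[ℝ] X, ‖T‖ ≤ 1 ∧
      ∀ Q : EuclideanSpace ℝ (Fin n) →L[ℝ] EuclideanSpace ℝ (Fin n),
        |Q.det| ≤ ‖T ∘L Q‖ ^ n := by
  have e : EuclideanSpace ℝ (Fin n) ≃L[ℝ] X :=
    ContinuousLinearEquiv.ofFinrankEq (by rw [hX]; simp)
  set D : (EuclideanSpace ℝ (Fin n) →L[ℝ] X) → ℝ :=
    fun T => |((e.symm : X →L[ℝ] EuclideanSpace ℝ (Fin n)) ∘L T).det| with hD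
  have hDc : Continuous D := by
    refine continuous_abs.comp (ContinuousLinearMap.continuous_det.comp ?_)
    exact continuous_const.clm_comp continuous_id
  have hDs : ∀ (c : ℝ) T, D (c • T) = |c| ^ n * D T := by
    intro c T
    simp only [hD, ContinuousLinearMap.comp_smul]
    rw [ContinuousLinearMap.det, ContinuousLinearMap.toLinearMap_smul, LinearMap.det_smul, abs_mul,
      abs_pow]
    simp [ContinuousLinearMap.det]
  have : ProperSpace (EuclideanSpace ℝ (Fin n) →L[ℝ] X) := FiniteDimensional.proper ℝ _
  obtain ⟨T, hT, hmax⟩ := (isCompact_closedBall (0 : EuclideanSpace ℝ (Fin n) →L[ℝ] X)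
    1).exists_isMaxOn ⟨0, by simp⟩ hDc.continuousOn
  have hT1 : ‖T‖ ≤ 1 := by simpa using hT
  have hall : ∀ R, D R ≤ ‖R‖ ^ n * D T := by
    intro R
    rcases eq_or_ne R 0 with rfl | hR
    · have := hDs 0 0
      rw [zero_smul, abs_zero, zero_pow hn.ne', zero_mul] at this
      rw [this, norm_zero, zero_pow hn.ne', zero_mul]
    · have hR0 := norm_pos_iff.2 hR
      have h1 : D (‖R‖⁻¹ • R) ≤ D T := hmax (by
        simp [norm_smul, hR0.ne'])
      calc D R = D (‖R‖ • ‖R‖⁻¹ • R) := by rw [smul_smul, mul_inv_cancel₀ hR0.ne', one_smul]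
        _ = ‖R‖ ^ n * D (‖R‖⁻¹ • R) := by rw [hDs, abs_norm]
        _ ≤ _ := by gcongr
  have hDe : D e = 1 := by
    have : (e.symm : X →L[ℝ] EuclideanSpace ℝ (Fin n)) ∘L
        (e : EuclideanSpace ℝ (Fin n) →L[ℝ] X) = ContinuousLinearMap.id ℝ _ := by
      ext x; simp
    simp only [hD]
    rw [this]
    simp [ContinuousLinearMap.det]
  have hDT : 0 < D T := by
    have h1 := hall e
    rw [hDe] at h1
    by_contra! h0
    have := mul_nonpos_of_nonneg_of_nonpos
      (pow_nonneg (norm_nonneg (e : EuclideanSpace ℝ (Fin n) →L[ℝ] X)) n) h0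
    linarith
  refine ⟨T, hT1, fun Q => ?_⟩
  have h1 := hall (T ∘L Q)
  have h2 : D (T ∘L Q) = |Q.det| * D T := by
    simp only [hD, ContinuousLinearMap.det]
    rw [← abs_mul, mul_comm, ← LinearMap.det_comp]
    rfl
  rw [h2] at h1
  exact le_of_mul_le_mul_right h1 hDT

/-- First order consequence of a determinant inequality at the identity. -/
lemma trace_le_of_det_sq_le {n : ℕ} (S : Matrix (Fin n) (Fin n) ℝ) (q C : ℝ)
    (h : ∀ t : ℝ, 0 < t → (1 + t • S).det ^ 2 ≤ (1 + 2 * t * q + t ^ 2 * C) ^ n) :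
    S.trace ≤ n * q := by
  obtain ⟨p, hp⟩ : ∃ p : Polynomial ℝ, ∀ t : ℝ,
      (1 + t • S).det = 1 + S.trace * t + p.eval t * t ^ 2 :=
    ⟨_, fun t => det_one_add_smul t S⟩
  set F : Polynomial ℝ := (1 + Polynomial.C (2 * q) * Polynomial.X +
    Polynomial.C C * Polynomial.X ^ 2) ^ n -
    (1 + Polynomial.C S.trace * Polynomial.X + p * Polynomial.X ^ 2) ^ 2 with hF
  have hF0 : F.eval 0 = 0 := by simp [hF]
  have hF' : F.derivative.eval 0 = n * (2 * q) - 2 * S.trace := by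
    simp [hF, Polynomial.derivative_pow]
  have hFt : ∀ t : ℝ, 0 < t → 0 ≤ F.eval t := by
    intro t ht
    have h1 := h t ht
    rw [hp] at h1
    have h2 : F.eval t = (1 + 2 * t * q + t ^ 2 * C) ^ n -
        (1 + S.trace * t + p.eval t * t ^ 2) ^ 2 := by
      simp [hF]; ring
    rw [h2]
    exact sub_nonneg.2 h1
  have hlim := (F.hasDerivAt 0).tendsto_slope_zero_right
  have h0 : 0 ≤ F.derivative.eval 0 := by
    refine ge_of_tendsto hlim ?_
    filter_upwards [self_mem_nhdsWithin] with t ht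
    rw [zero_add, hF0, sub_zero, smul_eq_mul]
    exact mul_nonneg (inv_nonneg.2 (le_of_lt ht)) (hFt t ht)
  rw [hF'] at h0
  linarith

lemma dotProduct_eq_inner {n : ℕ} (x y : EuclideanSpace ℝ (Fin n)) :
    x.ofLp ⬝ᵥ y.ofLp = inner ℝ x y := by
  rw [EuclideanSpace.inner_eq_star_dotProduct, dotProduct_comm]; simp

lemma dotProduct_self_eq_norm_sq {n : ℕ} (x : EuclideanSpace ℝ (Fin n)) :
    x.ofLp ⬝ᵥ x.ofLp = ‖x‖ ^ 2 := by
  rw [dotProduct_eq_inner, real_inner_self_eq_norm_sq]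

/-- The image of the dual unit ball under the adjoint of `T`, in coordinates. -/
def dualBallImage {n : ℕ} {X : Type*} [NormedAddCommGroup X] [NormedSpace ℝ X]
    (T : EuclideanSpace ℝ (Fin n) →L[ℝ] X) : Set (Fin n → ℝ) :=
  {u | ∃ f : X →L[ℝ] ℝ, ‖f‖ ≤ 1 ∧ ∀ x, f (T x) = u ⬝ᵥ x.ofLp}

section dualBallImage

variable {n : ℕ} {X : Type*} [NormedAddCommGroup X] [NormedSpace ℝ X]
  {T : EuclideanSpace ℝ (Fin n) →L[ℝ] X}

lemma dotProduct_self_le_one_of_mem_dualBallImage (hT : ‖T‖ ≤ 1) {u : Fin n → ℝ}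
    (hu : u ∈ dualBallImage T) : u ⬝ᵥ u ≤ 1 := by
  obtain ⟨f, hf, hfu⟩ := hu
  have h1 := hfu (WithLp.toLp 2 u)
  have h2 := dotProduct_self_eq_norm_sq (WithLp.toLp 2 u)
  simp only at h1 h2
  rw [h2] at h1 ⊢
  set r := ‖(WithLp.toLp 2 u : EuclideanSpace ℝ (Fin n))‖ with hr
  have h3 : f (T (WithLp.toLp 2 u)) ≤ r := by
    calc f (T (WithLp.toLp 2 u)) ≤ ‖f (T (WithLp.toLp 2 u))‖ := le_abs_self _
      _ ≤ 1 * (1 * r) := f.le_of_opNorm_le_of_le hf (T.le_of_opNorm_le hT _)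
      _ = r := by ring
  have h4 : 0 ≤ r := norm_nonneg _
  nlinarith

lemma exists_mem_dualBallImage (f : X →L[ℝ] ℝ) (hf : ‖f‖ ≤ 1) :
    ∃ u ∈ dualBallImage T, ∀ x, f (T x) = u ⬝ᵥ x.ofLp := by
  have h : ∀ x, f (T x) =
      ((InnerProductSpace.toDual ℝ _).symm (f ∘L T)).ofLp ⬝ᵥ x.ofLp := fun x => by
    rw [dotProduct_eq_inner, InnerProductSpace.toDual_symm_apply]; rfl
  exact ⟨_, ⟨f, hf, h⟩, h⟩

lemma isotropicallyRich_dualBallImage (hT : ‖T‖ ≤ 1)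
    (hmax : ∀ Q : EuclideanSpace ℝ (Fin n) →L[ℝ] EuclideanSpace ℝ (Fin n),
      |Q.det| ≤ ‖T ∘L Q‖ ^ n) : IsotropicallyRich (dualBallImage T) := by
  intro S q hq
  by_contra! hS
  refine absurd hq (not_lt.2 ?_)
  rw [← trace_transpose]
  have hq0 : 0 ≤ q := by
    simpa using hS 0 ⟨0, by simp, by simp⟩
  set L := toEuclideanCLM (𝕜 := ℝ) S with hL
  apply trace_le_of_det_sq_le Sᵀ q (‖L‖ ^ 2)
  intro t ht
  set A := 1 + t • Sᵀ with hA
  set m := 1 + 2 * t * q + t ^ 2 * ‖L‖ ^ 2 with hm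
  have hm0 : 0 ≤ m := by positivity
  have hdet : (toEuclideanCLM (𝕜 := ℝ) A).det = A.det := by
    have : ((toEuclideanCLM (𝕜 := ℝ) A : _ →L[ℝ] _) : _ →ₗ[ℝ] _) = toLin
        (EuclideanSpace.basisFun (Fin n) ℝ).toBasis (EuclideanSpace.basisFun (Fin n) ℝ).toBasis
        A := by
      rw [← toEuclideanLin_eq_toLin_orthonormal]; rfl
    rw [ContinuousLinearMap.det, this, LinearMap.det_toLin]
  have hnorm : ‖T ∘L toEuclideanCLM (𝕜 := ℝ) A‖ ≤ √m := by
    refine ContinuousLinearMap.opNorm_le_bound _ (Real.sqrt_nonneg _) fun x => ?_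
    obtain ⟨f, hf, hfx⟩ := exists_dual_vector'' ℝ (T (toEuclideanCLM (𝕜 := ℝ) A x))
    obtain ⟨u, hu, hfu⟩ := exists_mem_dualBallImage (T := T) f hf
    have hu1 := dotProduct_self_le_one_of_mem_dualBallImage hT hu
    have e1 : u ⬝ᵥ (toEuclideanCLM (𝕜 := ℝ) A x).ofLp = (u + t • (S *ᵥ u)) ⬝ᵥ x.ofLp := by
      rw [ofLp_toEuclideanCLM, dotProduct_mulVec, hA, vecMul_add, vecMul_one, vecMul_smul,
        vecMul_transpose]
    have e2 : (u + t • (S *ᵥ u)) ⬝ᵥ (u + t • (S *ᵥ u)) ≤ m := by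
      have h1 := hS u hu
      have h2 : (S *ᵥ u) ⬝ᵥ (S *ᵥ u) ≤ ‖L‖ ^ 2 := by
        have h3 := dotProduct_self_eq_norm_sq (L (WithLp.toLp 2 u))
        rw [hL, ofLp_toEuclideanCLM] at h3
        have h4 := dotProduct_self_eq_norm_sq (WithLp.toLp 2 u)
        simp only at h3 h4
        rw [h3, ← hL]
        have h5 : ‖(WithLp.toLp 2 u : EuclideanSpace ℝ (Fin n))‖ ≤ 1 := by
          rw [h4] at hu1
          exact (sq_le_one_iff₀ (norm_nonneg _)).1 hu1
        gcongr
        exact (L.le_of_opNorm_le_of_le le_rfl h5).trans_eq (mul_one _)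
      simp only [add_dotProduct, dotProduct_add, smul_dotProduct, dotProduct_smul, smul_eq_mul,
        dotProduct_comm (S *ᵥ u) u]
      rw [hm]
      nlinarith [mul_le_mul_of_nonneg_left h1 ht.le, mul_le_mul_of_nonneg_left h2 (sq_nonneg t)]
    have e3 := dotProduct_self_eq_norm_sq (WithLp.toLp 2 (u + t • (S *ᵥ u)))
    have e4 := dotProduct_eq_inner (WithLp.toLp 2 (u + t • (S *ᵥ u))) x
    simp only at e3 e4
    rw [e3] at e2
    have e5 : ‖T (toEuclideanCLM (𝕜 := ℝ) A x)‖ = f (T (toEuclideanCLM (𝕜 := ℝ) A x)) := by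
      rw [hfx]; rfl
    rw [ContinuousLinearMap.comp_apply, e5, hfu, e1, e4]
    exact (real_inner_le_norm _ _).trans (by gcongr; exact Real.le_sqrt_of_sq_le e2)
  have h1 := hmax (toEuclideanCLM (𝕜 := ℝ) A)
  rw [hdet] at h1
  calc A.det ^ 2 = |A.det| ^ 2 := (sq_abs _).symm
    _ ≤ ((√m) ^ n) ^ 2 := by gcongr; exact h1.trans (by gcongr)
    _ = m ^ n := by rw [← pow_mul, mul_comm, pow_mul, Real.sq_sqrt hm0]

end dualBallImage

/-- proportional Dvoretzky–Rogers factorization. For every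
`ε ∈ (0,1)` there is `C(ε) > 0` such that every `n`-dimensional real Banach space `X`
admits, for some `k > (1-ε)n`, operators `β : l₂ᵏ → X` and `α : X → l∞ᵏ` (here `l∞ᵏ` is
`Fin k → ℝ` with the sup norm) whose composition is the formal identity and with
`‖α‖ ‖β‖ ≤ C(ε)`. -/
theorem proportional_dvoretzky_rogers_factorization :
    ∀ ε : ℝ, ε ∈ Set.Ioo (0 : ℝ) 1 → ∃ C : ℝ, 0 < C ∧
      ∀ (n : ℕ), 0 < n →
      ∀ (X : Type) [NormedAddCommGroup X] [NormedSpace ℝ X] [FiniteDimensional ℝ X],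
        Module.finrank ℝ X = n →
      ∃ k : ℕ, (1 - ε) * n < k ∧
      ∃ (β : EuclideanSpace ℝ (Fin k) →L[ℝ] X) (α : X →L[ℝ] (Fin k → ℝ)),
        (∀ (a : EuclideanSpace ℝ (Fin k)) (i : Fin k), α (β a) i = a i) ∧
        ‖α‖ * ‖β‖ ≤ C := by
  rintro ε ⟨hε, hε1⟩
  obtain ⟨b, hb, H⟩ := exists_rowsBoundedBelow hε hε1
  refine ⟨√b⁻¹, by positivity, fun n hn X _ _ _ hX => ?_⟩
  obtain ⟨T, hT, hmax⟩ := exists_contraction_abs_det_le hn X hX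
  obtain ⟨k, hk, V, hV, hVb⟩ := H n hn (dualBallImage T) (isotropicallyRich_dualBallImage hT hmax)
    fun u hu => dotProduct_self_le_one_of_mem_dualBallImage hT hu
  obtain ⟨R, hVR, hR⟩ := hVb.exists_rightInverse hb
  choose f hf hfV using hV
  refine ⟨k, hk, T ∘L (toEuclideanLin R).toContinuousLinearMap, ContinuousLinearMap.pi f, ?_, ?_⟩
  · intro a i
    have : V i ⬝ᵥ (R *ᵥ a.ofLp) = ((V * R) *ᵥ a.ofLp) i := by rw [← mulVec_mulVec]; rfl
    simp only [ContinuousLinearMap.pi_apply, ContinuousLinearMap.comp_apply, hfV]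
    simpa [hVR] using this
  · have h1 : ‖ContinuousLinearMap.pi f‖ ≤ 1 := by
      refine ContinuousLinearMap.opNorm_le_bound _ zero_le_one fun x => ?_
      rw [one_mul, pi_norm_le_iff_of_nonneg (norm_nonneg _)]
      exact fun i => by simpa using (f i).le_of_opNorm_le (hf i) x
    have h2 : ‖T ∘L (toEuclideanLin R).toContinuousLinearMap‖ ≤ √b⁻¹ := by
      refine ContinuousLinearMap.opNorm_le_bound _ (Real.sqrt_nonneg _) fun x => ?_
      have h3 := hR x.ofLp
      have h4 : (R *ᵥ x.ofLp) ⬝ᵥ (R *ᵥ x.ofLp) = ‖toEuclideanLin R x‖ ^ 2 :=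
        dotProduct_self_eq_norm_sq (toEuclideanLin R x)
      have h5 : ‖toEuclideanLin R x‖ ≤ √b⁻¹ * ‖x‖ := by
        refine (abs_le_of_sq_le_sq' ?_ (by positivity)).2
        rw [mul_pow, Real.sq_sqrt (by positivity), ← h4, ← dotProduct_self_eq_norm_sq x]
        exact h3
      exact ((T.le_of_opNorm_le hT _).trans_eq (one_mul _)).trans h5
    exact (mul_le_mul h1 h2 (norm_nonneg _) zero_le_one).trans_eq (one_mul _)
end
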